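/- arXiv:1712.01502 — 3 statements merged into one kernel-verified Lean document; each statement's English description precedes it below -/
import Mathlib

section
/- For every α in the extended real interval [2, +∞] there exists a Brouwer homeomorphism f_α of the plane whose polynomial entropy equals α. -/
open Filter Topology Set
open scoped ENNReal

/-- `E` is `(n, ε)`-separated for `f`: any two distinct points of `E` are `ε`-apart at some
time `k ∈ {0, …, n-1}`. -/
def IsDynSeparated {X : Type*} [MetricSpace X] (f : X → X) (n : ℕ) (ε : ℝ) (E : Set X) : Prop :=
  ∀ x ∈ E, ∀ y ∈ E, x ≠ y → ∃ k < n, ε < dist (f^[k] x) (f^[k] y)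

/-- `S(n, ε)`: the maximal cardinality of an `(n, ε)`-separated set. -/
noncomputable def maxSep {X : Type*} [MetricSpace X] (f : X → X) (n : ℕ) (ε : ℝ) : ℕ :=
  sSup {m | ∃ E : Finset X, IsDynSeparated f n ε ↑E ∧ E.card = m}

/-- Polynomial entropy `h_pol(f) = lim_{ε → 0} limsup_n (log S(n,ε) / log n)`, a value in
`[0, ∞]`.  Since `ε ↦ limsup_n (log S(n,ε) / log n)` is nonincreasing in `ε`, the limit as
`ε → 0⁺` is the supremum over `ε > 0`. -/
noncomputable def polEntropy {X : Type*} [MetricSpace X] (f : X → X) : ℝ≥0∞ :=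
  ⨆ (ε : ℝ) (_ : 0 < ε),
    Filter.atTop.limsup fun n : ℕ =>
      ENNReal.ofReal (Real.log (maxSep f n ε) / Real.log n)

/-- An injective map `S² = ℝ² ∪ {∞} → ℝ² × ℝ` realizing the one-point compactification of
the plane as a compact subset of `ℝ³` (it is a homeomorphism onto its image, being a
continuous injection from a compact space to a Hausdorff space): `∞ ↦ ((0,0), 0)` and
`w ↦ ((1+‖w‖²)⁻¹ • w, (1+‖w‖²)⁻¹)`. -/
noncomputable def spherePoint : OnePoint (ℝ × ℝ) → (ℝ × ℝ) × ℝ :=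
  fun z => Option.elim z (((0 : ℝ), (0 : ℝ)), (0 : ℝ))
    (fun w => ((1 + ‖w‖ ^ 2)⁻¹ • w, (1 + ‖w‖ ^ 2)⁻¹))

lemma spherePoint_injective : Function.Injective spherePoint := by
  have key_pos : ∀ w : ℝ × ℝ, (0:ℝ) < (1 + ‖w‖ ^ 2)⁻¹ := fun w => by positivity
  intro a b hab
  cases a with
  | infty =>
    cases b with
    | infty => rfl
    | coe w =>
      exfalso
      have h2 := congrArg Prod.snd hab
      simp only [spherePoint, Option.elim] at h2
      exact (ne_of_gt (key_pos w)) h2.symm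
  | coe v =>
    cases b with
    | infty =>
      exfalso
      have h2 := congrArg Prod.snd hab
      simp only [spherePoint, Option.elim] at h2
      exact (ne_of_gt (key_pos v)) h2
    | coe w =>
      have h2 := congrArg Prod.snd hab
      have h1 := congrArg Prod.fst hab
      simp only [spherePoint, Option.elim] at h1 h2
      rw [h2] at h1
      exact congrArg _ (smul_right_injective (ℝ × ℝ) (ne_of_gt (key_pos w)) h1)

/-- A (compatible) metric on the one-point compactification `S² = ℝ² ∪ {∞}`, induced by the
embedding `spherePoint` of `S²` onto a compact subset of `ℝ³`; with it `S²` is a compact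
metric space, and its metric topology is the one-point-compactification topology. -/
noncomputable instance : MetricSpace (OnePoint (ℝ × ℝ)) :=
  MetricSpace.induced spherePoint spherePoint_injective inferInstance

/-- The extension of a plane map to the one-point compactification `S² = ℝ² ∪ {∞}`,
fixing `∞`. -/
def onePointExtend (g : ℝ × ℝ → ℝ × ℝ) : OnePoint (ℝ × ℝ) → OnePoint (ℝ × ℝ) :=
  Option.map g

/-- The translation `T(x,y) = (x+1, y)` of the plane. -/
def planeTranslation : ℝ × ℝ → ℝ × ℝ := fun z => (z.1 + 1, z.2)

/-- A Brouwer homeomorphism: a fixed-point-free homeomorphism of the plane which preserves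
orientation, equivalently is isotopic to the identity: there is a continuous family
`(H t)_{t ∈ [0,1]}` of homeomorphisms of the plane with `H 0 = id` and `H 1 = f`. -/
def IsBrouwer (f : (ℝ × ℝ) ≃ₜ (ℝ × ℝ)) : Prop :=
  (∀ z, f z ≠ z) ∧
  ∃ H : ℝ → (ℝ × ℝ) → (ℝ × ℝ),
    Continuous (fun q : ℝ × (ℝ × ℝ) => H q.1 q.2) ∧
    (∀ t ∈ Set.Icc (0 : ℝ) 1, ∃ g : (ℝ × ℝ) ≃ₜ (ℝ × ℝ), ⇑g = H t) ∧
    H 0 = id ∧ H 1 = ⇑f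

namespace BrouwerChain

/-- Clamp of the height to the unit interval. -/
noncomputable def lev (y : ℝ) : ℝ := max 0 (min y 1)

lemma lev_nonneg (y : ℝ) : 0 ≤ lev y := le_max_left _ _

lemma lev_le_one (y : ℝ) : lev y ≤ 1 := max_le zero_le_one (min_le_right _ _)

lemma lev_of_nonpos {y : ℝ} (h : y ≤ 0) : lev y = 0 :=
  max_eq_left ((min_le_left _ _).trans h)

lemma lev_pos {y : ℝ} (h : 0 < y) : 0 < lev y := lt_max_of_lt_right (lt_min h one_pos)

lemma lev_of_pos {y : ℝ} (h : 0 < y) : lev y = min y 1 :=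
  max_eq_right (lt_min h one_pos).le

lemma continuous_lev : Continuous lev := by unfold lev; fun_prop

/-- Position inside a column as a function of the time `s` and of the clamped height `w`. -/
noncomputable def prof (s w : ℝ) : ℝ := 2 * s / max 2 (1 + w + (1 - w) * |s|)

/-- The time as a function of the position inside a column. -/
noncomputable def profInv (r w : ℝ) : ℝ := r * max 1 ((1 + w) / (2 - (1 - w) * |r|))

/-- The time needed to cross a column, as a function of the clamped height. -/
noncomputable def period (w : ℝ) : ℝ := 2 * (1 + w) / w

/-- The inverse of the crossing time, written so as to vanish at height zero. -/
noncomputable def freq (w : ℝ) : ℝ := w / (2 * (1 + w))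

/-- Horizontal position reached at time `s`, starting in the middle of the column `0`. -/
noncomputable def colX (s w : ℝ) : ℝ :=
  4 * round (s * freq w) + prof (s - period w * round (s * freq w)) w

lemma prof_den_pos (s w : ℝ) : 0 < max 2 (1 + w + (1 - w) * |s|) :=
  lt_max_of_lt_left two_pos

lemma prof_neg (s w : ℝ) : prof (-s) w = -prof s w := by
  unfold prof; rw [abs_neg]; ring

lemma prof_of_abs_le_one {s w : ℝ} (hw1 : w ≤ 1) (hs : |s| ≤ 1) : prof s w = s := by
  unfold prof
  rw [max_eq_left (by nlinarith)]
  field_simp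

lemma prof_strictMono {w : ℝ} (hw0 : 0 ≤ w) (hw1 : w ≤ 1) : StrictMono fun s => prof s w := by
  have key : ∀ s t : ℝ, 0 ≤ s → s < t → prof s w < prof t w := by
    intro s t hs hst
    unfold prof
    rw [div_lt_div_iff₀ (prof_den_pos _ _) (prof_den_pos _ _), abs_of_nonneg hs,
      abs_of_nonneg (hs.trans hst.le)]
    have h1 : 2 ≤ max 2 (1 + w + (1 - w) * s) := le_max_left _ _
    have h2 : 1 + w + (1 - w) * s ≤ max 2 (1 + w + (1 - w) * s) := le_max_right _ _
    have ht : 0 < t := hs.trans_lt hst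
    rcases max_cases 2 (1 + w + (1 - w) * t) with ⟨h, -⟩ | ⟨h, -⟩ <;> rw [h] <;> nlinarith
  intro s t hst
  change prof s w < prof t w
  rcases le_or_gt 0 s with hs | hs
  · exact key s t hs hst
  · rcases le_or_gt 0 t with ht | ht
    · have h1 : prof s w < 0 := div_neg_of_neg_of_pos (by linarith) (prof_den_pos _ _)
      have h2 : 0 ≤ prof t w := div_nonneg (by linarith) (prof_den_pos _ _).le
      linarith
    · have := key (-t) (-s) (by linarith) (by linarith)
      rw [prof_neg, prof_neg] at this
      linarith

lemma continuous_prof : Continuous fun q : ℝ × ℝ => prof q.1 q.2 := by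
  unfold prof
  refine Continuous.div (by fun_prop) (by fun_prop) fun q => (prof_den_pos _ _).ne'

lemma abs_prof_lt_two {s w : ℝ} (h : w * |s| < 1 + w) : |prof s w| < 2 := by
  unfold prof
  rw [abs_div, abs_of_pos (prof_den_pos s w), div_lt_iff₀ (prof_den_pos _ _), abs_mul,
    abs_of_pos (two_pos : (0:ℝ) < 2)]
  have h2 : 1 + w + (1 - w) * |s| ≤ max 2 (1 + w + (1 - w) * |s|) := le_max_right _ _
  nlinarith

lemma prof_half_period {w : ℝ} (hw0 : 0 < w) (hw1 : w ≤ 1) : prof (period w / 2) w = 2 := by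
  have h1 : period w / 2 = (1 + w) / w := by unfold period; ring
  have h2 : 0 < (1 + w) / w := by positivity
  rw [h1]
  unfold prof
  rw [abs_of_pos h2]
  have h3 : 1 + w + (1 - w) * ((1 + w) / w) = (1 + w) / w := by field_simp; ring
  rw [h3, max_eq_right]
  · field_simp
  · rw [le_div_iff₀ hw0]; linarith

lemma freq_nonneg {w : ℝ} (hw0 : 0 ≤ w) : 0 ≤ freq w := by unfold freq; positivity

lemma period_mul_freq {w : ℝ} (hw0 : 0 < w) : period w * freq w = 1 := by
  unfold period freq; field_simp

lemma colX_of_round {s w : ℝ} (h : |s * freq w| < 1 / 2) : colX s w = prof s w := by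
  have : round (s * freq w) = 0 := by
    rw [round_eq_zero_iff]; rw [abs_lt] at h; exact ⟨h.1.le, h.2⟩
  unfold colX; rw [this]; simp

lemma prof_mem {s w : ℝ} (hw0 : 0 ≤ w) (hw1 : w ≤ 1) (h : s * freq w ∈ Ico (-(1 / 2) : ℝ) (1 / 2)) :
    -2 ≤ prof s w ∧ prof s w < 2 := by
  rcases hw0.eq_or_lt with rfl | hw
  · have := abs_lt.1 (abs_prof_lt_two (s := s) (w := 0) (by simp))
    exact ⟨this.1.le, this.2⟩
  · have hp := period_mul_freq hw
    have hf : 0 < freq w := by unfold freq; positivity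
    have h1 : -(period w / 2) ≤ s := by
      have := h.1; by_contra hc; push Not at hc
      nlinarith
    have h2 : s < period w / 2 := by
      have := h.2; by_contra hc; push Not at hc
      nlinarith
    have m := prof_strictMono hw.le hw1
    have e := prof_half_period hw hw1
    constructor
    · have := m.monotone h1
      simp only [prof_neg, e] at this; exact this
    · have := m h2
      simp only [e] at this; exact this

lemma sub_round_freq_mem {s w : ℝ} (hw0 : 0 ≤ w) :
    (s - period w * round (s * freq w)) * freq w ∈ Ico (-(1 / 2) : ℝ) (1 / 2) := by
  rcases hw0.eq_or_lt with rfl | hw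
  · simp [freq]
  · have hp := period_mul_freq hw
    have := (round_eq_iff (x := s * freq w)).1 rfl
    have e : (s - period w * round (s * freq w)) * freq w = s * freq w - round (s * freq w) := by
      linear_combination (-(round (s * freq w) : ℝ)) * hp
    rw [e]
    constructor
    · linarith [this.1]
    · linarith [this.2]

lemma colX_strictMono {w : ℝ} (hw0 : 0 ≤ w) (hw1 : w ≤ 1) : StrictMono fun s => colX s w := by
  intro s t hst
  change colX s w < colX t w
  have hs := prof_mem hw0 hw1 (sub_round_freq_mem (s := s) hw0)
  have ht := prof_mem hw0 hw1 (sub_round_freq_mem (s := t) hw0)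
  have hle : round (s * freq w) ≤ round (t * freq w) := by
    simp only [round_eq]
    apply Int.floor_le_floor
    have := mul_le_mul_of_nonneg_right hst.le (freq_nonneg hw0)
    linarith
  unfold colX
  rcases hle.eq_or_lt with h | h
  · rw [h]
    have := prof_strictMono hw0 hw1
      (show s - period w * round (t * freq w) < t - period w * round (t * freq w) by linarith)
    simp only at this
    linarith
  · have : (round (s * freq w) : ℝ) + 1 ≤ round (t * freq w) := by exact_mod_cast h
    linarith [hs.2, ht.1]

lemma colX_add_period {s w : ℝ} (hw : 0 < w) (j : ℤ) :
    colX (s + period w * j) w = colX s w + 4 * j := by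
  have hp := period_mul_freq hw
  have e : (s + period w * j) * freq w = s * freq w + j := by
    linear_combination (j : ℝ) * hp
  unfold colX
  rw [e, round_add_intCast]
  push_cast
  have : s + period w * j - period w * (round (s * freq w) + j)
    = s - period w * round (s * freq w) := by ring
  rw [this]; ring

lemma continuous_colX : Continuous fun q : ℝ × ℝ => colX q.1 (lev q.2) := by
  have cf : Continuous fun q : ℝ × ℝ => freq (lev q.2) := by
    unfold freq
    refine Continuous.div (continuous_lev.comp continuous_snd)
      (continuous_const.mul (continuous_const.add (continuous_lev.comp continuous_snd))) fun q => ?_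
    have := lev_nonneg q.2; positivity
  rw [continuous_iff_continuousAt]
  rintro ⟨s, y⟩
  rcases le_or_gt y 0 with hy | hy
  · have h0 : ∀ᶠ q : ℝ × ℝ in 𝓝 (s, y), |q.1 * freq (lev q.2)| < 1 / 2 := by
      refine ContinuousAt.eventually_lt (Continuous.continuousAt (by fun_prop)) continuousAt_const ?_
      simp [lev_of_nonpos hy, freq]
    refine ContinuousAt.congr (f := fun q : ℝ × ℝ => prof q.1 (lev q.2)) ?_
      (h0.mono fun q hq => (colX_of_round hq).symm)
    exact (continuous_prof.comp (continuous_fst.prodMk (continuous_lev.comp continuous_snd))).continuousAt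
  · let P := {q : ℝ × ℝ // 0 < q.2}
    have cl : Continuous fun q : P => lev q.1.2 :=
      continuous_lev.comp (continuous_snd.comp continuous_subtype_val)
    have cp : Continuous fun q : P => period (lev q.1.2) := by
      unfold period
      exact Continuous.div (by fun_prop) cl fun q => (lev_pos q.2).ne'
    have key : Continuous fun q : P => (fun (q : P) (φ : ℝ) =>
        prof (period (lev q.1.2) * (φ - 1 / 2)) (lev q.1.2) - 4 * (φ - 1 / 2)) q
          (Int.fract (q.1.1 * freq (lev q.1.2) + 1 / 2)) := by
      refine ContinuousOn.comp_fract (f := fun (q : P) (φ : ℝ) =>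
        prof (period (lev q.1.2) * (φ - 1 / 2)) (lev q.1.2) - 4 * (φ - 1 / 2)) ?_ ?_ ?_
      · have c2 : Continuous fun x : P × ℝ =>
            ((period (lev x.1.1.2) * (x.2 - 1 / 2), lev x.1.1.2) : ℝ × ℝ) :=
          ((cp.comp continuous_fst).mul (by fun_prop)).prodMk (cl.comp continuous_fst)
        exact ((continuous_prof.comp c2).sub
          (show Continuous fun x : P × ℝ => 4 * (x.2 - 1 / 2) by fun_prop)).continuousOn
      · exact (Continuous.mul (by fun_prop) (cf.comp continuous_subtype_val)).add continuous_const
      · intro q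
        have h := prof_half_period (lev_pos q.2) (lev_le_one _)
        have e0 : period (lev q.1.2) * (0 - 1 / 2) = -(period (lev q.1.2) / 2) := by ring
        have e1 : period (lev q.1.2) * (1 - 1 / 2) = period (lev q.1.2) / 2 := by ring
        simp only [e0, e1, prof_neg, h]
        norm_num
    have key2 : Continuous fun q : P => colX q.1.1 (lev q.1.2) := by
      have c4 : Continuous fun q : P => 4 * (q.1.1 * freq (lev q.1.2)) :=
        continuous_const.mul (Continuous.mul (by fun_prop) (cf.comp continuous_subtype_val))
      refine (c4.add key).congr fun q => ?_
      have hp := period_mul_freq (lev_pos q.2)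
      simp only [Pi.add_apply, colX, round_eq, Int.fract]
      set m : ℝ := (⌊q.1.1 * freq (lev q.1.2) + 1 / 2⌋ : ℝ)
      have : period (lev q.1.2) * (q.1.1 * freq (lev q.1.2) + 1 / 2 - m - 1 / 2)
        = q.1.1 - period (lev q.1.2) * m := by linear_combination q.1.1 * hp
      rw [this]; ring
    have ho : IsOpen {q : ℝ × ℝ | 0 < q.2} := isOpen_lt continuous_const continuous_snd
    have : ContinuousOn (fun q : ℝ × ℝ => colX q.1 (lev q.2)) {q : ℝ × ℝ | 0 < q.2} := by
      rw [continuousOn_iff_continuous_domRestrict]; exact key2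
    exact this.continuousAt (ho.mem_nhds hy)

lemma freq_lt {w : ℝ} (hw0 : 0 ≤ w) (hw1 : w ≤ 1) : freq w ≤ 1 / 4 := by
  unfold freq; rw [div_le_iff₀ (by positivity)]; linarith

lemma prof_profInv {r w : ℝ} (hw0 : 0 ≤ w) (hw1 : w ≤ 1) (hr : |r| ≤ 2) (h : |r| = 2 → 0 < w) :
    prof (profInv r w) w = r := by
  have hd : 0 < 2 - (1 - w) * |r| := by
    rcases hr.eq_or_lt with e | e
    · have := h e; rw [e]; linarith
    · nlinarith [abs_nonneg r]
  rcases le_or_gt |r| 1 with h1 | h1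
  · have : profInv r w = r := by
      unfold profInv
      rw [max_eq_left]
      · ring
      · rw [div_le_one hd]; nlinarith
    rw [this, prof_of_abs_le_one hw1 h1]
  · have e : profInv r w = r * ((1 + w) / (2 - (1 - w) * |r|)) := by
      unfold profInv
      rw [max_eq_right]
      rw [le_div_iff₀ hd]; nlinarith
    have hq : 0 < (1 + w) / (2 - (1 - w) * |r|) := by positivity
    rw [e]
    unfold prof
    rw [abs_mul, abs_of_pos hq]
    have e2 : 1 + w + (1 - w) * (|r| * ((1 + w) / (2 - (1 - w) * |r|)))
      = 2 * ((1 + w) / (2 - (1 - w) * |r|)) := by field_simp; ring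
    rw [e2, max_eq_right]
    · field_simp
    · have : 1 ≤ (1 + w) / (2 - (1 - w) * |r|) := by rw [le_div_iff₀ hd]; nlinarith
      linarith

lemma profInv_freq_mem {r w : ℝ} (hw0 : 0 ≤ w) (hw1 : w ≤ 1) (hr : r ∈ Ico (-2 : ℝ) 2)
    (h : r = -2 → 0 < w) : profInv r w * freq w ∈ Ico (-(1 / 2) : ℝ) (1 / 2) := by
  have hf := freq_lt hw0 hw1
  have hf0 := freq_nonneg hw0
  have hr2 : |r| ≤ 2 := abs_le.2 ⟨hr.1, hr.2.le⟩
  have hd : 0 < 2 - (1 - w) * |r| := by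
    rcases hr2.eq_or_lt with e | e
    · have : r = -2 := by
        rcases abs_cases r with ⟨h', _⟩ | ⟨h', _⟩
        · linarith [hr.2]
        · linarith
      have := h this; rw [e]; linarith
    · nlinarith [abs_nonneg r]
  unfold profInv
  rcases max_cases 1 ((1 + w) / (2 - (1 - w) * |r|)) with ⟨e, h1⟩ | ⟨e, h1⟩
  · rw [e]
    have h1 : |r| ≤ 1 ∨ w = 1 := by
      rw [div_le_one hd] at h1
      by_contra hc; push Not at hc
      have : w < 1 := lt_of_le_of_ne hw1 hc.2
      nlinarith [hc.1]
    constructor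
    · nlinarith [hr.1, hr.2]
    · nlinarith [hr.1, hr.2]
  · rw [e]
    have : r * ((1 + w) / (2 - (1 - w) * |r|)) * freq w = r * w / (2 * (2 - (1 - w) * |r|)) := by
      unfold freq; field_simp
    rw [this]
    constructor
    · rw [le_div_iff₀ (by linarith)]
      rcases abs_cases r with ⟨h', _⟩ | ⟨h', _⟩ <;> rw [h'] <;> nlinarith [hr.1, hr.2]
    · rw [div_lt_iff₀ (by linarith)]
      rcases abs_cases r with ⟨h', _⟩ | ⟨h', _⟩ <;> rw [h'] <;> nlinarith [hr.1, hr.2]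

lemma colX_profInv {r w : ℝ} (hw0 : 0 ≤ w) (hw1 : w ≤ 1) (hr : r ∈ Ico (-2 : ℝ) 2)
    (h : r = -2 → 0 < w) : colX (profInv r w) w = r := by
  have h1 : round (profInv r w * freq w) = 0 :=
    round_eq_zero_iff.2 (profInv_freq_mem hw0 hw1 hr h)
  have h2 : prof (profInv r w) w = r := by
    refine prof_profInv hw0 hw1 (abs_le.2 ⟨hr.1, hr.2.le⟩) fun e => h ?_
    rcases abs_cases r with ⟨h', _⟩ | ⟨h', _⟩
    · linarith [hr.2]
    · linarith
  unfold colX; rw [h1]; simpa using h2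

lemma colX_of_abs_le_one {s w : ℝ} (hw0 : 0 ≤ w) (hw1 : w ≤ 1) (hs : |s| ≤ 1) : colX s w = s := by
  rw [colX_of_round, prof_of_abs_le_one hw1 hs]
  rw [abs_mul, abs_of_nonneg (freq_nonneg hw0)]
  have := freq_lt hw0 hw1
  nlinarith [abs_nonneg s, freq_nonneg hw0]

end BrouwerChain

namespace BrouwerChain

/-- A `4`-periodic function whose zeros are the walls between the columns. -/
noncomputable def hgt (x : ℝ) : ℝ := |Real.cos (Real.pi * x / 4)|

/-- The function whose level sets carry the orbits of the flow. -/
noncomputable def level (p : ℝ × ℝ) : ℝ := Real.exp p.2 - hgt p.1 * Real.exp (-p.2)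

/-- The vertical coordinate of the point of abscissa `x` at level `y`. -/
noncomputable def ucoord (x y : ℝ) : ℝ := Real.log ((y + √(y ^ 2 + 4 * hgt x)) / 2)

/-- Abscissa at time `s` when starting at time `0` in the middle of column `i`. -/
noncomputable def posX (i : ℤ) (s y : ℝ) : ℝ := 4 * i + colX s (lev y)

/-- The point at time `s` and level `y`, starting at time `0` in the middle of column `i`. -/
noncomputable def chart (i : ℤ) (q : ℝ × ℝ) : ℝ × ℝ :=
  (posX i q.1 q.2, ucoord (posX i q.1 q.2) q.2)

lemma hgt_nonneg (x : ℝ) : 0 ≤ hgt x := abs_nonneg _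

lemma continuous_hgt : Continuous hgt := by unfold hgt; fun_prop

lemma hgt_four_mul_add (i : ℤ) (r : ℝ) : hgt (4 * i + r) = |Real.cos (Real.pi * r / 4)| := by
  unfold hgt
  have : Real.pi * (4 * i + r) / 4 = Real.pi * r / 4 + i * Real.pi := by ring
  rw [this, Real.cos_add_int_mul_pi, abs_mul, abs_zpow]
  simp

lemma hgt_pos {i : ℤ} {r : ℝ} (h : |r| < 2) : 0 < hgt (4 * i + r) := by
  rw [hgt_four_mul_add]
  have := abs_lt.1 h
  have hp := Real.pi_pos
  refine abs_pos.2 (Real.cos_pos_of_mem_Ioo ⟨?_, ?_⟩).ne' <;> nlinarith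

lemma hgt_wall (i : ℤ) : hgt (4 * i + (-2)) = 0 := by
  rw [hgt_four_mul_add]
  have : Real.pi * (-2) / 4 = -(Real.pi / 2) := by ring
  rw [this]; simp

lemma continuous_level : Continuous level := by
  have := continuous_hgt
  unfold level; fun_prop

lemma level_strictMono (x : ℝ) : StrictMono fun u => level (x, u) := by
  intro u v h
  simp only [level]
  have h1 := Real.exp_lt_exp.2 h
  have h2 := Real.exp_le_exp.2 (neg_le_neg h.le)
  nlinarith [hgt_nonneg x]

lemma hgt_pos_of_level_nonpos {p : ℝ × ℝ} (h : level p ≤ 0) : 0 < hgt p.1 := by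
  unfold level at h
  by_contra hc
  have : hgt p.1 = 0 := le_antisymm (not_lt.1 hc) (hgt_nonneg _)
  rw [this] at h
  linarith [Real.exp_pos p.2]

lemma ucoord_level (p : ℝ × ℝ) : ucoord p.1 (level p) = p.2 := by
  unfold ucoord level
  have e : Real.exp p.2 * Real.exp (-p.2) = 1 := by rw [← Real.exp_add]; simp
  have : (Real.exp p.2 - hgt p.1 * Real.exp (-p.2)) ^ 2 + 4 * hgt p.1
      = (Real.exp p.2 + hgt p.1 * Real.exp (-p.2)) ^ 2 := by
    linear_combination (-4 * hgt p.1) * e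
  rw [this, Real.sqrt_sq]
  · rw [show (Real.exp p.2 - hgt p.1 * Real.exp (-p.2) + (Real.exp p.2 + hgt p.1 * Real.exp (-p.2))) / 2
      = Real.exp p.2 by ring, Real.log_exp]
  · have := hgt_nonneg p.1; positivity

lemma ucoord_arg_pos {x y : ℝ} (h : 0 < y ∨ 0 < hgt x) : 0 < (y + √(y ^ 2 + 4 * hgt x)) / 2 := by
  have hg := hgt_nonneg x
  rcases h with h | h
  · have := Real.sqrt_nonneg (y ^ 2 + 4 * hgt x); linarith
  · have : |y| < √(y ^ 2 + 4 * hgt x) := by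
      rw [Real.lt_sqrt (abs_nonneg _), sq_abs]; linarith
    linarith [neg_abs_le y]

lemma level_ucoord {x y : ℝ} (h : 0 < y ∨ 0 < hgt x) : level (x, ucoord x y) = y := by
  have hp := ucoord_arg_pos h
  unfold level ucoord
  simp only
  rw [Real.exp_neg, Real.exp_log hp]
  have hs := Real.sq_sqrt (show 0 ≤ y ^ 2 + 4 * hgt x by have := hgt_nonneg x; positivity)
  rw [sub_eq_iff_eq_add, ← div_eq_mul_inv, ← sub_eq_iff_eq_add', eq_div_iff hp.ne']
  nlinarith

lemma ucoord_lt {x y z : ℝ} (h : 0 < y ∨ 0 < hgt x) (hyz : y < z) : ucoord x y < ucoord x z := by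
  have h' : 0 < z ∨ 0 < hgt x := h.imp_left fun h => h.trans hyz
  rw [← (level_strictMono x).lt_iff_lt]
  simp only [level_ucoord h, level_ucoord h', hyz]

lemma continuousAt_ucoord {x y : ℝ} (h : 0 < y ∨ 0 < hgt x) :
    ContinuousAt (fun q : ℝ × ℝ => ucoord q.1 q.2) (x, y) := by
  unfold ucoord
  refine ContinuousAt.log ?_ (ucoord_arg_pos h).ne'
  have := continuous_hgt
  exact Continuous.continuousAt (by fun_prop)

lemma abs_colX_zero_lt (s : ℝ) : |colX s 0| < 2 := by
  rw [colX_of_round (by simp [freq])]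
  exact abs_prof_lt_two (w := 0) (by simp)

lemma chart_good (i : ℤ) (s y : ℝ) : 0 < y ∨ 0 < hgt (posX i s y) := by
  rcases lt_or_ge 0 y with h | h
  · exact Or.inl h
  · right
    unfold posX
    rw [lev_of_nonpos h]
    exact hgt_pos (abs_colX_zero_lt s)

lemma level_chart (i : ℤ) (q : ℝ × ℝ) : level (chart i q) = q.2 :=
  level_ucoord (chart_good i q.1 q.2)

lemma posX_strictMono (i : ℤ) (y : ℝ) : StrictMono fun s => posX i s y := by
  intro s t h
  have := colX_strictMono (lev_nonneg y) (lev_le_one y) h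
  simp only [posX] at this ⊢
  linarith

lemma continuous_posX (i : ℤ) : Continuous fun q : ℝ × ℝ => posX i q.1 q.2 :=
  continuous_const.add continuous_colX

lemma posX_of_abs_le_one (i : ℤ) {s y : ℝ} (h : |s| ≤ 1) : posX i s y = 4 * i + s := by
  unfold posX; rw [colX_of_abs_le_one (lev_nonneg y) (lev_le_one y) h]

lemma posX_shift (i j : ℤ) {s y : ℝ} (hy : 0 < y) :
    posX j s y = posX i (s + period (lev y) * (j - i : ℤ)) y := by
  unfold posX
  rw [colX_add_period (lev_pos hy)]; push_cast; ring

lemma chart_shift (i j : ℤ) {s y : ℝ} (hy : 0 < y) :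
    chart j (s, y) = chart i (s + period (lev y) * (j - i : ℤ), y) := by
  unfold chart; simp only [posX_shift i j hy]

lemma chart_eq_of_posX {i : ℤ} {s : ℝ} {p : ℝ × ℝ} (h : posX i s (level p) = p.1) :
    chart i (s, level p) = p := by
  unfold chart; simp only [h, ucoord_level]

lemma continuous_chart (i : ℤ) : Continuous (chart i) := by
  refine (continuous_posX i).prodMk (continuous_iff_continuousAt.2 fun q => ?_)
  exact ContinuousAt.comp (g := fun q : ℝ × ℝ => ucoord q.1 q.2)
    (f := fun q : ℝ × ℝ => (posX i q.1 q.2, q.2)) (continuousAt_ucoord (chart_good i q.1 q.2))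
    ((continuous_posX i).prodMk continuous_snd).continuousAt

lemma exists_chart_eq_of_between {i : ℤ} {a b : ℝ} {p : ℝ × ℝ} (hab : a ≤ b)
    (h1 : posX i a (level p) ≤ p.1) (h2 : p.1 ≤ posX i b (level p)) :
    ∃ t ∈ Icc a b, chart i (t, level p) = p := by
  have hcs : ContinuousOn (fun t => posX i t (level p)) (Icc a b) :=
    (((continuous_posX i).comp
      (show Continuous fun t : ℝ => (t, level p) by fun_prop) :)).continuousOn
  obtain ⟨t, ht, he⟩ := intermediate_value_Icc hab hcs ⟨h1, h2⟩
  exact ⟨t, ht, chart_eq_of_posX he⟩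

lemma continuous_posX_level (i : ℤ) (t : ℝ) : Continuous fun p : ℝ × ℝ => posX i t (level p) :=
  ((continuous_posX i).comp
    (show Continuous fun p : ℝ × ℝ => (t, level p) from continuous_const.prodMk continuous_level) :)

lemma chart_image_mem_nhds {i : ℤ} {s y : ℝ} {p₀ : ℝ × ℝ} (hp : posX i s y = p₀.1)
    (hl : level p₀ = y) {U : Set (ℝ × ℝ)} (hU : U ∈ 𝓝 (s, y)) : chart i '' U ∈ 𝓝 p₀ := by
  obtain ⟨ε, hε, hb⟩ := Metric.mem_nhds_iff.1 hU
  have e1 : ∀ᶠ p in 𝓝 p₀, posX i (s - ε / 2) (level p) < p.1 := by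
    refine (continuous_posX_level i _).continuousAt.eventually_lt
      continuous_fst.continuousAt ?_
    rw [hl, ← hp]
    exact posX_strictMono i y (by linarith)
  have e2 : ∀ᶠ p in 𝓝 p₀, p.1 < posX i (s + ε / 2) (level p) := by
    refine continuous_fst.continuousAt.eventually_lt
      (continuous_posX_level i _).continuousAt ?_
    rw [hl, ← hp]
    exact posX_strictMono i y (by linarith)
  have e3 : ∀ᶠ p in 𝓝 p₀, |level p - y| < ε := by
    have hc : Continuous fun p => |level p - y| := (continuous_level.sub continuous_const).abs
    refine hc.continuousAt.eventually_lt continuousAt_const ?_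
    rw [hl]; simpa using hε
  filter_upwards [e1, e2, e3] with p h1 h2 h3
  obtain ⟨t, ht, he⟩ := exists_chart_eq_of_between (by linarith) h1.le h2.le
  refine ⟨(t, level p), hb ?_, he⟩
  rw [Metric.mem_ball, Prod.dist_eq, max_lt_iff, Real.dist_eq, Real.dist_eq]
  refine ⟨abs_lt.2 ⟨?_, ?_⟩, h3⟩
  · have := ht.1; simp only; linarith
  · have := ht.2; simp only; linarith

lemma isOpenMap_chart (i : ℤ) : IsOpenMap (chart i) := by
  intro U hU
  rw [isOpen_iff_mem_nhds]
  rintro _ ⟨q, hq, rfl⟩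
  exact chart_image_mem_nhds (s := q.1) (y := q.2) rfl (level_chart i q) (hU.mem_nhds hq)

/-- The index of the column containing `p`. -/
noncomputable def secI (p : ℝ × ℝ) : ℤ := round (p.1 / 4)

/-- The time of `p` in the chart of its column. -/
noncomputable def secS (p : ℝ × ℝ) : ℝ := profInv (p.1 - 4 * secI p) (lev (level p))

lemma secI_mem (p : ℝ × ℝ) : p.1 - 4 * secI p ∈ Ico (-2 : ℝ) 2 := by
  have := (round_eq_iff (x := p.1 / 4)).1 (rfl : _ = secI p)
  exact ⟨by linarith [this.1], by linarith [this.2]⟩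

lemma sec_wall {p : ℝ × ℝ} (h : p.1 - 4 * secI p = -2) : 0 < lev (level p) := by
  refine lev_pos (not_le.1 fun hn => ?_)
  have h1 := hgt_pos_of_level_nonpos hn
  rw [show p.1 = 4 * secI p + (-2) by linarith, hgt_wall] at h1
  exact lt_irrefl _ h1

lemma chart_sec (p : ℝ × ℝ) : chart (secI p) (secS p, level p) = p := by
  apply chart_eq_of_posX
  unfold posX secS
  rw [colX_profInv (lev_nonneg _) (lev_le_one _) (secI_mem p) sec_wall]
  ring

lemma posX_eq_of_nonpos {i j : ℤ} {s t y : ℝ} (hy : y ≤ 0) (h : posX i s y = posX j t y) :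
    i = j ∧ s = t := by
  have hij : i = j := by
    unfold posX at h
    rw [lev_of_nonpos hy] at h
    have h1 := abs_lt.1 (abs_colX_zero_lt s)
    have h2 := abs_lt.1 (abs_colX_zero_lt t)
    have h3 : (i : ℝ) - j < 1 := by linarith
    have h4 : (j : ℝ) - i < 1 := by linarith
    have h5 : i - j < 1 := by exact_mod_cast h3
    have h6 : j - i < 1 := by exact_mod_cast h4
    omega
  subst hij
  exact ⟨rfl, (posX_strictMono i y).injective h⟩

/-- The flow. -/
noncomputable def flow (t : ℝ) (p : ℝ × ℝ) : ℝ × ℝ := chart (secI p) (secS p + t, level p)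

lemma flow_chart (t : ℝ) (i : ℤ) (s y : ℝ) : flow t (chart i (s, y)) = chart i (s + t, y) := by
  have h := chart_sec (chart i (s, y))
  have hx : posX (secI (chart i (s, y))) (secS (chart i (s, y))) y = posX i s y := by
    have := congrArg Prod.fst h
    simpa only [chart, level_ucoord (chart_good i s y)] using this
  unfold flow
  rw [level_chart]
  simp only
  rcases lt_or_ge 0 y with hy | hy
  · rw [posX_shift i _ hy] at hx
    have := (posX_strictMono i y).injective hx
    rw [chart_shift i _ hy]
    congr 2; linarith
  · obtain ⟨h1, h2⟩ := posX_eq_of_nonpos hy hx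
    rw [h1, h2]

lemma exists_chart (p : ℝ × ℝ) : ∃ i s y, p = chart i (s, y) := ⟨_, _, _, (chart_sec p).symm⟩

lemma flow_zero : flow 0 = id := by
  ext1 p
  obtain ⟨i, s, y, rfl⟩ := exists_chart p
  rw [flow_chart, add_zero, id]

lemma flow_neg_flow (t : ℝ) (p : ℝ × ℝ) : flow (-t) (flow t p) = p := by
  obtain ⟨i, s, y, rfl⟩ := exists_chart p
  rw [flow_chart, flow_chart, add_neg_cancel_right]

lemma continuous_flow : Continuous fun q : ℝ × (ℝ × ℝ) => flow q.1 q.2 := by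
  rw [continuous_iff_continuousAt]
  rintro ⟨t, p⟩
  obtain ⟨i, s, y, rfl⟩ := exists_chart p
  have ho : IsOpenMap (Prod.map (id : ℝ → ℝ) (chart i)) := IsOpenMap.id.prodMap (isOpenMap_chart i)
  have h1 := ho.nhds_le (t, (s, y))
  refine Tendsto.mono_left ?_ h1
  rw [tendsto_map'_iff]
  have hc : Continuous fun q : ℝ × (ℝ × ℝ) => chart i (q.2.1 + q.1, q.2.2) :=
    (continuous_chart i).comp (by fun_prop)
  have := hc.tendsto (t, (s, y))
  have e : ((fun q : ℝ × (ℝ × ℝ) => flow q.1 q.2) ∘ Prod.map (id : ℝ → ℝ) (chart i))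
      = fun q : ℝ × (ℝ × ℝ) => chart i (q.2.1 + q.1, q.2.2) := by
    ext1 q
    simp only [Function.comp, Prod.map, id]
    exact flow_chart _ _ _ _
  rw [e]
  change Tendsto _ _ (𝓝 (flow t (chart i (s, y))))
  rw [flow_chart]
  exact this

lemma continuous_flow_const (t : ℝ) : Continuous (flow t) :=
  (continuous_flow.comp (g := fun q : ℝ × (ℝ × ℝ) => flow q.1 q.2)
    (f := fun p : ℝ × ℝ => (t, p)) (by fun_prop) :)

/-- The time `t` map of the flow. -/
noncomputable def flowHomeo (t : ℝ) : (ℝ × ℝ) ≃ₜ (ℝ × ℝ) where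
  toFun := flow t
  invFun := flow (-t)
  left_inv := flow_neg_flow t
  right_inv p := by simpa using flow_neg_flow (-t) p
  continuous_toFun := continuous_flow_const t
  continuous_invFun := continuous_flow_const (-t)

end BrouwerChain

namespace BrouwerChain

/-- A bump function supported in the gates `4i ≤ x ≤ 4i + 1`. -/
noncomputable def bump (x : ℝ) : ℝ :=
  max 0 (min (8 * Int.fract (x / 4)) (2 - 8 * Int.fract (x / 4)))

lemma fract_div_four (i : ℤ) {s : ℝ} (h0 : 0 ≤ s) (h4 : s < 4) :
    Int.fract ((4 * i + s) / 4) = s / 4 := by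
  rw [Int.fract_eq_iff]
  refine ⟨by linarith, by linarith, i, by ring⟩

lemma bump_eq (i : ℤ) {s : ℝ} (h0 : 0 ≤ s) (h4 : s < 4) :
    bump (4 * i + s) = max 0 (min (2 * s) (2 - 2 * s)) := by
  unfold bump; rw [fract_div_four i h0 h4]; ring_nf

lemma bump_nonneg (x : ℝ) : 0 ≤ bump x := le_max_left _ _

lemma bump_le_one (x : ℝ) : bump x ≤ 1 := by
  refine max_le zero_le_one ?_
  rcases le_total (8 * Int.fract (x / 4)) 1 with h | h
  · exact (min_le_left _ _).trans h
  · exact (min_le_right _ _).trans (by linarith)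

lemma bump_eq_zero {i : ℤ} {x : ℝ} (h1 : 4 * i + 1 ≤ x) (h4 : x ≤ 4 * i + 4) : bump x = 0 := by
  rcases h4.eq_or_lt with h | h
  · have := bump_eq (i + 1) (s := 0) le_rfl (by norm_num)
    push_cast at this
    rw [h, show (4 * i + 4 : ℝ) = 4 * (i + 1) + 0 by ring, this]; simp
  · have := bump_eq i (s := x - 4 * i) (by linarith) (by linarith)
    rw [show (4 * i + (x - 4 * i) : ℝ) = x by ring] at this
    rw [this]
    exact max_eq_left ((min_le_right _ _).trans (by linarith))

lemma continuous_bump : Continuous bump := by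
  have := ContinuousOn.comp_fract (β := ℝ) (γ := ℝ) (s := fun x : ℝ => x / 4)
    (f := fun _ t => max 0 (min (8 * t) (2 - 8 * t)))
    (Continuous.continuousOn (by fun_prop)) (by fun_prop) (by intro x; norm_num)
  exact this

/-- Continuous exponents in `[0, 1]` which are constant on each gate. -/
structure GateWeight where
  /-- The exponent as a function of the abscissa. -/
  fn : ℝ → ℝ
  /-- The exponent on each gate. -/
  val : ℤ → ℝ
  cont : Continuous fn
  nonneg : ∀ x, 0 ≤ fn x
  le_one : ∀ x, fn x ≤ 1
  gate : ∀ (i : ℤ) (s : ℝ), 0 ≤ s → s ≤ 1 → fn (4 * i + s) = val i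

variable (W : GateWeight)

/-- The action of the gates on the inverse of the level. -/
noncomputable def stretch (x z : ℝ) : ℝ := z + bump x * ((max 1 z) ^ W.fn x - 1)

lemma one_le_rpow_max (x z : ℝ) : 1 ≤ (max 1 z) ^ W.fn x :=
  Real.one_le_rpow (le_max_left _ _) (W.nonneg x)

lemma rpow_max_le (x z : ℝ) : (max 1 z) ^ W.fn x ≤ max 1 z := by
  simpa using Real.rpow_le_rpow_of_exponent_le (le_max_left 1 z) (W.le_one x)

lemma le_stretch (x z : ℝ) : z ≤ stretch W x z := by
  have := mul_nonneg (bump_nonneg x) (sub_nonneg.2 (one_le_rpow_max W x z))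
  unfold stretch; linarith

lemma stretch_le {x z : ℝ} (hz : 0 < z) : stretch W x z ≤ 2 * z := by
  have h1 : (max 1 z) ^ W.fn x - 1 ≤ z := by
    have := rpow_max_le W x z
    have h2 : max 1 z ≤ 1 + z := max_le (by linarith) (by linarith)
    linarith
  have h0 := sub_nonneg.2 (one_le_rpow_max W x z)
  have := mul_le_of_le_one_left h0 (bump_le_one x)
  unfold stretch; linarith

lemma stretch_strictMono (x : ℝ) : StrictMono (stretch W x) := by
  intro z w h
  have h1 : (max 1 z) ^ W.fn x ≤ (max 1 w) ^ W.fn x :=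
    Real.rpow_le_rpow (by positivity) (max_le_max le_rfl h.le) (W.nonneg x)
  have := mul_le_mul_of_nonneg_left h1 (bump_nonneg x)
  unfold stretch; linarith

lemma continuous_stretch : Continuous fun q : ℝ × ℝ => stretch W q.1 q.2 := by
  have h1 := continuous_bump
  have h2 := W.cont
  have h3 : Continuous fun q : ℝ × ℝ => (max 1 q.2) ^ W.fn q.1 :=
    Continuous.rpow (by fun_prop) (by fun_prop) fun q => Or.inl (by positivity)
  unfold stretch; fun_prop

/-- The action of the gates on the level. -/
noncomputable def sink (x y : ℝ) : ℝ := if y ≤ 0 then y else (stretch W x y⁻¹)⁻¹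

lemma sink_of_nonpos {x y : ℝ} (h : y ≤ 0) : sink W x y = y := if_pos h

lemma sink_of_pos {x y : ℝ} (h : 0 < y) : sink W x y = (stretch W x y⁻¹)⁻¹ := if_neg (not_le.2 h)

lemma stretch_pos (x : ℝ) {z : ℝ} (h : 0 < z) : 0 < stretch W x z := h.trans_le (le_stretch W x z)

lemma sink_pos (x : ℝ) {y : ℝ} (h : 0 < y) : 0 < sink W x y := by
  rw [sink_of_pos W h]; exact inv_pos.2 (stretch_pos W x (inv_pos.2 h))

lemma inv_sink (x : ℝ) {y : ℝ} (h : 0 < y) : (sink W x y)⁻¹ = stretch W x y⁻¹ := by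
  rw [sink_of_pos W h, inv_inv]

lemma sink_le (x y : ℝ) : sink W x y ≤ y := by
  rcases le_or_gt y 0 with h | h
  · rw [sink_of_nonpos W h]
  · rw [sink_of_pos W h]
    exact inv_le_of_inv_le₀ h (le_stretch W x _)

lemma le_sink {x y : ℝ} (h : 0 < y) : y / 2 ≤ sink W x y := by
  rw [sink_of_pos W h, le_inv_comm₀ (by positivity) (stretch_pos W x (inv_pos.2 h))]
  have := stretch_le W (x := x) (inv_pos.2 h)
  rwa [inv_div, div_eq_mul_inv]

lemma sink_strictMono (x : ℝ) : StrictMono (sink W x) := by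
  intro y z h
  rcases le_or_gt y 0 with hy | hy
  · rw [sink_of_nonpos W hy]
    rcases le_or_gt z 0 with hz | hz
    · rwa [sink_of_nonpos W hz]
    · exact hy.trans_lt (sink_pos W x hz)
  · have hz := hy.trans h
    rw [sink_of_pos W hy, sink_of_pos W hz]
    refine (inv_lt_inv₀ (stretch_pos W x (inv_pos.2 hy)) (stretch_pos W x (inv_pos.2 hz))).2 ?_
    exact stretch_strictMono W x ((inv_lt_inv₀ hz hy).2 h)

lemma sink_of_bump_eq_zero {x : ℝ} (h : bump x = 0) (y : ℝ) : sink W x y = y := by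
  rcases le_or_gt y 0 with hy | hy
  · rw [sink_of_nonpos W hy]
  · rw [sink_of_pos W hy]; unfold stretch; rw [h]; simp

lemma abs_sink_le (x y : ℝ) : |sink W x y| ≤ |y| := by
  rcases le_or_gt y 0 with hy | hy
  · rw [sink_of_nonpos W hy]
  · rw [abs_of_pos (sink_pos W x hy), abs_of_pos hy]; exact sink_le W x y

lemma continuous_sink : Continuous fun q : ℝ × ℝ => sink W q.1 q.2 := by
  rw [continuous_iff_continuousAt]
  rintro ⟨x, y⟩
  rcases lt_trichotomy y 0 with hy | hy | hy
  · have : ∀ᶠ q : ℝ × ℝ in 𝓝 (x, y), q.2 < 0 :=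
      continuous_snd.continuousAt.eventually_lt continuousAt_const hy
    exact continuous_snd.continuousAt.congr (this.mono fun q hq => (sink_of_nonpos W hq.le).symm)
  · subst hy
    change Tendsto _ _ (𝓝 (sink W x 0))
    rw [sink_of_nonpos W le_rfl]
    refine squeeze_zero_norm (fun q => abs_sink_le W q.1 q.2) ?_
    have : Continuous fun q : ℝ × ℝ => |q.2| := by fun_prop
    simpa using this.tendsto (x, 0)
  · have : ∀ᶠ q : ℝ × ℝ in 𝓝 (x, y), 0 < q.2 :=
      continuousAt_const.eventually_lt continuous_snd.continuousAt hy
    refine ContinuousAt.congr (f := fun q : ℝ × ℝ => (stretch W q.1 q.2⁻¹)⁻¹) ?_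
      (this.mono fun q hq => (sink_of_pos W hq).symm)
    refine ContinuousAt.inv₀ ?_ (stretch_pos W x (inv_pos.2 hy)).ne'
    exact ContinuousAt.comp (g := fun q : ℝ × ℝ => stretch W q.1 q.2)
      (f := fun q : ℝ × ℝ => (q.1, q.2⁻¹)) (continuous_stretch W).continuousAt
      (continuousAt_fst.prodMk (continuousAt_snd.inv₀ hy.ne'))

/-- A fibrewise increasing map of the plane at bounded distance from the identity is a
homeomorphism. -/
noncomputable def fiberHomeo (F : ℝ × ℝ → ℝ) (C : ℝ) (hc : Continuous F)
    (hm : ∀ x, StrictMono fun u => F (x, u)) (hb : ∀ p, |F p - p.2| ≤ C) :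
    (ℝ × ℝ) ≃ₜ (ℝ × ℝ) :=
  have hs : ∀ p : ℝ × ℝ, ∃ u, F (p.1, u) = p.2 := fun p => by
    have h1 := abs_le.1 (hb (p.1, p.2 - C))
    have h2 := abs_le.1 (hb (p.1, p.2 + C))
    have hC : 0 ≤ C := (abs_nonneg _).trans (hb p)
    have hcs : ContinuousOn (fun u => F (p.1, u)) (Icc (p.2 - C) (p.2 + C)) :=
      Continuous.continuousOn (by fun_prop)
    have hmem : p.2 ∈ Icc (F (p.1, p.2 - C)) (F (p.1, p.2 + C)) :=
      ⟨by simp only at h1; linarith, by simp only at h2; linarith⟩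
    obtain ⟨u, -, hu⟩ := intermediate_value_Icc (show p.2 - C ≤ p.2 + C by linarith) hcs hmem
    exact ⟨u, hu⟩
  { toFun := fun p => (p.1, F p)
    invFun := fun p => (p.1, (hs p).choose)
    left_inv := fun p => Prod.ext rfl ((hm p.1).injective (hs (p.1, F p)).choose_spec)
    right_inv := fun p => Prod.ext rfl (hs p).choose_spec
    continuous_toFun := continuous_fst.prodMk hc
    continuous_invFun := by
      refine continuous_fst.prodMk (continuous_iff_continuousAt.2 fun p => ?_)
      have hF : ∀ a, Continuous fun q : ℝ × ℝ => F (q.1, a) := fun a => by fun_prop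
      refine tendsto_order.2 ⟨fun a ha => ?_, fun a ha => ?_⟩
      · have : F (p.1, a) < p.2 := by
          have := hm p.1 ha; simp only at this; rwa [(hs p).choose_spec] at this
        have := (hF a).continuousAt.eventually_lt continuous_snd.continuousAt this
        filter_upwards [this] with q hq
        refine (hm q.1).lt_iff_lt.1 ?_
        rwa [(hs q).choose_spec]
      · have : p.2 < F (p.1, a) := by
          have := hm p.1 ha; simp only at this; rwa [(hs p).choose_spec] at this
        have := continuous_snd.continuousAt.eventually_lt (hF a).continuousAt this
        filter_upwards [this] with q hq
        refine (hm q.1).lt_iff_lt.1 ?_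
        rwa [(hs q).choose_spec] }

/-- Vertical coordinate of the image of a point under the action of the gates. -/
noncomputable def drop (p : ℝ × ℝ) : ℝ := ucoord p.1 (sink W p.1 (level p))

lemma sink_good (p : ℝ × ℝ) : 0 < sink W p.1 (level p) ∨ 0 < hgt p.1 := by
  rcases le_or_gt (level p) 0 with h | h
  · exact Or.inr (hgt_pos_of_level_nonpos h)
  · exact Or.inl (sink_pos W _ h)

lemma continuous_drop : Continuous (drop W) := by
  rw [continuous_iff_continuousAt]
  intro p
  refine ContinuousAt.comp (g := fun q : ℝ × ℝ => ucoord q.1 q.2)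
    (f := fun p : ℝ × ℝ => (p.1, sink W p.1 (level p))) (continuousAt_ucoord (sink_good W p)) ?_
  have : Continuous fun p : ℝ × ℝ => sink W p.1 (level p) :=
    ((continuous_sink W).comp
      (show Continuous fun p : ℝ × ℝ => (p.1, level p) from continuous_fst.prodMk continuous_level) :)
  exact (continuous_fst.prodMk this).continuousAt

lemma drop_strictMono (x : ℝ) : StrictMono fun u => drop W (x, u) := fun _ _ h =>
  ucoord_lt (sink_good W _) (sink_strictMono W x (level_strictMono x h))

lemma drop_le (p : ℝ × ℝ) : drop W p ≤ p.2 := by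
  rcases (sink_le W p.1 (level p)).eq_or_lt with h | h
  · unfold drop; rw [h, ucoord_level]
  · have := ucoord_lt (sink_good W p) h
    rw [ucoord_level] at this
    exact this.le

lemma le_drop (p : ℝ × ℝ) : p.2 - Real.log 2 ≤ drop W p := by
  rcases le_or_gt (level p) 0 with h | h
  · unfold drop
    rw [sink_of_nonpos W h, ucoord_level]
    linarith [Real.log_pos (one_lt_two)]
  · have h1 := le_sink W (x := p.1) h
    have hg := hgt_nonneg p.1
    have e := ucoord_level p
    unfold drop
    nth_rewrite 1 [← e]
    have hp := ucoord_arg_pos (x := p.1) (Or.inl h)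
    unfold ucoord
    rw [← Real.log_div hp.ne' two_ne_zero]
    refine Real.log_le_log (by positivity) ?_
    have : √(level p ^ 2 + 4 * hgt p.1) ≤ 2 * √(sink W p.1 (level p) ^ 2 + 4 * hgt p.1) := by
      rw [Real.sqrt_le_left (by positivity), mul_pow, Real.sq_sqrt (by positivity)]
      nlinarith
    linarith

/-- The isotopy from the identity to the action of the gates. -/
noncomputable def gateIsotopy (t : ℝ) (p : ℝ × ℝ) : ℝ × ℝ := (p.1, (1 - t) * p.2 + t * drop W p)

lemma continuous_gateIsotopy : Continuous fun q : ℝ × (ℝ × ℝ) => gateIsotopy W q.1 q.2 := by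
  have := continuous_drop W
  unfold gateIsotopy; fun_prop

/-- The homeomorphisms of the isotopy. -/
noncomputable def gateHomeo (t : ℝ) (ht : t ∈ Icc (0 : ℝ) 1) : (ℝ × ℝ) ≃ₜ (ℝ × ℝ) :=
  fiberHomeo (fun p => (1 - t) * p.2 + t * drop W p) (Real.log 2)
    (by have := continuous_drop W; fun_prop)
    (by
      intro x u v h
      have h1 := drop_strictMono W x h
      simp only at h1 ⊢
      rcases ht.1.eq_or_lt with h0 | h0
      · rw [← h0]; linarith
      · nlinarith [ht.2])
    (by
      intro p
      have h1 := drop_le W p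
      have h2 := le_drop W p
      have h3 := Real.log_pos (one_lt_two)
      rw [abs_le]
      constructor <;> nlinarith [ht.1, ht.2])

/-- The homeomorphism of the plane associated with a family of exponents. -/
noncomputable def chainHomeo : (ℝ × ℝ) ≃ₜ (ℝ × ℝ) :=
  (gateHomeo W 1 ⟨zero_le_one, le_rfl⟩).trans (flowHomeo 1)

lemma chainHomeo_apply (p : ℝ × ℝ) : chainHomeo W p = flow 1 (p.1, drop W p) := by
  change flow 1 (gateIsotopy W 1 p) = _
  unfold gateIsotopy; simp

lemma drop_chart {i : ℤ} {s y x : ℝ} (hx : posX i s y = x) (hs : 0 < y → posX i s (sink W x y) = x) :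
    chainHomeo W (chart i (s, y)) = chart i (s + 1, sink W x y) := by
  rw [chainHomeo_apply, ← flow_chart]
  congr 1
  have h1 : (chart i (s, y)).1 = x := hx
  unfold drop
  rw [level_chart, h1]
  have h2 : posX i s (sink W x y) = x := by
    rcases le_or_gt y 0 with h | h
    · rw [sink_of_nonpos W h]; exact hx
    · exact hs h
  unfold chart
  simp only [h2]

/-- Inside a gate. -/
lemma chainHomeo_gate (i : ℤ) {s : ℝ} (y : ℝ) (h : |s| ≤ 1) :
    chainHomeo W (chart i (s, y)) = chart i (s + 1, sink W (4 * i + s) y) :=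
  drop_chart W (posX_of_abs_le_one i h) fun _ => posX_of_abs_le_one i h

/-- Outside the gates. -/
lemma chainHomeo_of_bump {i : ℤ} {s y : ℝ} (h : bump (posX i s y) = 0) :
    chainHomeo W (chart i (s, y)) = chart i (s + 1, y) := by
  have := drop_chart W (i := i) (s := s) (y := y) rfl
    (fun _ => by rw [sink_of_bump_eq_zero W h])
  rwa [sink_of_bump_eq_zero W h] at this

lemma chainHomeo_cases (p : ℝ × ℝ) :
    (∃ i s y, |s| ≤ 1 ∧ 0 ≤ s ∧ p = chart i (s, y)) ∨ (bump p.1 = 0) := by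
  by_cases h : p.1 ≤ 4 * ⌊p.1 / 4⌋ + 1
  · left
    have h0 : 4 * (⌊p.1 / 4⌋ : ℝ) ≤ p.1 := by have := Int.floor_le (p.1 / 4); linarith
    have hs : |p.1 - 4 * ⌊p.1 / 4⌋| ≤ 1 := by rw [abs_le]; constructor <;> linarith
    refine ⟨⌊p.1 / 4⌋, p.1 - 4 * ⌊p.1 / 4⌋, level p, hs, by linarith, (chart_eq_of_posX ?_).symm⟩
    rw [posX_of_abs_le_one _ hs]; ring
  · right
    have := Int.lt_floor_add_one (p.1 / 4)
    exact bump_eq_zero (i := ⌊p.1 / 4⌋) (by linarith) (by linarith)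

lemma lt_chainHomeo_fst (p : ℝ × ℝ) : p.1 < (chainHomeo W p).1 := by
  rcases chainHomeo_cases p with ⟨i, s, y, hs, h0, rfl⟩ | h
  · rw [chainHomeo_gate W i y hs]
    have h1 : (chart i (s, y)).1 = 4 * i + s := posX_of_abs_le_one i hs
    have h2 : posX i s (sink W (4 * i + s) y) = 4 * i + s := posX_of_abs_le_one i hs
    have h3 := posX_strictMono i (sink W (4 * i + s) y) (lt_add_one s)
    simp only [h2] at h3
    exact h1.trans_lt h3
  · obtain ⟨i, s, y, rfl⟩ := exists_chart p
    rw [chainHomeo_of_bump W h]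
    exact posX_strictMono i _ (by linarith)

lemma continuous_isotopy :
    Continuous fun q : ℝ × (ℝ × ℝ) => flow q.1 (gateIsotopy W q.1 q.2) := by
  have hg : Continuous fun q : ℝ × (ℝ × ℝ) => (q.1, gateIsotopy W q.1 q.2) :=
    Continuous.prodMk continuous_fst (continuous_gateIsotopy W)
  exact Continuous.comp (g := fun q : ℝ × (ℝ × ℝ) => flow q.1 q.2) continuous_flow hg

lemma isBrouwer_chainHomeo : IsBrouwer (chainHomeo W) := by
  refine ⟨fun z hz => ?_, fun t p => flow t (gateIsotopy W t p), ?_, ?_, ?_, ?_⟩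
  · have := lt_chainHomeo_fst W z
    rw [hz] at this
    exact lt_irrefl _ this
  · exact continuous_isotopy W
  · exact fun t ht => ⟨(gateHomeo W t ht).trans (flowHomeo t), rfl⟩
  · ext1 p
    simp only [flow_zero, id]
    unfold gateIsotopy
    simp
  · rfl

end BrouwerChain

namespace BrouwerChain

variable (W : GateWeight)

lemma chart_fst (i : ℤ) (s y : ℝ) : (chart i (s, y)).1 = posX i s y := rfl

lemma posX_period (i : ℤ) {y : ℝ} (hy : 0 < y) : posX i (period (lev y)) y = 4 * i + 4 := by
  unfold posX
  have := colX_add_period (s := 0) (lev_pos hy) 1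
  have h0 : colX 0 (lev y) = 0 := colX_of_abs_le_one (lev_nonneg y) (lev_le_one y) (by simp)
  rw [h0] at this
  simp only [Int.cast_one, mul_one, zero_add] at this
  rw [this]

lemma posX_lt_of_nonpos (i : ℤ) (s : ℝ) {y : ℝ} (hy : y ≤ 0) : posX i s y < 4 * i + 2 := by
  unfold posX
  rw [lev_of_nonpos hy]
  linarith [(abs_lt.1 (abs_colX_zero_lt s)).2]

lemma le_posX_of_one_le (i : ℤ) {s : ℝ} (y : ℝ) (hs : 1 ≤ s) : 4 * i + 1 ≤ posX i s y := by
  rw [← posX_of_abs_le_one i (s := 1) (y := y) (by simp)]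
  exact (posX_strictMono i y).monotone hs

lemma iterate_free (i : ℤ) {s y : ℝ} (hs : 1 ≤ s) (k : ℕ)
    (h : y ≤ 0 ∨ s + k ≤ period (lev y) + 1) :
    (chainHomeo W)^[k] (chart i (s, y)) = chart i (s + k, y) := by
  induction k with
  | zero => simp
  | succ k ih =>
    push_cast at h
    rw [Function.iterate_succ_apply', ih (h.imp_right fun h => by linarith),
      chainHomeo_of_bump]
    · push_cast; congr 2; ring
    · have hk : (0 : ℝ) ≤ k := by positivity
      refine bump_eq_zero (i := i) (le_posX_of_one_le i y (by linarith)) ?_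
      rcases h with h | h
      · linarith [posX_lt_of_nonpos i (s + k) h]
      · rcases lt_or_ge 0 y with hy | hy
        · rw [← posX_period i hy]
          exact (posX_strictMono i y).monotone (by linarith)
        · linarith [posX_lt_of_nonpos i (s + k) hy]

lemma iterate_free_left (i : ℤ) {s y : ℝ} (hs : 4 * i - 3 ≤ posX i s y) (k : ℕ)
    (h : s + k ≤ 1) :
    (chainHomeo W)^[k] (chart i (s, y)) = chart i (s + k, y) := by
  induction k with
  | zero => simp
  | succ k ih =>
    push_cast at h
    rw [Function.iterate_succ_apply', ih (by linarith), chainHomeo_of_bump]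
    · push_cast; congr 2; ring
    · have hk : (0 : ℝ) ≤ k := by positivity
      refine bump_eq_zero (i := i - 1) ?_ ?_
      · push_cast
        have := (posX_strictMono i y).monotone (show s ≤ s + k by linarith)
        linarith
      · push_cast
        have := (posX_strictMono i y).monotone (show s + k ≤ 0 by linarith)
        simp only [posX_of_abs_le_one i (s := 0) (y := y) (by simp)] at this
        linarith

/-- The points of the gate of column `i`. -/
def InGate (i : ℤ) (p : ℝ × ℝ) : Prop := 4 * i ≤ p.1 ∧ p.1 < 4 * i + 1

lemma inGate_chart {i : ℤ} {s : ℝ} (y : ℝ) (h0 : 0 ≤ s) (h1 : s < 1) :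
    InGate i (chart i (s, y)) := by
  unfold InGate
  rw [chart_fst, posX_of_abs_le_one i (abs_le.2 ⟨by linarith, h1.le⟩)]
  constructor <;> linarith

variable {W}

lemma InGate.eq_chart {i : ℤ} {p : ℝ × ℝ} (h : InGate i p) :
    p = chart i (p.1 - 4 * i, level p) := by
  refine (chart_eq_of_posX ?_).symm
  rw [posX_of_abs_le_one i (abs_le.2 ⟨by linarith [h.1], by linarith [h.2]⟩)]; ring

variable (W) in
lemma iterate_fst_strictMono (p : ℝ × ℝ) : StrictMono fun k => ((chainHomeo W)^[k] p).1 := by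
  refine strictMono_nat_of_lt_succ fun k => ?_
  rw [Function.iterate_succ_apply']
  exact lt_chainHomeo_fst W _

lemma InGate.succ_fst {i : ℤ} {p : ℝ × ℝ} (h : InGate i p) : 4 * i + 1 ≤ (chainHomeo W p).1 := by
  have h0 := h.1
  have h1 := h.2
  rw [h.eq_chart, chainHomeo_gate W i _ (abs_le.2 ⟨by linarith, by linarith⟩), chart_fst]
  exact le_posX_of_one_le i _ (by linarith)

lemma InGate.time_unique {i : ℤ} {p : ℝ × ℝ} {S T : ℕ} (hS : InGate i ((chainHomeo W)^[S] p))
    (hT : InGate i ((chainHomeo W)^[T] p)) : S = T := by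
  have key : ∀ {S T : ℕ}, InGate i ((chainHomeo W)^[S] p) → InGate i ((chainHomeo W)^[T] p) →
      ¬ S < T := by
    intro S T hS hT h
    have h1 := hS.succ_fst (W := W)
    rw [← Function.iterate_succ_apply' (chainHomeo W)] at h1
    have h2 := (iterate_fst_strictMono W p).monotone (Nat.succ_le_of_lt h)
    linarith [hT.2]
  exact le_antisymm (not_lt.1 (key hT hS)) (not_lt.1 (key hS hT))

lemma InGate.time_lt {i j : ℤ} {p : ℝ × ℝ} {S T : ℕ} (hS : InGate i ((chainHomeo W)^[S] p))
    (hT : InGate j ((chainHomeo W)^[T] p)) (h : i < j) : S < T := by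
  refine (iterate_fst_strictMono W p).lt_iff_lt.1 ?_
  have : (i : ℝ) + 1 ≤ j := by exact_mod_cast h
  linarith [hS.2, hT.1]

lemma gate_iterate {i : ℤ} {s y : ℝ} (h0 : 0 ≤ s) (h1 : s ≤ 1) (k : ℕ)
    (h : sink W (4 * i + s) y ≤ 0 ∨ s + (k + 1 : ℕ) ≤ period (lev (sink W (4 * i + s) y)) + 1) :
    (chainHomeo W)^[k + 1] (chart i (s, y)) = chart i (s + (k + 1 : ℕ), sink W (4 * i + s) y) := by
  rw [Function.iterate_succ_apply, chainHomeo_gate W i y (abs_le.2 ⟨by linarith, h1⟩),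
    iterate_free W i (by linarith)]
  · push_cast; congr 2; ring
  · push_cast at h
    exact h.imp_right fun h => by linarith

lemma InGate.fst_lt_of_nonpos {i : ℤ} {p : ℝ × ℝ} (h : InGate i p) (hl : level p ≤ 0) (k : ℕ) :
    ((chainHomeo W)^[k] p).1 < 4 * i + 2 := by
  have h0 := h.1
  have h1 := h.2
  cases k with
  | zero => simp only [Function.iterate_zero, id]; linarith
  | succ k =>
    have hs : sink W (4 * i + (p.1 - 4 * i)) (level p) ≤ 0 := by rwa [sink_of_nonpos W hl]
    rw [h.eq_chart, gate_iterate (by linarith) (by linarith) k (Or.inl hs), chart_fst]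
    exact posX_lt_of_nonpos _ _ hs

lemma period_lev {y : ℝ} (hy : 0 < y) : period (lev y) = 2 + 2 * max 1 y⁻¹ := by
  rw [lev_of_pos hy]
  unfold period
  rcases le_total y 1 with h | h
  · rw [min_eq_left h, max_eq_right ((one_le_inv₀ hy).2 h)]; field_simp; ring
  · rw [min_eq_right h, max_eq_left (inv_le_one_of_one_le₀ h)]; norm_num

lemma gate_transit_of_eq {i : ℤ} {s s' y : ℝ} {k : ℕ} (hs0 : 0 ≤ s) (hs1 : s ≤ 1) (hs' : s' ≤ 1)
    (hy : 0 < sink W (4 * i + s) y) (hk1 : 1 ≤ k)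
    (hk : s + k = 2 + 2 * max 1 (sink W (4 * i + s) y)⁻¹ + s') :
    (chainHomeo W)^[k] (chart i (s, y)) = chart (i + 1) (s', sink W (4 * i + s) y) := by
  obtain ⟨k, rfl⟩ : ∃ l, k = l + 1 := ⟨k - 1, by omega⟩
  have hp := period_lev hy
  rw [gate_iterate hs0 hs1 k (Or.inr (by linarith)), chart_shift i (i + 1) hy]
  congr 2
  simp only [add_sub_cancel_left, Int.cast_one, mul_one]
  linarith

/-- The first return to the next gate. -/
lemma exists_gate_transit {i : ℤ} {s y : ℝ} (hs0 : 0 ≤ s) (hs1 : s < 1) (hy : 0 < y) :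
    ∃ (k : ℕ) (s' : ℝ), 1 ≤ k ∧ 0 ≤ s' ∧ s' < 1 ∧
      s + k = 2 + 2 * max 1 (sink W (4 * i + s) y)⁻¹ + s' ∧
      (chainHomeo W)^[k] (chart i (s, y)) = chart (i + 1) (s', sink W (4 * i + s) y) := by
  have hy' := sink_pos W (4 * i + s) hy
  set P := 2 + 2 * max 1 (sink W (4 * i + s) y)⁻¹ with hP
  have hP4 : 4 ≤ P := by
    have : 1 ≤ max 1 (sink W (4 * i + s) y)⁻¹ := le_max_left _ _
    linarith
  have h1 := Nat.le_ceil (P - s)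
  have h2 := Nat.ceil_lt_add_one (show 0 ≤ P - s by linarith)
  have h3 : 1 ≤ ⌈P - s⌉₊ := Nat.one_le_ceil_iff.2 (by linarith)
  refine ⟨⌈P - s⌉₊, s + ⌈P - s⌉₊ - P, h3, by linarith, by linarith, by ring, ?_⟩
  exact gate_transit_of_eq hs0 hs1.le (by linarith) hy' h3 (by rw [← hP]; ring)

lemma InGate.level_pos {i j : ℤ} {p : ℝ × ℝ} {T : ℕ} (h : InGate i p)
    (hT : InGate j ((chainHomeo W)^[T] p)) (hij : i < j) : 0 < level p := by
  by_contra hn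
  have := h.fst_lt_of_nonpos (W := W) (not_lt.1 hn) T
  have h2 : (i : ℝ) + 1 ≤ j := by exact_mod_cast hij
  linarith [hT.1]

lemma InGate.exists_next {i : ℤ} {p : ℝ × ℝ} (h : InGate i p) (hl : 0 < level p) :
    ∃ k : ℕ, InGate (i + 1) ((chainHomeo W)^[k] p) ∧
      level ((chainHomeo W)^[k] p) = sink W p.1 (level p) ∧
      (k : ℝ) = 2 + 2 * max 1 (sink W p.1 (level p))⁻¹
        + (((chainHomeo W)^[k] p).1 - 4 * (i + 1 : ℤ) - (p.1 - 4 * i)) := by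
  have h0 := h.1
  have h1 := h.2
  obtain ⟨k, s', -, hs0, hs1, hk, hf⟩ :=
    exists_gate_transit (W := W) (i := i) (s := p.1 - 4 * i) (by linarith) (by linarith) hl
  rw [← h.eq_chart, show 4 * i + (p.1 - 4 * i) = p.1 by ring] at hf
  rw [show 4 * i + (p.1 - 4 * i) = p.1 by ring] at hk
  refine ⟨k, ?_, ?_, ?_⟩
  · rw [hf]; exact inGate_chart _ hs0 hs1
  · rw [hf, level_chart]
  · rw [hf, chart_fst, posX_of_abs_le_one _ (abs_le.2 ⟨by linarith, hs1.le⟩)]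
    linarith

lemma InGate.exists_between {i j : ℤ} {p : ℝ × ℝ} {S T : ℕ} (hS : InGate i ((chainHomeo W)^[S] p))
    (hT : InGate j ((chainHomeo W)^[T] p)) {l : ℤ} (hil : i ≤ l) (hlj : l ≤ j) :
    ∃ R ≤ T, InGate l ((chainHomeo W)^[R] p) := by
  have key : ∀ d : ℕ, i + d ≤ j → ∃ R : ℕ, InGate (i + d) ((chainHomeo W)^[R] p) := by
    intro d
    induction d with
    | zero => exact fun _ => ⟨S, by simpa using hS⟩
    | succ d ih =>
      intro hd
      obtain ⟨R, hR⟩ := ih (by push_cast at hd; omega)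
      have hlt : i + d < j := by push_cast at hd; omega
      have hRT := hR.time_lt hT hlt
      have hT' : InGate j ((chainHomeo W)^[T - R] ((chainHomeo W)^[R] p)) := by
        rwa [← Function.iterate_add_apply, Nat.sub_add_cancel hRT.le]
      obtain ⟨k, hk, -⟩ := hR.exists_next (W := W) (hR.level_pos hT' hlt)
      refine ⟨k + R, ?_⟩
      rw [Function.iterate_add_apply]
      push_cast
      rwa [← add_assoc]
  obtain ⟨R, hR⟩ := key (l - i).toNat (by omega)
  have e : i + ((l - i).toNat : ℤ) = l := by omega
  rw [e] at hR
  refine ⟨R, ?_, hR⟩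
  rcases hlj.eq_or_lt with h | h
  · subst h; exact (hR.time_unique hT).le
  · exact (hR.time_lt hT h).le

lemma InGate.second_difference {i : ℤ} {p : ℝ × ℝ} {R S T : ℕ}
    (hR : InGate (i - 1) ((chainHomeo W)^[R] p)) (hS : InGate i ((chainHomeo W)^[S] p))
    (hT : InGate (i + 1) ((chainHomeo W)^[T] p)) :
    -2 < (T : ℝ) - S - (S - R) ∧ (T : ℝ) - S - (S - R) < 2 * (S : ℝ) ^ W.val i := by
  have hRS := hR.time_lt hS (by omega)
  have hST := hS.time_lt hT (by omega)
  have l1 : 0 < level ((chainHomeo W)^[R] p) := by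
    refine hR.level_pos (W := W) (T := S - R) (j := i) ?_ (by omega)
    rwa [← Function.iterate_add_apply, Nat.sub_add_cancel hRS.le]
  have l2 : 0 < level ((chainHomeo W)^[S] p) := by
    refine hS.level_pos (W := W) (T := T - S) (j := i + 1) ?_ (by omega)
    rwa [← Function.iterate_add_apply, Nat.sub_add_cancel hST.le]
  obtain ⟨k, gk, lk, ek⟩ := hR.exists_next (W := W) l1
  obtain ⟨l, gl, ll, el⟩ := hS.exists_next (W := W) l2
  rw [← Function.iterate_add_apply] at gk lk ek gl ll el
  rw [sub_add_cancel] at gk ek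
  have e1 : k + R = S := gk.time_unique hS
  have e2 : l + S = T := gl.time_unique hT
  rw [e1] at ek lk
  rw [e2] at el
  rw [← lk] at ek
  rw [inv_sink W _ l2] at el
  have hk : (k : ℝ) = S - R := by rw [← e1]; push_cast; ring
  have hl : (l : ℝ) = T - S := by rw [← e2]; push_cast; ring
  rw [hk] at ek
  rw [hl] at el
  set x0 := ((chainHomeo W)^[R] p).1
  set x1 := ((chainHomeo W)^[S] p).1
  set x2 := ((chainHomeo W)^[T] p).1
  set z := (level ((chainHomeo W)^[S] p))⁻¹
  have hz : 0 < z := inv_pos.2 l2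
  obtain ⟨a0, a1⟩ := hR
  obtain ⟨b0, b1⟩ := hS
  obtain ⟨c0, c1⟩ := hT
  change 4 * ((i - 1 : ℤ) : ℝ) ≤ x0 at a0
  change x0 < 4 * ((i - 1 : ℤ) : ℝ) + 1 at a1
  change 4 * (i : ℝ) ≤ x1 at b0
  change x1 < 4 * (i : ℝ) + 1 at b1
  change 4 * ((i + 1 : ℤ) : ℝ) ≤ x2 at c0
  change x2 < 4 * ((i + 1 : ℤ) : ℝ) + 1 at c1
  push_cast at a0 a1 c0 c1 ek el
  have hmono : max 1 z ≤ max 1 (stretch W x1 z) := max_le_max le_rfl (le_stretch W x1 z)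
  have hR0 : (0 : ℝ) ≤ R := by positivity
  have hm1 : 1 ≤ max 1 z := le_max_left _ _
  have hzS : max 1 z ≤ S := by linarith
  have hfn : W.fn x1 = W.val i := by
    have := W.gate i (x1 - 4 * i) (by linarith) (by linarith)
    rwa [show 4 * i + (x1 - 4 * i) = x1 by ring] at this
  have hup : max 1 (stretch W x1 z) ≤ max 1 z + (S : ℝ) ^ W.val i - 1 := by
    have h1 := one_le_rpow_max W x1 z
    have h2 : (max 1 z) ^ W.fn x1 ≤ (S : ℝ) ^ W.fn x1 :=
      Real.rpow_le_rpow (by positivity) hzS (W.nonneg x1)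
    have h3 := mul_le_of_le_one_left (sub_nonneg.2 h1) (bump_le_one x1)
    rw [← hfn]
    refine max_le (by linarith) ?_
    have : z ≤ max 1 z := le_max_right _ _
    unfold stretch
    linarith
  constructor <;> linarith

variable (W) in
lemma sink_surjective (x : ℝ) : Function.Surjective (sink W x) := by
  intro y
  rcases le_or_gt y 0 with hy | hy
  · exact ⟨y, sink_of_nonpos W hy⟩
  · have hc : ContinuousOn (sink W x) (Icc y (2 * y)) :=
      ((continuous_sink W).comp (Continuous.prodMk_right x) :).continuousOn
    have hmem : y ∈ Icc (sink W x y) (sink W x (2 * y)) :=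
      ⟨sink_le W x y, by have := le_sink W (x := x) (y := 2 * y) (by linarith); linarith⟩
    obtain ⟨t, -, ht⟩ := intermediate_value_Icc (by linarith) hc hmem
    exact ⟨t, ht⟩

/-- Points whose time in their column is bounded by `M` are at most `M` iterates away from a
gate. -/
lemma exists_gate_near {p : ℝ × ℝ} {M : ℕ} (hM : |secS p| ≤ M) :
    (∃ k ≤ M, InGate (secI p) ((chainHomeo W)^[k] p)) ∨
    (∃ k ≤ M, ∃ q, InGate (secI p) q ∧ (chainHomeo W)^[k] q = p) := by
  have hp := chart_sec p
  have hx := secI_mem p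
  have hx' : posX (secI p) (secS p) (level p) = p.1 := congrArg Prod.fst hp
  set i := secI p
  set s := secS p
  set y := level p
  have hM' := abs_le.1 hM
  rcases lt_or_ge s 0 with h | h
  · left
    have h1 := Nat.le_ceil (-s)
    have h2 := Nat.ceil_lt_add_one (show 0 ≤ -s by linarith)
    refine ⟨⌈-s⌉₊, Nat.ceil_le.2 (by linarith), ?_⟩
    rw [← hp, iterate_free_left W i (by rw [hx']; linarith [hx.1]) _ (by linarith)]
    exact inGate_chart _ (by linarith) (by linarith)
  · right
    have h1 := Nat.floor_le h
    have h2 := Nat.lt_floor_add_one s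
    refine ⟨⌊s⌋₊, Nat.floor_le_of_le hM'.2, ?_⟩
    rcases Nat.eq_zero_or_pos ⌊s⌋₊ with h0 | h0
    · rw [h0] at h1 h2 ⊢
      refine ⟨p, ?_, rfl⟩
      rw [← hp]
      exact inGate_chart _ h (by simpa using h2)
    · obtain ⟨k, hk⟩ : ∃ l, ⌊s⌋₊ = l + 1 := ⟨⌊s⌋₊ - 1, by omega⟩
      obtain ⟨y0, hy0⟩ := sink_surjective W (4 * i + (s - ⌊s⌋₊)) y
      refine ⟨chart i (s - ⌊s⌋₊, y0), inGate_chart _ (by linarith) (by linarith), ?_⟩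
      rw [hk] at h1 h2 hy0 ⊢
      rw [gate_iterate (by linarith) (by linarith), hy0]
      · rw [sub_add_cancel]; exact hp
      · rw [hy0, sub_add_cancel]
        rcases le_or_gt y 0 with hy | hy
        · exact Or.inl hy
        · right
          have : posX i s y < posX i (period (lev y)) y := by
            rw [posX_period i hy, hx']; linarith [hx.2]
          linarith [(posX_strictMono i y).lt_iff_lt.1 this]

end BrouwerChain

namespace BrouwerChain

section Sphere

lemma sphere_dist_eq (z w : OnePoint (ℝ × ℝ)) : dist z w = dist (spherePoint z) (spherePoint w) :=
  rfl

lemma spherePoint_infty : spherePoint OnePoint.infty = 0 := rfl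

lemma spherePoint_coe (w : ℝ × ℝ) :
    spherePoint (w : OnePoint (ℝ × ℝ)) = ((1 + ‖w‖ ^ 2)⁻¹ • w, (1 + ‖w‖ ^ 2)⁻¹) := rfl

lemma norm_spherePoint_le (w : ℝ × ℝ) {R : ℝ} (hR : 1 ≤ R) (h : R ≤ ‖w‖) :
    ‖spherePoint (w : OnePoint (ℝ × ℝ))‖ ≤ R⁻¹ := by
  have hp : 0 < 1 + ‖w‖ ^ 2 := by positivity
  rw [spherePoint_coe, Prod.norm_mk, norm_smul, Real.norm_of_nonneg (inv_pos.2 hp).le]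
  refine max_le ?_ ?_
  · rw [inv_mul_le_iff₀ hp, ← div_eq_mul_inv, le_div_iff₀ (by linarith)]; nlinarith
  · refine inv_anti₀ (by linarith) ?_; nlinarith

lemma norm_spherePoint_le_one (z : OnePoint (ℝ × ℝ)) : ‖spherePoint z‖ ≤ 1 := by
  induction z using OnePoint.rec with
  | infty => rw [spherePoint_infty]; simp
  | coe w =>
    have hp : 0 < 1 + ‖w‖ ^ 2 := by positivity
    rw [spherePoint_coe, Prod.norm_mk, norm_smul, Real.norm_of_nonneg (inv_pos.2 hp).le]
    refine max_le ?_ (inv_le_one_of_one_le₀ (by nlinarith [sq_nonneg ‖w‖]))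
    rw [inv_mul_le_iff₀ hp]; nlinarith [sq_nonneg (‖w‖ - 1)]

lemma exists_near_infty {ε : ℝ} (hε : 0 < ε) : ∃ R : ℝ, 1 ≤ R ∧ ∀ v w : ℝ × ℝ, R ≤ ‖v‖ → R ≤ ‖w‖ →
    dist (v : OnePoint (ℝ × ℝ)) (w : OnePoint (ℝ × ℝ)) ≤ ε := by
  have h1 : 1 ≤ max 1 (2 / ε) := le_max_left _ _
  refine ⟨max 1 (2 / ε), h1, fun v w hv hw => ?_⟩
  rw [sphere_dist_eq, dist_eq_norm]
  refine (norm_sub_le _ _).trans ?_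
  have h2 : (max 1 (2 / ε))⁻¹ ≤ ε / 2 := by
    refine (inv_anti₀ (by positivity) (le_max_right 1 (2 / ε))).trans_eq (inv_div _ _)
  linarith [norm_spherePoint_le v h1 hv, norm_spherePoint_le w h1 hw]

lemma exists_cells {ε : ℝ} (hε : 0 < ε) : ∃ (N : ℕ) (c : OnePoint (ℝ × ℝ) → Fin N),
    ∀ z w, c z = c w → dist z w ≤ ε := by
  have hb : TotallyBounded (range spherePoint) := by
    refine (isCompact_closedBall (0 : (ℝ × ℝ) × ℝ) 1).totallyBounded.subset ?_
    rintro _ ⟨z, rfl⟩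
    simpa using norm_spherePoint_le_one z
  obtain ⟨t, ht, hcov⟩ := Metric.totallyBounded_iff.1 hb (ε / 2) (by linarith)
  have hex : ∀ z, ∃ y : t, dist (spherePoint z) y < ε / 2 := fun z => by
    obtain ⟨y, hy⟩ := mem_iUnion.1 (hcov (mem_range_self z))
    obtain ⟨hyt, hy⟩ := mem_iUnion.1 hy
    exact ⟨⟨y, hyt⟩, hy⟩
  choose c hc using hex
  have : Finite t := ht
  obtain ⟨N, ⟨e⟩⟩ := Finite.exists_equiv_fin t
  refine ⟨N, fun z => e (c z), fun z w h => ?_⟩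
  have h' := e.injective h
  rw [sphere_dist_eq]
  have h1 := hc z
  have h2 := hc w
  rw [← h', dist_comm] at h2
  linarith [dist_triangle (spherePoint z) (c z) (spherePoint w)]

lemma exists_sphere_dist {R : ℝ} (hR : 0 ≤ R) : ∃ ε : ℝ, 0 < ε ∧ ∀ v w : ℝ × ℝ, ‖v‖ ≤ R →
    1 / 2 ≤ ‖v - w‖ → ε < dist (v : OnePoint (ℝ × ℝ)) (w : OnePoint (ℝ × ℝ)) := by
  set A : ℝ := (1 + R ^ 2)⁻¹ with hA
  have hA0 : 0 < A := by positivity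
  refine ⟨A / (8 * (1 + R)), by positivity, fun v w hv hvw => ?_⟩
  by_contra hn
  rw [not_lt, sphere_dist_eq, spherePoint_coe, spherePoint_coe, Prod.dist_eq, max_le_iff] at hn
  obtain ⟨h1, h2⟩ := hn
  simp only at h1 h2
  set η := A / (8 * (1 + R)) with hη
  set a := (1 + ‖v‖ ^ 2)⁻¹
  set b := (1 + ‖w‖ ^ 2)⁻¹
  have hη2 : η * (8 * (1 + R)) = A := div_mul_cancel₀ _ (by positivity)
  have hη0 : 0 < η := by positivity
  have ha : A ≤ a := inv_anti₀ (by positivity) (by nlinarith [norm_nonneg v])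
  rw [Real.dist_eq] at h2
  have h2' := abs_le.1 h2
  have hb : A / 2 ≤ b := by nlinarith
  have e : b • (v - w) = (a • v - b • w) + (b - a) • v := by
    rw [smul_sub, sub_smul]; abel
  have h3 : ‖b • (v - w)‖ ≤ η + η * R := by
    rw [e]
    refine (norm_add_le _ _).trans (add_le_add (by rwa [← dist_eq_norm]) ?_)
    rw [norm_smul, Real.norm_eq_abs, abs_sub_comm]
    exact mul_le_mul h2 hv (norm_nonneg _) hη0.le
  rw [norm_smul, Real.norm_of_nonneg (by linarith)] at h3
  have h4 : A / 2 * (1 / 2) ≤ b * ‖v - w‖ := mul_le_mul hb hvw (by norm_num) (by linarith)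
  nlinarith

end Sphere

section PolynomialEntropy

variable {X : Type*} [MetricSpace X] {f : X → X}

lemma maxSep_le {n : ℕ} {ε B : ℝ}
    (h : ∀ E : Finset X, IsDynSeparated f n ε ↑E → (E.card : ℝ) ≤ B) : (maxSep f n ε : ℝ) ≤ B := by
  have hB : 0 ≤ B := by simpa using h ∅ (by intro x hx; simp at hx)
  have : maxSep f n ε ≤ ⌊B⌋₊ := by
    refine csSup_le' ?_
    rintro _ ⟨E, hE, rfl⟩
    exact Nat.le_floor (h E hE)
  exact (Nat.cast_le.2 this).trans (Nat.floor_le hB)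

lemma card_le_maxSep {n : ℕ} {ε B : ℝ}
    (h : ∀ E : Finset X, IsDynSeparated f n ε ↑E → (E.card : ℝ) ≤ B) {E : Finset X}
    (hE : IsDynSeparated f n ε ↑E) : E.card ≤ maxSep f n ε := by
  refine le_csSup ⟨⌊B⌋₊, ?_⟩ ⟨E, hE, rfl⟩
  rintro _ ⟨E, hE, rfl⟩
  exact Nat.le_floor (h E hE)

lemma tendsto_log_div_log {C d : ℝ} (hC : 0 < C) :
    Tendsto (fun n : ℕ => ENNReal.ofReal (Real.log (C * (n : ℝ) ^ d) / Real.log n)) atTop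
      (𝓝 (ENNReal.ofReal d)) := by
  refine ENNReal.tendsto_ofReal ?_
  have hl : Tendsto (fun n : ℕ => Real.log n) atTop atTop :=
    Real.tendsto_log_atTop.comp tendsto_natCast_atTop_atTop
  have h1 : Tendsto (fun n : ℕ => Real.log C / Real.log n + d) atTop (𝓝 (0 + d)) :=
    (hl.const_div_atTop _).add tendsto_const_nhds
  rw [zero_add] at h1
  refine h1.congr' ?_
  filter_upwards [eventually_ge_atTop 2] with n hn
  have hn' : (1 : ℝ) < n := by exact_mod_cast hn
  have h0 := Real.log_pos hn'
  rw [Real.log_mul hC.ne' (by positivity), Real.log_rpow (by linarith)]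
  field_simp

lemma polEntropy_le {d : ℝ} (hd : 0 ≤ d)
    (h : ∀ ε > 0, ∃ C : ℝ, 1 ≤ C ∧ ∀ n : ℕ, 1 ≤ n → (maxSep f n ε : ℝ) ≤ C * (n : ℝ) ^ d) :
    polEntropy f ≤ ENNReal.ofReal d := by
  refine iSup₂_le fun ε hε => ?_
  obtain ⟨C, hC, hle⟩ := h ε hε
  rw [← (tendsto_log_div_log (d := d) (zero_lt_one.trans_le hC)).limsup_eq]
  refine limsup_le_limsup ?_
  filter_upwards [eventually_ge_atTop 2] with n hn
  have hn' : (1 : ℝ) < n := by exact_mod_cast hn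
  refine ENNReal.ofReal_le_ofReal (div_le_div_of_nonneg_right ?_ (Real.log_pos hn').le)
  have h1 : 1 ≤ C * (n : ℝ) ^ d := by nlinarith [Real.one_le_rpow hn'.le hd]
  rcases Nat.eq_zero_or_pos (maxSep f n ε) with h0 | h0
  · rw [h0]; simpa using Real.log_nonneg h1
  · exact Real.log_le_log (by exact_mod_cast h0) (hle n (by omega))

lemma le_polEntropy {d ε c : ℝ} (hε : 0 < ε) (hc : 0 < c)
    (h : ∀ᶠ n : ℕ in atTop, c * (n : ℝ) ^ d ≤ maxSep f n ε) :
    ENNReal.ofReal d ≤ polEntropy f := by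
  refine le_trans ?_ (le_iSup₂ (f := fun (ε : ℝ) (_ : 0 < ε) => Filter.atTop.limsup fun n : ℕ =>
      ENNReal.ofReal (Real.log (maxSep f n ε) / Real.log n)) ε hε)
  rw [← (tendsto_log_div_log (d := d) hc).limsup_eq]
  refine limsup_le_limsup ?_
  filter_upwards [h, eventually_ge_atTop 2] with n hn hn2
  have hn' : (1 : ℝ) < n := by exact_mod_cast hn2
  refine ENNReal.ofReal_le_ofReal (div_le_div_of_nonneg_right ?_ (Real.log_pos hn').le)
  exact Real.log_le_log (by positivity) hn

end PolynomialEntropy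

end BrouwerChain

namespace BrouwerChain

lemma hgt_le {i : ℤ} {r : ℝ} (h : |r| ≤ 2) : hgt (4 * i + r) ≤ 2 - |r| := by
  rw [hgt_four_mul_add]
  have hp := Real.pi_pos
  have h4 := Real.pi_le_four
  have e : Real.cos (Real.pi * r / 4) = Real.sin (Real.pi / 2 - Real.pi * |r| / 4) := by
    rw [Real.sin_pi_div_two_sub, ← Real.cos_abs, abs_div, abs_mul, abs_of_pos hp]
    norm_num
  have h0 : 0 ≤ Real.pi / 2 - Real.pi * |r| / 4 := by nlinarith
  have h1 : Real.pi / 2 - Real.pi * |r| / 4 ≤ Real.pi := by nlinarith [abs_nonneg r]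
  rw [e, abs_of_nonneg (Real.sin_nonneg_of_nonneg_of_le_pi h0 h1)]
  refine (Real.sin_le h0).trans ?_
  nlinarith

lemma exists_sec_bound (R : ℝ) : ∃ m M : ℕ, ∀ p : ℝ × ℝ, ‖p‖ ≤ R → |secI p| ≤ m ∧ |secS p| ≤ M := by
  set δ := Real.exp (-(2 * R)) / 2 with hδ
  have hδ0 : 0 < δ := by positivity
  refine ⟨⌈|R|⌉₊ + 1, ⌈2 * max 1 (2 / δ)⌉₊, fun p hp => ?_⟩
  have hx : |p.1| ≤ R := (le_max_left _ _).trans hp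
  have hu : |p.2| ≤ R := (le_max_right _ _).trans hp
  have hR0 : 0 ≤ R := (abs_nonneg _).trans hx
  have hx' := abs_le.1 hx
  have hu' := abs_le.1 hu
  have hs := secI_mem p
  have hδ1 : δ ≤ 1 / 2 := by
    have : Real.exp (-(2 * R)) ≤ 1 := Real.exp_le_one_iff.2 (by linarith)
    linarith
  constructor
  · have h1 := Nat.le_ceil |R|
    rw [abs_of_nonneg hR0] at h1
    have h3 : |(secI p : ℝ)| ≤ ((⌈|R|⌉₊ + 1 : ℕ) : ℝ) := by
      rw [abs_of_nonneg hR0]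
      push_cast
      rw [abs_le]; constructor <;> linarith [hs.1, hs.2]
    exact_mod_cast h3
  · refine le_trans ?_ (Nat.le_ceil _)
    set r := p.1 - 4 * secI p with hr
    have hr2 : |r| ≤ 2 := abs_le.2 ⟨hs.1, hs.2.le⟩
    have hw0 := lev_nonneg (level p)
    have hw1 := lev_le_one (level p)
    have hden : δ ≤ 2 - (1 - lev (level p)) * |r| := by
      rcases le_or_gt δ (2 - |r|) with h | h
      · nlinarith [abs_nonneg r]
      · have hg : hgt p.1 ≤ 2 - |r| := by
          have := hgt_le (i := secI p) hr2
          rwa [show 4 * (secI p : ℝ) + r = p.1 by rw [hr]; ring] at this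
        have h1 : Real.exp (-R) ≤ Real.exp p.2 := Real.exp_le_exp.2 hu'.1
        have h2 : Real.exp (-p.2) ≤ Real.exp R := Real.exp_le_exp.2 (by linarith)
        have h3 : hgt p.1 * Real.exp (-p.2) ≤ δ * Real.exp R :=
          mul_le_mul (by linarith) h2 (Real.exp_pos _).le hδ0.le
        have h4 : δ * Real.exp R = Real.exp (-R) / 2 := by
          rw [hδ, div_mul_eq_mul_div, ← Real.exp_add]; ring_nf
        have h5 : δ ≤ Real.exp (-R) / 2 := by
          rw [hδ]
          have : Real.exp (-(2 * R)) ≤ Real.exp (-R) := Real.exp_le_exp.2 (by linarith)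
          linarith
        have h6 : δ ≤ level p := by unfold level; linarith
        have h7 : δ ≤ lev (level p) := le_max_of_le_right (le_min h6 (by linarith))
        nlinarith
    unfold secS profInv
    have hd : 0 < 2 - (1 - lev (level p)) * |r| := hδ0.trans_le hden
    rw [abs_mul, abs_of_pos (lt_max_of_lt_left one_pos :
      0 < max 1 ((1 + lev (level p)) / (2 - (1 - lev (level p)) * |r|)))]
    refine mul_le_mul hr2 (max_le_max le_rfl ?_) (by positivity) (by norm_num)
    exact div_le_div₀ (by norm_num) (by linarith) hδ0 hden

variable (W : GateWeight)

lemma iterate_onePointExtend (g : ℝ × ℝ → ℝ × ℝ) (k : ℕ) (p : ℝ × ℝ) :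
    (onePointExtend g)^[k] (p : OnePoint (ℝ × ℝ)) = ((g^[k] p : ℝ × ℝ) : OnePoint (ℝ × ℝ)) := by
  induction k with
  | zero => rfl
  | succ k ih => rw [Function.iterate_succ_apply', ih, Function.iterate_succ_apply']; rfl

open Classical in
/-- The time at most `n` at which the orbit of `q` visits the gate of column `i`, or `n + 1`. -/
noncomputable def gateTime (n : ℕ) (q : ℝ × ℝ) (i : ℤ) : ℕ :=
  if h : ∃ T ≤ n, InGate i ((chainHomeo W)^[T] q) then h.choose else n + 1

variable {W}

lemma gateTime_eq {n T : ℕ} {q : ℝ × ℝ} {i : ℤ} (hT : T ≤ n)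
    (h : InGate i ((chainHomeo W)^[T] q)) : gateTime W n q i = T := by
  have hex : ∃ T ≤ n, InGate i ((chainHomeo W)^[T] q) := ⟨T, hT, h⟩
  unfold gateTime
  rw [dif_pos hex]
  exact hex.choose_spec.2.time_unique h

lemma inGate_gateTime {n : ℕ} {q : ℝ × ℝ} {i : ℤ} (h : gateTime W n q i ≤ n) :
    InGate i ((chainHomeo W)^[gateTime W n q i] q) := by
  by_cases hex : ∃ T ≤ n, InGate i ((chainHomeo W)^[T] q)
  · obtain ⟨T, hT, hg⟩ := hex
    rwa [gateTime_eq hT hg]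
  · unfold gateTime at h
    rw [dif_neg hex] at h
    omega

variable (W) in
lemma gateTime_le (n : ℕ) (q : ℝ × ℝ) (i : ℤ) : gateTime W n q i ≤ n + 1 := by
  by_cases hex : ∃ T ≤ n, InGate i ((chainHomeo W)^[T] q)
  · obtain ⟨T, hT, hg⟩ := hex
    rw [gateTime_eq hT hg]; omega
  · unfold gateTime
    rw [dif_neg hex]

lemma gateTime_between {n : ℕ} {q : ℝ × ℝ} {i j l : ℤ} (hi : gateTime W n q i ≤ n)
    (hj : gateTime W n q j ≤ n) (hil : i ≤ l) (hlj : l ≤ j) : gateTime W n q l ≤ n := by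
  obtain ⟨R, hR, hg⟩ := (inGate_gateTime hi).exists_between (inGate_gateTime hj) hil hlj
  rw [gateTime_eq (hR.trans hj) hg]
  exact hR.trans hj

variable (W) in
/-- The second difference of the gate times, shifted so as to be positive whenever it makes
sense. -/
noncomputable def gateDiff (n : ℕ) (q : ℝ × ℝ) (i : ℤ) : ℕ :=
  if gateTime W n q (i - 1) ≤ n ∧ gateTime W n q i ≤ n ∧ gateTime W n q (i + 1) ≤ n then
    gateTime W n q (i + 1) + gateTime W n q (i - 1) + 2 - 2 * gateTime W n q i
  else 0

lemma gateDiff_aux {n : ℕ} {q : ℝ × ℝ} {i : ℤ} (h1 : gateTime W n q (i - 1) ≤ n)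
    (h2 : gateTime W n q i ≤ n) (h3 : gateTime W n q (i + 1) ≤ n) :
    2 * gateTime W n q i < gateTime W n q (i + 1) + gateTime W n q (i - 1) + 2 ∧
    ((gateTime W n q (i + 1) + gateTime W n q (i - 1) + 2 - 2 * gateTime W n q i : ℕ) : ℝ)
      < 2 * (n : ℝ) ^ W.val i + 2 := by
  obtain ⟨ha, hb⟩ := (inGate_gateTime h1).second_difference (inGate_gateTime h2)
    (inGate_gateTime h3)
  have hv : 0 ≤ W.val i := by rw [← W.gate i 0 le_rfl zero_le_one]; exact W.nonneg _
  have hpow : (gateTime W n q i : ℝ) ^ W.val i ≤ (n : ℝ) ^ W.val i :=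
    Real.rpow_le_rpow (by positivity) (by exact_mod_cast h2) hv
  have hlt : 2 * gateTime W n q i < gateTime W n q (i + 1) + gateTime W n q (i - 1) + 2 := by
    have : 2 * (gateTime W n q i : ℝ)
        < gateTime W n q (i + 1) + gateTime W n q (i - 1) + 2 := by linarith
    exact_mod_cast this
  refine ⟨hlt, ?_⟩
  rw [Nat.cast_sub hlt.le]
  push_cast
  linarith

lemma gateDiff_lt (n : ℕ) (q : ℝ × ℝ) (i : ℤ) :
    gateDiff W n q i < ⌊2 * (n : ℝ) ^ W.val i⌋₊ + 3 := by
  unfold gateDiff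
  split_ifs with h
  · have := (gateDiff_aux h.1 h.2.1 h.2.2).2
    have h2 := Nat.lt_floor_add_one (2 * (n : ℝ) ^ W.val i)
    have h3 : ((gateTime W n q (i + 1) + gateTime W n q (i - 1) + 2 - 2 * gateTime W n q i : ℕ) : ℝ)
        < ((⌊2 * (n : ℝ) ^ W.val i⌋₊ + 3 : ℕ) : ℝ) := by push_cast; linarith
    exact_mod_cast h3
  · omega

/-- `a` is the first gate visited in the range `[-m, m]`, or `m + 1` if there is none. -/
def IsFirstGate (W : GateWeight) (n m : ℕ) (q : ℝ × ℝ) (a : ℤ) : Prop :=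
  a ∈ Finset.Icc (-(m : ℤ)) (m + 1) ∧ (a = m + 1 ∨ gateTime W n q a ≤ n) ∧
    ∀ i, -(m : ℤ) ≤ i → i < a → gateTime W n q i = n + 1

variable (W) in
lemma exists_isFirstGate (n m : ℕ) (q : ℝ × ℝ) : ∃ a, IsFirstGate W n m q a := by
  obtain ⟨a, ⟨ha, hor⟩, hmin⟩ := Int.exists_least_of_bdd
    (P := fun z => -(m : ℤ) ≤ z ∧ (z = m + 1 ∨ gateTime W n q z ≤ n))
    ⟨-m, fun z hz => hz.1⟩ ⟨m + 1, by omega, Or.inl rfl⟩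
  refine ⟨a, Finset.mem_Icc.2 ⟨ha, hmin _ ⟨by omega, Or.inl rfl⟩⟩, hor, fun i hi hia => ?_⟩
  by_contra hne
  have := gateTime_le W n q i
  have := hmin i ⟨hi, Or.inr (by omega)⟩
  omega

lemma gateTime_eq_of_code {n m : ℕ} {q q' : ℝ × ℝ} {a : ℤ} (ha : IsFirstGate W n m q a)
    (ha' : IsFirstGate W n m q' a) (h0 : gateTime W n q a = gateTime W n q' a)
    (h1 : gateTime W n q (a + 1) = gateTime W n q' (a + 1))
    (hd : ∀ i ∈ Finset.Icc (-(m : ℤ)) m, gateDiff W n q i = gateDiff W n q' i) :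
    ∀ i ∈ Finset.Icc (-(m : ℤ)) m, gateTime W n q i = gateTime W n q' i := by
  intro i hi
  rw [Finset.mem_Icc] at hi
  have ham := Finset.mem_Icc.1 ha.1
  rcases lt_or_ge i a with hia | hia
  · rw [ha.2.2 i hi.1 hia, ha'.2.2 i hi.1 hia]
  have hv : gateTime W n q a ≤ n := by
    rcases ha.2.1 with h | h
    · omega
    · exact h
  have key : ∀ d : ℕ, a + d ≤ m → gateTime W n q (a + d) = gateTime W n q' (a + d) ∧
      gateTime W n q (a + d + 1) = gateTime W n q' (a + d + 1) := by
    intro d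
    induction d with
    | zero => intro _; simp only [Nat.cast_zero, add_zero]; exact ⟨h0, h1⟩
    | succ d ih =>
      intro hdm
      push_cast at hdm
      obtain ⟨e0, e1⟩ := ih (by omega)
      push_cast
      rw [← add_assoc]
      refine ⟨e1, ?_⟩
      have hdi := hd (a + d + 1) (Finset.mem_Icc.2 ⟨by omega, by omega⟩)
      have r1 : a + d + 1 - 1 = a + (d : ℤ) := by ring
      by_cases hboth : gateTime W n q (a + d) ≤ n ∧ gateTime W n q (a + d + 1) ≤ n
      · obtain ⟨b0, b1⟩ := hboth
        have b0' := b0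
        have b1' := b1
        rw [e0] at b0'
        rw [e1] at b1'
        have l1 := gateTime_le W n q (a + d + 1 + 1)
        have l2 := gateTime_le W n q' (a + d + 1 + 1)
        have aux := @gateDiff_aux W n q (a + d + 1)
        have aux' := @gateDiff_aux W n q' (a + d + 1)
        unfold gateDiff at hdi
        rw [r1] at hdi aux aux'
        have aux := fun h => (aux b0 b1 h).1
        have aux' := fun h => (aux' b0' b1' h).1
        by_cases c : gateTime W n q (a + d + 1 + 1) ≤ n <;>
          by_cases c' : gateTime W n q' (a + d + 1 + 1) ≤ n
        · rw [if_pos ⟨b0, b1, c⟩, if_pos ⟨b0', b1', c'⟩] at hdi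
          have := aux c
          have := aux' c'
          omega
        · rw [if_pos ⟨b0, b1, c⟩, if_neg (fun h => c' h.2.2)] at hdi
          have := aux c
          omega
        · rw [if_neg (fun h => c h.2.2), if_pos ⟨b0', b1', c'⟩] at hdi
          have := aux' c'
          omega
        · omega
      · have hend : ∀ q : ℝ × ℝ, gateTime W n q a ≤ n →
            ¬ (gateTime W n q (a + d) ≤ n ∧ gateTime W n q (a + d + 1) ≤ n) →
            gateTime W n q (a + d + 1 + 1) = n + 1 := by
          intro q hq hn
          by_contra hne
          have := gateTime_le W n q (a + d + 1 + 1)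
          have hle : gateTime W n q (a + d + 1 + 1) ≤ n := by omega
          exact hn ⟨gateTime_between hq hle (by omega) (by omega),
            gateTime_between hq hle (by omega) (by omega)⟩
        rw [hend q hv hboth, hend q' (h0 ▸ hv) (by rwa [← e0, ← e1])]
  have := (key (i - a).toNat (by omega)).1
  rwa [show a + ((i - a).toNat : ℤ) = i by omega] at this

lemma iterate_symm_iterate (k : ℕ) (p : ℝ × ℝ) :
    (chainHomeo W)^[k] ((chainHomeo W).symm^[k] p) = p :=
  (Function.LeftInverse.iterate (fun x => (chainHomeo W).apply_symm_apply x) k) p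

lemma iterate_injective (k : ℕ) : Function.Injective (chainHomeo W)^[k] :=
  (chainHomeo W).injective.iterate k

/-- Points in a bounded region are the images of points lying in gates. -/
lemma exists_gateTime {M j : ℕ} {p : ℝ × ℝ}
    (hM : |secS ((chainHomeo W)^[j] p)| ≤ M) :
    ∃ T, j ≤ T ∧ T ≤ j + 2 * M ∧ InGate (secI ((chainHomeo W)^[j] p))
      ((chainHomeo W)^[T] ((chainHomeo W).symm^[M] p)) := by
  have e : (chainHomeo W)^[j] p = (chainHomeo W)^[j + M] ((chainHomeo W).symm^[M] p) := by
    rw [Function.iterate_add_apply, iterate_symm_iterate]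
  rcases exists_gate_near (W := W) hM with ⟨k, hk, hg⟩ | ⟨k, hk, Q, hg, hQ⟩
  · refine ⟨k + (j + M), by omega, by omega, ?_⟩
    rw [Function.iterate_add_apply _ k, ← e]; exact hg
  · refine ⟨j + M - k, by omega, by omega, ?_⟩
    have : Q = (chainHomeo W)^[j + M - k] ((chainHomeo W).symm^[M] p) := by
      apply iterate_injective (W := W) k
      rw [hQ, ← Function.iterate_add_apply, e, show k + (j + M - k) = j + M by omega]
    rwa [← this]

lemma iterate_eq_of_gateTime {M j T : ℕ} (p : ℝ × ℝ) (hT : T ≤ j + 2 * M) :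
    (chainHomeo W)^[j] p = (chainHomeo W)^[j + 2 * M - T] ((chainHomeo W).symm^[M]
      ((chainHomeo W)^[T] ((chainHomeo W).symm^[M] p))) := by
  apply iterate_injective (W := W) M
  rw [← Function.iterate_add_apply, ← Function.iterate_add_apply, Nat.add_comm M (_ - T),
    Function.iterate_add_apply _ (_ - T), iterate_symm_iterate, ← Function.iterate_add_apply,
    show j + 2 * M - T + T = (M + j) + M by omega, Function.iterate_add_apply _ (M + j),
    iterate_symm_iterate]

end BrouwerChain

namespace BrouwerChain

lemma GateWeight.val_nonneg (W : GateWeight) (i : ℤ) : 0 ≤ W.val i := by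
  rw [← W.gate i 0 le_rfl zero_le_one]; exact W.nonneg _

lemma GateWeight.val_le_one (W : GateWeight) (i : ℤ) : W.val i ≤ 1 := by
  rw [← W.gate i 0 le_rfl zero_le_one]; exact W.le_one _

variable {W : GateWeight}

/-- Orbits visiting the same gates at the same times, in the same cells, stay close. -/
lemma dist_iterate_le {R ε : ℝ} {m M N n : ℕ} {c : OnePoint (ℝ × ℝ) → Fin N}
    (hR : ∀ v w : ℝ × ℝ, R ≤ ‖v‖ → R ≤ ‖w‖ →
      dist (v : OnePoint (ℝ × ℝ)) (w : OnePoint (ℝ × ℝ)) ≤ ε)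
    (hmM : ∀ p : ℝ × ℝ, ‖p‖ ≤ R → |secI p| ≤ m ∧ |secS p| ≤ M)
    (hc : ∀ z w, c z = c w → dist z w ≤ ε) {p p' : ℝ × ℝ}
    (ht : ∀ i ∈ Finset.Icc (-(m : ℤ)) m,
      gateTime W (n + 2 * M) ((chainHomeo W).symm^[M] p) i
        = gateTime W (n + 2 * M) ((chainHomeo W).symm^[M] p') i)
    (hcell : ∀ i ∈ Finset.Icc (-(m : ℤ)) m, ∀ l ≤ 2 * M,
      c (((chainHomeo W)^[l] ((chainHomeo W).symm^[M] ((chainHomeo W)^[gateTime W (n + 2 * M)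
          ((chainHomeo W).symm^[M] p) i] ((chainHomeo W).symm^[M] p))) : ℝ × ℝ))
        = c (((chainHomeo W)^[l] ((chainHomeo W).symm^[M] ((chainHomeo W)^[gateTime W (n + 2 * M)
          ((chainHomeo W).symm^[M] p') i] ((chainHomeo W).symm^[M] p'))) : ℝ × ℝ)))
    {j : ℕ} (hj : j < n) :
    dist (((chainHomeo W)^[j] p : ℝ × ℝ) : OnePoint (ℝ × ℝ))
      (((chainHomeo W)^[j] p' : ℝ × ℝ) : OnePoint (ℝ × ℝ)) ≤ ε := by
  have key : ∀ x : ℝ × ℝ, ‖(chainHomeo W)^[j] x‖ ≤ R → ∃ i ∈ Finset.Icc (-(m : ℤ)) m,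
      j ≤ gateTime W (n + 2 * M) ((chainHomeo W).symm^[M] x) i ∧
      gateTime W (n + 2 * M) ((chainHomeo W).symm^[M] x) i ≤ j + 2 * M := by
    intro x hx
    obtain ⟨hI, hS⟩ := hmM _ hx
    obtain ⟨T, h1, h2, h3⟩ := exists_gateTime hS
    refine ⟨_, Finset.mem_Icc.2 (abs_le.1 hI), ?_⟩
    rw [gateTime_eq (by omega) h3]
    exact ⟨h1, h2⟩
  have key2 : ∀ i ∈ Finset.Icc (-(m : ℤ)) m,
      j ≤ gateTime W (n + 2 * M) ((chainHomeo W).symm^[M] p) i →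
      gateTime W (n + 2 * M) ((chainHomeo W).symm^[M] p) i ≤ j + 2 * M →
      dist (((chainHomeo W)^[j] p : ℝ × ℝ) : OnePoint (ℝ × ℝ))
        (((chainHomeo W)^[j] p' : ℝ × ℝ) : OnePoint (ℝ × ℝ)) ≤ ε := by
    intro i hi h1 h2
    have h2' := h2
    rw [ht i hi] at h2'
    refine hc _ _ ?_
    rw [iterate_eq_of_gateTime p h2, iterate_eq_of_gateTime p' h2']
    have := hcell i hi (j + 2 * M - gateTime W (n + 2 * M) ((chainHomeo W).symm^[M] p) i) (by omega)
    rw [this, ht i hi]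
  rcases le_total ‖(chainHomeo W)^[j] p‖ R with h | h
  · obtain ⟨i, hi, h1, h2⟩ := key p h
    exact key2 i hi h1 h2
  rcases le_total ‖(chainHomeo W)^[j] p'‖ R with h' | h'
  · obtain ⟨i, hi, h1, h2⟩ := key p' h'
    rw [← ht i hi] at h1 h2
    exact key2 i hi h1 h2
  exact hR _ _ h h'

/-- The codes of orbits of length `n`: the first visited gate, the times of the first two visits,
the second differences of the times, and the cells around each visit. -/
noncomputable def codes (W : GateWeight) (m M N n : ℕ) : Finset (Option (ℤ × ℕ × ℕ ×
    (Finset.Icc (-(m : ℤ)) m → ℕ) × (Finset.Icc (-(m : ℤ)) m → Fin (2 * M + 1) → Fin N))) :=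
  Finset.insertNone (Finset.Icc (-(m : ℤ)) (m + 1) ×ˢ Finset.range (n + 2) ×ˢ
    Finset.range (n + 2) ×ˢ
    Fintype.piFinset (fun i : Finset.Icc (-(m : ℤ)) m =>
      Finset.range (⌊2 * (n : ℝ) ^ W.val i⌋₊ + 3)) ×ˢ Finset.univ)

lemma card_le_card_codes {R ε : ℝ} {m M N : ℕ} (n : ℕ) {c : OnePoint (ℝ × ℝ) → Fin N}
    (hR : ∀ v w : ℝ × ℝ, R ≤ ‖v‖ → R ≤ ‖w‖ →
      dist (v : OnePoint (ℝ × ℝ)) (w : OnePoint (ℝ × ℝ)) ≤ ε)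
    (hmM : ∀ p : ℝ × ℝ, ‖p‖ ≤ R → |secI p| ≤ m ∧ |secS p| ≤ M)
    (hc : ∀ z w, c z = c w → dist z w ≤ ε) (E : Finset (OnePoint (ℝ × ℝ)))
    (hE : IsDynSeparated (onePointExtend (chainHomeo W)) n ε ↑E) :
    E.card ≤ (codes W m M N (n + 2 * M)).card := by
  choose a ha using fun p : ℝ × ℝ =>
    exists_isFirstGate W (n + 2 * M) m ((chainHomeo W).symm^[M] p)
  let code : OnePoint (ℝ × ℝ) → Option (ℤ × ℕ × ℕ × (Finset.Icc (-(m : ℤ)) m → ℕ) ×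
      (Finset.Icc (-(m : ℤ)) m → Fin (2 * M + 1) → Fin N)) := fun z =>
    Option.elim z none fun p => some (a p,
      gateTime W (n + 2 * M) ((chainHomeo W).symm^[M] p) (a p),
      gateTime W (n + 2 * M) ((chainHomeo W).symm^[M] p) (a p + 1),
      fun i => gateDiff W (n + 2 * M) ((chainHomeo W).symm^[M] p) i,
      fun i l => c (((chainHomeo W)^[l] ((chainHomeo W).symm^[M] ((chainHomeo W)^[gateTime W
        (n + 2 * M) ((chainHomeo W).symm^[M] p) i] ((chainHomeo W).symm^[M] p))) : ℝ × ℝ)))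
  refine Finset.card_le_card_of_injOn code ?_ ?_
  · intro z _
    induction z using OnePoint.rec with
    | infty => exact Finset.mem_coe.2 Finset.none_mem_insertNone
    | coe p =>
      refine Finset.mem_coe.2 (Finset.some_mem_insertNone.2 ?_)
      simp only [Finset.mem_product, Finset.mem_range, Finset.mem_univ, and_true,
        Fintype.mem_piFinset]
      refine ⟨(ha p).1, ?_, ?_, fun i => gateDiff_lt _ _ _⟩
      · exact Nat.lt_succ_of_le (gateTime_le W _ _ _)
      · exact Nat.lt_succ_of_le (gateTime_le W _ _ _)
  · intro z hz w hw hzw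
    by_contra hne
    obtain ⟨k, hk, hd⟩ := hE z hz w hw hne
    induction z using OnePoint.rec with
    | infty =>
      induction w using OnePoint.rec with
      | infty => exact hne rfl
      | coe p' => exact absurd hzw (Option.some_ne_none _).symm
    | coe p =>
      induction w using OnePoint.rec with
      | infty => exact absurd hzw (Option.some_ne_none _)
      | coe p' =>
        have hcode := Option.some.inj hzw
        simp only [Prod.mk.injEq] at hcode
        obtain ⟨h1, h2, h3, h4, h5⟩ := hcode
        rw [iterate_onePointExtend, iterate_onePointExtend] at hd
        have ha' := ha p'
        rw [← h1] at h2 h3 ha'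
        refine absurd (dist_iterate_le (W := W) hR hmM hc (p := p) (p' := p')
          (gateTime_eq_of_code (ha p) ha' h2 h3 fun i hi => congrFun h4 ⟨i, hi⟩)
          (fun i hi l hl => congrFun (congrFun h5 ⟨i, hi⟩) ⟨l, by omega⟩) hk) (not_le.2 hd)

lemma card_codes_le (W : GateWeight) (m M N : ℕ) : ∃ C : ℝ, 1 ≤ C ∧ ∀ n : ℕ, 1 ≤ n →
    ((codes W m M N (n + 2 * M)).card : ℝ)
      ≤ C * (n : ℝ) ^ (2 + ∑ i ∈ Finset.Icc (-(m : ℤ)) m, W.val i) := by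
  set S := Finset.Icc (-(m : ℤ)) m with hS
  set L : ℝ := 2 * M + 3 with hL
  have hL1 : 1 ≤ L := by rw [hL]; have : (0 : ℝ) ≤ M := by positivity
                         linarith
  set D : ℝ := ((Finset.univ : Finset (S → Fin (2 * M + 1) → Fin N)).card : ℝ) with hD
  refine ⟨(2 * m + 2) * (L * (L * ((5 * L) ^ S.card * D))) + 1, ?_, fun n hn => ?_⟩
  · have : 0 ≤ (2 * m + 2) * (L * (L * ((5 * L) ^ S.card * D))) := by positivity
    linarith
  have hn1 : (1 : ℝ) ≤ n := by exact_mod_cast hn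
  have hn0 : (0 : ℝ) < n := by linarith
  have hM0 : (0 : ℝ) ≤ M := by positivity
  have hlin : ((n + 2 * M : ℕ) : ℝ) + 2 ≤ L * n := by push_cast; rw [hL]; nlinarith
  have hbig : (1 : ℝ) ≤ ((n + 2 * M : ℕ) : ℝ) := by push_cast; linarith
  have hJ : ∀ i : S, ((⌊2 * ((n + 2 * M : ℕ) : ℝ) ^ W.val i⌋₊ + 3 : ℕ) : ℝ)
      ≤ 5 * L * (n : ℝ) ^ W.val i := by
    intro i
    have h0 := W.val_nonneg i
    have h1 : (1 : ℝ) ≤ ((n + 2 * M : ℕ) : ℝ) ^ W.val i := Real.one_le_rpow hbig h0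
    have h2 : ((n + 2 * M : ℕ) : ℝ) ^ W.val i ≤ (L * n) ^ W.val i :=
      Real.rpow_le_rpow (by linarith) (by linarith) h0
    rw [Real.mul_rpow (by linarith) hn0.le] at h2
    have h3 : L ^ W.val i ≤ L := by
      simpa using Real.rpow_le_rpow_of_exponent_le hL1 (W.val_le_one i)
    have h4 := mul_le_mul_of_nonneg_right h3 (Real.rpow_nonneg hn0.le (W.val i))
    have h5 := Nat.floor_le (a := 2 * ((n + 2 * M : ℕ) : ℝ) ^ W.val i) (by linarith)
    rw [Nat.cast_add]
    push_cast at *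
    linarith
  have hprod : ∏ i : S, ((⌊2 * ((n + 2 * M : ℕ) : ℝ) ^ W.val i⌋₊ + 3 : ℕ) : ℝ)
      ≤ (5 * L) ^ S.card * (n : ℝ) ^ (∑ i ∈ S, W.val i) := by
    refine (Finset.prod_le_prod (fun i _ => by positivity) fun i _ => hJ i).trans_eq ?_
    rw [Finset.prod_mul_distrib, Finset.prod_const, Finset.card_univ, Fintype.card_coe,
      ← Real.rpow_sum_of_pos hn0, Finset.sum_coe_sort S W.val]
  have hcard : ((codes W m M N (n + 2 * M)).card : ℝ)
      = (2 * m + 2) * ((((n + 2 * M : ℕ) : ℝ) + 2) * ((((n + 2 * M : ℕ) : ℝ) + 2) *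
        ((∏ i : S, ((⌊2 * ((n + 2 * M : ℕ) : ℝ) ^ W.val i⌋₊ + 3 : ℕ) : ℝ)) * D))) + 1 := by
    unfold codes
    rw [Finset.card_insertNone, Finset.card_product, Finset.card_product, Finset.card_product,
      Finset.card_product, Fintype.card_piFinset, Int.card_Icc, Finset.card_range,
      show ((m : ℤ) + 1 + 1 - -m).toNat = 2 * m + 2 by omega]
    simp only [Finset.card_range]
    push_cast
    rfl
  rw [hcard, Real.rpow_add hn0, Real.rpow_two, add_mul (_ * _) 1, one_mul]
  have hD0 : 0 ≤ D := by positivity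
  have hone : 1 ≤ (n : ℝ) ^ 2 * (n : ℝ) ^ (∑ i ∈ S, W.val i) :=
    one_le_mul_of_one_le_of_one_le (one_le_pow₀ hn1)
      (Real.one_le_rpow hn1 (Finset.sum_nonneg fun i _ => W.val_nonneg i))
  refine add_le_add ?_ hone
  calc _ ≤ (2 * m + 2) * (L * n * (L * n *
        (((5 * L) ^ S.card * (n : ℝ) ^ (∑ i ∈ S, W.val i)) * D))) := by gcongr
    _ = _ := by ring

lemma exists_card_bound (W : GateWeight) {ε : ℝ} (hε : 0 < ε) : ∃ (m : ℕ) (C : ℝ), 1 ≤ C ∧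
    ∀ n : ℕ, 1 ≤ n → ∀ E : Finset (OnePoint (ℝ × ℝ)),
      IsDynSeparated (onePointExtend (chainHomeo W)) n ε ↑E →
      (E.card : ℝ) ≤ C * (n : ℝ) ^ (2 + ∑ i ∈ Finset.Icc (-(m : ℤ)) m, W.val i) := by
  obtain ⟨R, -, hR⟩ := exists_near_infty hε
  obtain ⟨m, M, hmM⟩ := exists_sec_bound R
  obtain ⟨N, c, hc⟩ := exists_cells hε
  obtain ⟨C, hC, h⟩ := card_codes_le W m M N
  exact ⟨m, C, hC, fun n hn E hE =>
    le_trans (by exact_mod_cast card_le_card_codes n hR hmM hc E hE) (h n hn)⟩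

lemma polEntropy_chainHomeo_le (W : GateWeight) {d : ℝ}
    (hd : ∀ m : ℕ, 2 + ∑ i ∈ Finset.Icc (-(m : ℤ)) m, W.val i ≤ d) :
    polEntropy (onePointExtend (chainHomeo W)) ≤ ENNReal.ofReal d := by
  have hd0 : 0 ≤ d := le_trans
    (add_nonneg zero_le_two (Finset.sum_nonneg fun i _ => W.val_nonneg i)) (hd 0)
  refine polEntropy_le hd0 fun ε hε => ?_
  obtain ⟨m, C, hC, h⟩ := exists_card_bound W hε
  refine ⟨C, hC, fun n hn => maxSep_le fun E hE => (h n hn E hE).trans ?_⟩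
  have hn1 : (1 : ℝ) ≤ n := by exact_mod_cast hn
  gcongr
  exact hd m

end BrouwerChain

namespace BrouwerChain

variable {W : GateWeight}

/-- `p` lies in the left half of the gate of column `i`, at level in `[0, 1]`. -/
def InHalfGate (i : ℤ) (p : ℝ × ℝ) : Prop :=
  ∃ s ∈ Icc (0 : ℝ) (1 / 2), ∃ y ∈ Icc (0 : ℝ) 1, p = chart i (s, y)

lemma InHalfGate.fst_mem {i : ℤ} {p : ℝ × ℝ} (h : InHalfGate i p) :
    p.1 ∈ Icc (4 * i : ℝ) (4 * i + 1 / 2) := by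
  obtain ⟨s, hs, y, -, rfl⟩ := h
  rw [chart_fst, posX_of_abs_le_one i (abs_le.2 ⟨by linarith [hs.1], by linarith [hs.2]⟩)]
  exact ⟨by linarith [hs.1], by linarith [hs.2]⟩

lemma InHalfGate.inGate {i : ℤ} {p : ℝ × ℝ} (h : InHalfGate i p) : InGate i p :=
  ⟨h.fst_mem.1, by linarith [h.fst_mem.2]⟩

lemma InHalfGate.fst_far {i : ℤ} {p : ℝ × ℝ} {k T : ℕ} (h : InHalfGate i ((chainHomeo W)^[T] p))
    (hk : k ≠ T) :
    ((chainHomeo W)^[k] p).1 ≤ 4 * i - 1 / 2 ∨ 4 * i + 1 ≤ ((chainHomeo W)^[k] p).1 := by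
  have hmono := (iterate_fst_strictMono W p).monotone
  rcases lt_or_gt_of_ne hk with hlt | hgt
  · left
    obtain ⟨s, hs, y, -, he⟩ := h
    have hx : posX i (s - 1) y = 4 * i + (s - 1) :=
      posX_of_abs_le_one i (abs_le.2 ⟨by linarith [hs.1], by linarith [hs.2]⟩)
    have hb : bump (posX i (s - 1) y) = 0 := by
      rw [hx]
      exact bump_eq_zero (i := i - 1) (by push_cast; linarith [hs.1]) (by push_cast; linarith [hs.2])
    have hf := chainHomeo_of_bump W hb
    rw [sub_add_cancel, ← he, show T = (T - 1) + 1 by omega, Function.iterate_succ_apply'] at hf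
    have hf := (chainHomeo W).injective hf
    have hle := hmono (show k ≤ T - 1 by omega)
    simp only [← hf, chart_fst, hx] at hle
    linarith [hs.2]
  · right
    have h1 := h.inGate.succ_fst (W := W)
    rw [← Function.iterate_succ_apply' (chainHomeo W)] at h1
    exact h1.trans (hmono hgt)

lemma exists_norm_le_of_inHalfGate (m : ℕ) : ∃ R : ℝ, 0 ≤ R ∧ ∀ l ≤ m, ∀ p : ℝ × ℝ,
    InHalfGate l p → ‖p‖ ≤ R := by
  have hb : ∀ l : ℕ, ∃ R : ℝ, ∀ p : ℝ × ℝ, InHalfGate l p → ‖p‖ ≤ R := by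
    intro l
    have hc : IsCompact (chart l '' (Icc (0 : ℝ) (1 / 2) ×ˢ Icc (0 : ℝ) 1)) :=
      (isCompact_Icc.prod isCompact_Icc).image (continuous_chart l)
    obtain ⟨R, hR⟩ := hc.isBounded.exists_norm_le
    refine ⟨R, ?_⟩
    rintro _ ⟨s, hs, y, hy, rfl⟩
    exact hR _ ⟨(s, y), ⟨hs, hy⟩, rfl⟩
  choose R hR using hb
  refine ⟨∑ l ∈ Finset.range (m + 1), |R l|, by positivity, fun l hl p hp => ?_⟩
  exact ((hR l p hp).trans (le_abs_self _)).trans (Finset.single_le_sum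
    (f := fun l => |R l|) (fun _ _ => abs_nonneg _) (Finset.mem_range.2 (by omega)))

lemma exists_separation (W : GateWeight) (m : ℕ) : ∃ ε : ℝ, 0 < ε ∧ ∀ (p q : ℝ × ℝ) (l S T : ℕ),
    l ≤ m → InHalfGate l ((chainHomeo W)^[S] p) → InHalfGate l ((chainHomeo W)^[T] q) → S ≠ T →
    ε < dist (((chainHomeo W)^[S] p : ℝ × ℝ) : OnePoint (ℝ × ℝ))
      (((chainHomeo W)^[S] q : ℝ × ℝ) : OnePoint (ℝ × ℝ)) := by
  obtain ⟨R, hR0, hR⟩ := exists_norm_le_of_inHalfGate m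
  obtain ⟨ε, hε, h⟩ := exists_sphere_dist hR0
  refine ⟨ε, hε, fun p q l S T hl hp hq hST => h _ _ (hR l hl _ hp) ?_⟩
  refine le_trans ?_ (norm_fst_le _)
  have h1 := hp.fst_mem
  rw [Prod.fst_sub, Real.norm_eq_abs]
  rcases hq.fst_far hST with h2 | h2
  · exact le_trans (by linarith [h1.1]) (le_abs_self _)
  · exact le_trans (by linarith [h1.2]) (neg_le_abs _)

/-- A subinterval on which a continuous function crosses `[a, b]` exactly. -/
lemma exists_crossing_of_le {g : ℝ → ℝ} {p q a b : ℝ} (hpq : p ≤ q)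
    (hg : ContinuousOn g (Icc p q)) (hp : g p ≤ a) (hq : b ≤ g q) (hab : a ≤ b) :
    ∃ p' q', p ≤ p' ∧ p' ≤ q' ∧ q' ≤ q ∧ (∀ x ∈ Icc p' q', g x ∈ Icc a b) ∧ g p' = a ∧ g q' = b := by
  have hA : IsCompact (Icc p q ∩ g ⁻¹' Iic a) :=
    isCompact_Icc.of_isClosed_subset (hg.preimage_isClosed_of_isClosed isClosed_Icc isClosed_Iic)
      inter_subset_left
  obtain ⟨p', ⟨hp'1, hp'2⟩, hp'3⟩ := hA.exists_isGreatest ⟨p, ⟨le_rfl, hpq⟩, hp⟩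
  have hg' : ContinuousOn g (Icc p' q) := hg.mono (Icc_subset_Icc_left hp'1.1)
  have hB : IsCompact (Icc p' q ∩ g ⁻¹' Ici b) :=
    isCompact_Icc.of_isClosed_subset (hg'.preimage_isClosed_of_isClosed isClosed_Icc isClosed_Ici)
      inter_subset_left
  obtain ⟨q', ⟨hq'1, hq'2⟩, hq'3⟩ := hB.exists_isLeast ⟨q, ⟨hp'1.2, le_rfl⟩, hq⟩
  have hp'a : g p' = a := by
    obtain ⟨x, hx, hxa⟩ := intermediate_value_Icc hp'1.2 hg' ⟨hp'2, hab.trans hq⟩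
    have := hp'3 ⟨⟨hp'1.1.trans hx.1, hx.2⟩, hxa.le⟩
    rw [le_antisymm this hx.1] at hxa
    exact hxa
  have hq'b : g q' = b := by
    obtain ⟨x, hx, hxb⟩ := intermediate_value_Icc hq'1.1 (hg'.mono (Icc_subset_Icc_right hq'1.2))
      ⟨hp'a.le.trans hab, hq'2⟩
    have := hq'3 ⟨⟨hx.1, hx.2.trans hq'1.2⟩, hxb.ge⟩
    rw [le_antisymm hx.2 this] at hxb
    exact hxb
  refine ⟨p', q', hp'1.1, hq'1.1, hq'1.2, fun x hx => ⟨?_, ?_⟩, hp'a, hq'b⟩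
  · by_contra! hn
    have := hp'3 ⟨⟨hp'1.1.trans hx.1, hx.2.trans hq'1.2⟩, hn.le⟩
    rw [le_antisymm this hx.1, hp'a] at hn
    exact hn.false
  · by_contra! hn
    have := hq'3 ⟨⟨hx.1, hx.2.trans hq'1.2⟩, hn.le⟩
    rw [le_antisymm hx.2 this, hq'b] at hn
    exact hn.false

lemma exists_crossing {g : ℝ → ℝ} {p q a b : ℝ} (hpq : p ≤ q) (hg : ContinuousOn g (Icc p q))
    (h : g p ≤ a ∧ b ≤ g q ∨ b ≤ g p ∧ g q ≤ a) (hab : a ≤ b) :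
    ∃ p' q', p ≤ p' ∧ p' ≤ q' ∧ q' ≤ q ∧ (∀ x ∈ Icc p' q', g x ∈ Icc a b) ∧
      (g p' = a ∧ g q' = b ∨ g p' = b ∧ g q' = a) := by
  rcases h with ⟨hp, hq⟩ | ⟨hp, hq⟩
  · obtain ⟨p', q', h1, h2, h3, h4, h5⟩ := exists_crossing_of_le hpq hg hp hq hab
    exact ⟨p', q', h1, h2, h3, h4, Or.inl h5⟩
  · obtain ⟨p', q', h1, h2, h3, h4, h5, h6⟩ := exists_crossing_of_le (g := fun x => -g x)
      (a := -b) (b := -a) hpq hg.neg (neg_le_neg hp) (neg_le_neg hq) (neg_le_neg hab)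
    refine ⟨p', q', h1, h2, h3, fun x hx => ?_, Or.inr ⟨neg_inj.1 h5, neg_inj.1 h6⟩⟩
    exact ⟨neg_le_neg_iff.1 (h4 x hx).2, neg_le_neg_iff.1 (h4 x hx).1⟩

/-- Orbits with prescribed transit times between consecutive gates. -/
lemma exists_path (hW : W.val 0 = 0) (k : ℕ → ℕ) (hk0 : 5 ≤ k 0) (m : ℕ)
    (hk : ∀ i < m, k i + 1 ≤ k (i + 1) ∧
      (k (i + 1) : ℝ) ≤ k i - 3 + 2 * (((k i : ℝ) - 5 / 2) / 2) ^ W.val (i + 1)) :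
    ∃ (y p q : ℝ) (s z : ℝ → ℝ), p ≤ q ∧ ContinuousOn s (Icc p q) ∧ ContinuousOn z (Icc p q) ∧
      (s p = 0 ∧ s q = 1 / 2 ∨ s p = 1 / 2 ∧ s q = 0) ∧ 5 ≤ k m ∧
      ∀ x ∈ Icc p q, s x ∈ Icc (0 : ℝ) (1 / 2) ∧
        z x ∈ Icc (((k m : ℝ) - 5 / 2) / 2) (((k m : ℝ) - 3 / 2) / 2) ∧
        (chainHomeo W)^[∑ i ∈ Finset.range (m + 1), k i] (chart 0 (x, y))
          = chart (m + 1) (s x, (z x)⁻¹) ∧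
        ∀ l ≤ m + 1, InHalfGate l
          ((chainHomeo W)^[∑ i ∈ Finset.range l, k i] (chart 0 (x, y))) := by
  have inv_mem : ∀ {z : ℝ}, 1 ≤ z → z⁻¹ ∈ Icc (0 : ℝ) 1 := fun {z} hz =>
    ⟨inv_nonneg.2 (by linarith), inv_le_one_of_one_le₀ hz⟩
  induction m with
  | zero =>
    have hk5 : (5 : ℝ) ≤ k 0 := by exact_mod_cast hk0
    set z₀ : ℝ := ((k 0 : ℝ) - 2) / 2 with hz₀
    have hz1 : 1 ≤ z₀ := by rw [hz₀]; linarith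
    refine ⟨z₀⁻¹, 0, 1 / 2, id, fun _ => z₀, by norm_num, continuousOn_id, continuousOn_const,
      Or.inl ⟨rfl, rfl⟩, hk0, fun x hx => ?_⟩
    have hsink : sink W (4 * (0 : ℤ) + x) z₀⁻¹ = z₀⁻¹ := by
      rw [sink_of_pos W (by positivity), inv_inv]
      unfold stretch
      rw [W.gate 0 x hx.1 (by linarith [hx.2]), hW]
      simp
    have htr : (chainHomeo W)^[∑ i ∈ Finset.range (0 + 1), k i] (chart 0 (x, z₀⁻¹))
          = chart ((0 : ℕ) + 1) (x, z₀⁻¹) := by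
      rw [zero_add, Finset.sum_range_one]
      have := gate_transit_of_eq (W := W) (i := 0) (s := x) (s' := x) (y := z₀⁻¹) (k := k 0) hx.1
        (by linarith [hx.2]) (by linarith [hx.2]) (by rw [hsink]; positivity) (by omega)
        (by rw [hsink, inv_inv, max_eq_right hz1, hz₀]; ring)
      rwa [hsink] at this
    refine ⟨hx, ⟨by rw [hz₀]; linarith, by rw [hz₀]; linarith⟩, htr, fun l hl => ?_⟩
    interval_cases l
    · exact ⟨x, hx, z₀⁻¹, inv_mem hz1, rfl⟩
    · exact ⟨x, hx, z₀⁻¹, inv_mem hz1, htr⟩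
  | succ m ih =>
    obtain ⟨y, p, q, s, z, hpq, hs, hz, hend, hkm, h⟩ := ih fun i hi => hk i (by omega)
    obtain ⟨hlow, hhigh⟩ := hk m (by omega)
    set v := W.val (m + 1) with hv
    have hv0 : 0 ≤ v := W.val_nonneg _
    set K : ℝ := (k m : ℝ) with hK
    set K' : ℝ := (k (m + 1) : ℝ) with hK'
    have hK5 : 5 ≤ K := by rw [hK]; exact_mod_cast hkm
    have hlow' : K + 1 ≤ K' := by rw [hK, hK']; exact_mod_cast hlow
    have hz1 : ∀ x ∈ Icc p q, 1 ≤ z x := fun x hx => by linarith [(h x hx).2.1.1]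
    set z' : ℝ → ℝ := fun x => z x + 2 * s x * (z x ^ v - 1) with hz'
    have hz'c : ContinuousOn z' (Icc p q) := by
      have : ContinuousOn (fun x => z x ^ v) (Icc p q) :=
        hz.rpow_const fun x hx => Or.inr hv0
      fun_prop
    set s' : ℝ → ℝ := fun x => s x + K' - 2 - 2 * z' x with hs'
    have hs'c : ContinuousOn s' (Icc p q) := by fun_prop
    have hat0 : ∀ x ∈ Icc p q, s x = 0 → 1 / 2 ≤ s' x := by
      intro x hx h0
      simp only [hs', hz', h0]
      linarith [(h x hx).2.1.2]
    have hat1 : ∀ x ∈ Icc p q, s x = 1 / 2 → s' x ≤ 0 := by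
      intro x hx h0
      simp only [hs', hz', h0]
      have h1 := (h x hx).2.1.1
      have h2 := Real.rpow_le_rpow (by linarith) h1 hv0
      linarith
    obtain ⟨p', q', hpp, hpq', hqq, hmem, hend'⟩ := exists_crossing (a := 0) (b := 1 / 2) hpq hs'c
      (by
        rcases hend with ⟨h0, h1⟩ | ⟨h0, h1⟩
        · exact Or.inr ⟨hat0 p ⟨le_rfl, hpq⟩ h0, hat1 q ⟨hpq, le_rfl⟩ h1⟩
        · exact Or.inl ⟨hat1 p ⟨le_rfl, hpq⟩ h0, hat0 q ⟨hpq, le_rfl⟩ h1⟩) (by norm_num)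
    have hsub : Icc p' q' ⊆ Icc p q := Icc_subset_Icc hpp hqq
    refine ⟨y, p', q', s', z', hpq', hs'c.mono hsub, hz'c.mono hsub, hend', by omega,
      fun x hx => ?_⟩
    have hx' := hsub hx
    obtain ⟨hsx, hzx, horb, hhalf⟩ := h x hx'
    have hs'x := hmem x hx
    have hz1x := hz1 x hx'
    have hzz' : z x ≤ z' x := by
      have : 1 ≤ z x ^ v := Real.one_le_rpow hz1x hv0
      have := mul_nonneg (mul_nonneg zero_le_two hsx.1) (sub_nonneg.2 this)
      simp only [hz']; linarith
    have hsink : sink W (4 * ((m + 1 : ℤ) : ℝ) + s x) (z x)⁻¹ = (z' x)⁻¹ := by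
      rw [sink_of_pos W (by positivity), inv_inv]
      unfold stretch
      rw [W.gate (m + 1) (s x) hsx.1 (by linarith [hsx.2]), max_eq_right hz1x,
        bump_eq (m + 1) hsx.1 (by linarith [hsx.2]),
        min_eq_left (by linarith [hsx.2]), max_eq_right (by linarith [hsx.1])]
    have hz'pos : 0 < z' x := by linarith
    have htr : (chainHomeo W)^[∑ i ∈ Finset.range (m + 1 + 1), k i] (chart 0 (x, y))
        = chart ((m + 1 : ℕ) + 1) (s' x, (z' x)⁻¹) := by
      rw [Finset.sum_range_succ, add_comm, Function.iterate_add_apply, horb]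
      have := gate_transit_of_eq (W := W) (i := m + 1) (s := s x) (s' := s' x) (y := (z x)⁻¹)
        (k := k (m + 1)) hsx.1 (by linarith [hsx.2]) (by linarith [hs'x.2])
        (by rw [hsink]; positivity) (by omega)
        (by rw [hsink, inv_inv, max_eq_right (hz1x.trans hzz')]; simp only [hs', hK']; ring)
      rw [hsink] at this
      exact_mod_cast this
    have hs'z : s' x = s x + K' - 2 - 2 * z' x := rfl
    refine ⟨hs'x, ⟨by linarith [hs'x.2, hsx.1], by linarith [hs'x.1, hsx.2]⟩, htr, fun l hl => ?_⟩
    rcases Nat.lt_or_ge l (m + 2) with hl' | hl'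
    · exact hhalf l (by omega)
    · obtain rfl : l = m + 1 + 1 := by omega
      refine ⟨s' x, hs'x, (z' x)⁻¹, inv_mem (hz1x.trans hzz'), ?_⟩
      rw [htr]; push_cast; rfl

end BrouwerChain

namespace BrouwerChain

variable {W : GateWeight}

/-- The transit time from gate `l` to gate `l + 1` encoded by the first transit time and the
successive increments. -/
def transit {m : ℕ} (k₀ : ℕ) (j : Fin m → ℕ) (l : ℕ) : ℕ :=
  k₀ + l + ∑ i ∈ Finset.range l, if h : i < m then j ⟨i, h⟩ else 0

/-- The time of the visit of gate `l` when gate `0` is visited at time `T`. -/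
def visitTime {m : ℕ} (T k₀ : ℕ) (j : Fin m → ℕ) (l : ℕ) : ℕ :=
  T + ∑ i ∈ Finset.range l, transit k₀ j i

lemma transit_succ {m : ℕ} (k₀ : ℕ) (j : Fin m → ℕ) {i : ℕ} (hi : i < m) :
    transit k₀ j (i + 1) = transit k₀ j i + 1 + j ⟨i, hi⟩ := by
  unfold transit
  rw [Finset.sum_range_succ, dif_pos hi]; ring

lemma transit_zero {m : ℕ} (k₀ : ℕ) (j : Fin m → ℕ) : transit k₀ j 0 = k₀ := by simp [transit]

lemma visitTime_succ {m : ℕ} (T k₀ : ℕ) (j : Fin m → ℕ) (l : ℕ) :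
    visitTime T k₀ j (l + 1) = visitTime T k₀ j l + transit k₀ j l := by
  unfold visitTime
  rw [Finset.sum_range_succ, add_assoc]

lemma eq_of_visitTime_eq {m T T' k₀ k₀' : ℕ} {j j' : Fin m → ℕ}
    (h : ∀ l ≤ m + 1, visitTime T k₀ j l = visitTime T' k₀' j' l) :
    T = T' ∧ k₀ = k₀' ∧ j = j' := by
  have hT : ∀ l ≤ m, transit k₀ j l = transit k₀' j' l := by
    intro l hl
    have h1 := h (l + 1) (by omega)
    rw [visitTime_succ, visitTime_succ, h l (by omega)] at h1
    omega
  refine ⟨by simpa [visitTime] using h 0 (by omega), ?_, funext fun ⟨i, hi⟩ => ?_⟩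
  · simpa [transit_zero] using hT 0 (by omega)
  · have h1 := hT (i + 1) hi
    rw [transit_succ _ _ hi, transit_succ _ _ hi, hT i hi.le] at h1
    omega

lemma visitTime_lt {m N T k₀ : ℕ} {j : Fin m → ℕ} (hN : 1 ≤ N) (hT : T < N) (hk : k₀ ≤ 3 * N + 5)
    (hj : ∀ i, j i ≤ N) {l : ℕ} (hl : l ≤ m + 1) :
    visitTime T k₀ j l < (1 + (m + 1) * (8 + 2 * m)) * N := by
  have htr : ∀ i ∈ Finset.range l, transit k₀ j i ≤ (8 + 2 * m) * N := by
    intro i hi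
    have him : i ≤ m := by have := Finset.mem_range.1 hi; omega
    have hsum : ∑ x ∈ Finset.range i, (if h : x < m then j ⟨x, h⟩ else 0) ≤ i * N := by
      refine (Finset.sum_le_card_nsmul _ _ N fun x _ => ?_).trans_eq (by simp)
      split_ifs with h
      · exact hj _
      · exact Nat.zero_le _
    unfold transit
    have h1 : i * N ≤ m * N := Nat.mul_le_mul_right _ him
    have h2 : m ≤ m * N := Nat.le_mul_of_pos_right _ hN
    nlinarith
  have hsum := Finset.sum_le_card_nsmul _ _ _ htr
  rw [Finset.card_range, smul_eq_mul] at hsum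
  have := Nat.mul_le_mul_right ((8 + 2 * m) * N) hl
  unfold visitTime
  nlinarith

lemma exists_orbit {m N : ℕ} (hW : W.val 0 = 0)
    (hN : ∀ i < m, 3 ≤ (N : ℝ) ^ W.val (i + 1)) (T : ℕ) {k₀ : ℕ} (hk₀ : 2 * N + 5 ≤ k₀)
    {j : Fin m → ℕ} (hj : ∀ i : Fin m, (j i : ℝ) + 1 ≤ (N : ℝ) ^ W.val ((i : ℕ) + 1)) :
    ∃ P : ℝ × ℝ, ∀ l ≤ m + 1, InHalfGate l ((chainHomeo W)^[visitTime T k₀ j l] P) := by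
  obtain ⟨y, p, q, s, z, hpq, -, -, -, -, h⟩ := exists_path hW (transit k₀ j)
    (by rw [transit_zero]; omega) m fun i hi => by
      refine ⟨by rw [transit_succ _ _ hi]; omega, ?_⟩
      have h1 : (2 * N + 5 : ℝ) ≤ transit k₀ j i := by
        have : 2 * N + 5 ≤ transit k₀ j i := by unfold transit; omega
        exact_mod_cast this
      have h2 : (N : ℝ) ^ W.val (i + 1)
          ≤ (((transit k₀ j i : ℝ) - 5 / 2) / 2) ^ W.val (i + 1) :=
        Real.rpow_le_rpow (by positivity) (by linarith) (W.val_nonneg _)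
      have h3 := hN i hi
      have h4 := hj ⟨i, hi⟩
      rw [transit_succ _ _ hi]
      push_cast
      simp only at h4
      linarith
  refine ⟨(chainHomeo W).symm^[T] (chart 0 (p, y)), fun l hl => ?_⟩
  unfold visitTime
  rw [add_comm, Function.iterate_add_apply, iterate_symm_iterate]
  exact (h p ⟨le_rfl, hpq⟩).2.2.2 l hl

lemma card_le_maxSep_chainHomeo (m : ℕ) (hW : W.val 0 = 0) : ∃ ε : ℝ, 0 < ε ∧ ∀ n N : ℕ, 1 ≤ N →
    (1 + (m + 1) * (8 + 2 * m)) * N ≤ n → (∀ i < m, 3 ≤ (N : ℝ) ^ W.val (i + 1)) →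
    N * (N * ∏ i : Fin m, ⌊(N : ℝ) ^ W.val ((i : ℕ) + 1)⌋₊)
      ≤ maxSep (onePointExtend (chainHomeo W)) n ε := by
  classical
  obtain ⟨ε, hε, hsep⟩ := exists_separation W (m + 1)
  refine ⟨ε, hε, fun n N hN1 hNn hN => ?_⟩
  set I : Finset (ℕ × ℕ × (Fin m → ℕ)) := Finset.range N ×ˢ Finset.range N ×ˢ
    Fintype.piFinset fun i : Fin m => Finset.range ⌊(N : ℝ) ^ W.val ((i : ℕ) + 1)⌋₊ with hI
  have hcard : I.card = N * (N * ∏ i : Fin m, ⌊(N : ℝ) ^ W.val ((i : ℕ) + 1)⌋₊) := by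
    rw [hI, Finset.card_product, Finset.card_product, Fintype.card_piFinset]
    simp only [Finset.card_range]
  have hmemI : ∀ τ ∈ I, τ.1 < N ∧ τ.2.1 < N ∧
      ∀ i, (τ.2.2 i : ℝ) + 1 ≤ (N : ℝ) ^ W.val ((i : ℕ) + 1) := by
    intro τ hτ
    simp only [hI, Finset.mem_product, Finset.mem_range, Fintype.mem_piFinset] at hτ
    refine ⟨hτ.1, hτ.2.1, fun i => ?_⟩
    have h1 := Nat.floor_le (a := (N : ℝ) ^ W.val ((i : ℕ) + 1)) (by positivity)
    have h2 : ((τ.2.2 i + 1 : ℕ) : ℝ) ≤ (⌊(N : ℝ) ^ W.val ((i : ℕ) + 1)⌋₊ : ℝ) :=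
      Nat.cast_le.2 (hτ.2.2 i)
    push_cast at h2
    linarith
  have hex : ∀ τ : ℕ × ℕ × (Fin m → ℕ), ∃ P : ℝ × ℝ, τ ∈ I → ∀ l ≤ m + 1,
      InHalfGate l ((chainHomeo W)^[visitTime τ.1 (2 * N + 5 + τ.2.1) τ.2.2 l] P) := by
    intro τ
    by_cases hτ : τ ∈ I
    · obtain ⟨P, hP⟩ := exists_orbit hW hN τ.1 (k₀ := 2 * N + 5 + τ.2.1) (by omega)
        (hmemI τ hτ).2.2
      exact ⟨P, fun _ => hP⟩
    · exact ⟨0, fun h => absurd h hτ⟩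
  choose P hP using hex
  have hdist : ∀ τ ∈ I, ∀ τ' ∈ I, τ ≠ τ' → ∃ k < n,
      ε < dist ((onePointExtend (chainHomeo W))^[k] (P τ : OnePoint (ℝ × ℝ)))
        ((onePointExtend (chainHomeo W))^[k] (P τ' : OnePoint (ℝ × ℝ))) := by
    intro τ hτ τ' hτ' hne
    by_contra! hn
    refine hne ?_
    have hall : ∀ l ≤ m + 1, visitTime τ.1 (2 * N + 5 + τ.2.1) τ.2.2 l
        = visitTime τ'.1 (2 * N + 5 + τ'.2.1) τ'.2.2 l := by
      intro l hl
      by_contra hne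
      obtain ⟨h1, h2, h3⟩ := hmemI τ hτ
      have hlt : visitTime τ.1 (2 * N + 5 + τ.2.1) τ.2.2 l < n := by
        refine (visitTime_lt hN1 h1 (by omega) (fun i => ?_) hl).trans_le hNn
        have h4 : (N : ℝ) ^ W.val ((i : ℕ) + 1) ≤ N := by
          simpa using Real.rpow_le_rpow_of_exponent_le
            (show (1 : ℝ) ≤ N by exact_mod_cast hN1) (W.val_le_one ((i : ℕ) + 1))
        have h5 := h3 i
        have : (τ.2.2 i : ℝ) ≤ N := by linarith
        exact_mod_cast this
      have h6 := hn _ hlt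
      rw [iterate_onePointExtend, iterate_onePointExtend] at h6
      exact absurd (hsep _ _ l _ _ hl (hP τ hτ l hl) (hP τ' hτ' l hl) hne) (not_lt.2 h6)
    obtain ⟨e1, e2, e3⟩ := eq_of_visitTime_eq hall
    exact Prod.ext e1 (Prod.ext (by omega) e3)
  have hinj : Set.InjOn (fun τ => (P τ : OnePoint (ℝ × ℝ))) I := by
    intro τ hτ τ' hτ' he
    by_contra hne
    obtain ⟨k, -, hk⟩ := hdist τ hτ τ' hτ' hne
    simp only at he
    rw [he, dist_self] at hk
    exact absurd hk (not_lt.2 hε.le)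
  have hE : IsDynSeparated (onePointExtend (chainHomeo W)) n ε
      (↑(I.image fun τ => (P τ : OnePoint (ℝ × ℝ))) : Set (OnePoint (ℝ × ℝ))) := by
    intro x hx y hy hxy
    obtain ⟨τ, hτ, rfl⟩ := Finset.mem_image.1 (Finset.mem_coe.1 hx)
    obtain ⟨τ', hτ', rfl⟩ := Finset.mem_image.1 (Finset.mem_coe.1 hy)
    exact hdist τ hτ τ' hτ' fun h => hxy (by rw [h])
  obtain ⟨m', C, -, hbound⟩ := exists_card_bound W hε
  have hn1 : 1 ≤ n := le_trans (Nat.one_le_iff_ne_zero.2 (by positivity)) hNn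
  rw [← hcard, ← Finset.card_image_of_injOn hinj]
  exact card_le_maxSep (hbound n hn1) hE

lemma le_polEntropy_chainHomeo (m : ℕ) (hW : W.val 0 = 0)
    (hpos : ∀ i < m, 0 < W.val (i + 1)) :
    ENNReal.ofReal (2 + ∑ i : Fin m, W.val ((i : ℕ) + 1))
      ≤ polEntropy (onePointExtend (chainHomeo W)) := by
  obtain ⟨ε, hε, h⟩ := card_le_maxSep_chainHomeo m hW
  set K : ℕ := 1 + (m + 1) * (8 + 2 * m) with hK
  have hK0 : 0 < K := by rw [hK]; positivity
  have hKr : (0 : ℝ) < K := by exact_mod_cast hK0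
  set d : ℝ := 2 + ∑ i : Fin m, W.val ((i : ℕ) + 1) with hd
  have hd0 : 0 ≤ d := add_nonneg zero_le_two (Finset.sum_nonneg fun i _ => W.val_nonneg _)
  refine le_polEntropy hε (c := (1 / 2) ^ m * (1 / (2 * K)) ^ d) (by positivity) ?_
  have htend : Tendsto (fun n : ℕ => n / K) atTop atTop := Nat.tendsto_div_const_atTop hK0.ne'
  have hev : ∀ i ∈ Finset.range m, ∀ᶠ N : ℕ in atTop, 3 ≤ (N : ℝ) ^ W.val (i + 1) := fun i hi =>
    ((tendsto_rpow_atTop (hpos i (Finset.mem_range.1 hi))).comp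
      tendsto_natCast_atTop_atTop).eventually_ge_atTop 3
  have hev := htend.eventually ((Filter.eventually_all_finset _).2 hev)
  filter_upwards [hev, htend.eventually_ge_atTop 1] with n hn hN1
  set N : ℕ := n / K with hNdef
  have hNn : K * N ≤ n := Nat.mul_div_le n K
  have hmax := h n N hN1 hNn fun i hi => hn i (Finset.mem_range.2 hi)
  have hN0 : (0 : ℝ) < N := by exact_mod_cast hN1
  have hnN : 1 / (2 * K) * (n : ℝ) ≤ N := by
    have h1 : n < K * (N + 1) := Nat.lt_mul_div_succ n hK0
    have h2 : n ≤ 2 * K * N := by nlinarith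
    have h3 : (n : ℝ) ≤ 2 * K * N := by exact_mod_cast h2
    rw [div_mul_eq_mul_div, one_mul, div_le_iff₀ (by positivity)]
    linarith
  have hfloor : ∀ i : Fin m, (1 / 2) * (N : ℝ) ^ W.val ((i : ℕ) + 1)
      ≤ (⌊(N : ℝ) ^ W.val ((i : ℕ) + 1)⌋₊ : ℝ) := by
    intro i
    have h1 := Nat.lt_floor_add_one ((N : ℝ) ^ W.val ((i : ℕ) + 1))
    have h2 := hn i (Finset.mem_range.2 i.2)
    linarith
  have hprod := Finset.prod_le_prod (s := (Finset.univ : Finset (Fin m)))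
    (fun i _ => by positivity) fun i _ => hfloor i
  rw [Finset.prod_mul_distrib, Finset.prod_const, Finset.card_univ, Fintype.card_fin,
    ← Real.rpow_sum_of_pos hN0] at hprod
  calc (1 / 2) ^ m * (1 / (2 * K)) ^ d * (n : ℝ) ^ d
      = (1 / 2) ^ m * (1 / (2 * K) * (n : ℝ)) ^ d := by
        rw [Real.mul_rpow (by positivity) (by positivity), mul_assoc]
    _ ≤ (1 / 2) ^ m * (N : ℝ) ^ d := by gcongr
    _ = N * (N * ((1 / 2) ^ m * (N : ℝ) ^ (∑ i : Fin m, W.val ((i : ℕ) + 1)))) := by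
        rw [hd, Real.rpow_add hN0, Real.rpow_two]; ring
    _ ≤ N * (N * ∏ i : Fin m, (⌊(N : ℝ) ^ W.val ((i : ℕ) + 1)⌋₊ : ℝ)) := by gcongr
    _ ≤ _ := by exact_mod_cast hmax

end BrouwerChain

namespace BrouwerChain

/-- A continuous function equal to `i` on the gate of column `i`. -/
noncomputable def ramp (x : ℝ) : ℝ :=
  x / 4 + (max 0 ((4 * Int.fract (x / 4) - 1) / 3) - Int.fract (x / 4))

lemma continuous_ramp : Continuous ramp := by
  have := ContinuousOn.comp_fract (β := ℝ) (γ := ℝ) (s := fun x : ℝ => x / 4)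
    (f := fun _ t => max 0 ((4 * t - 1) / 3) - t)
    (Continuous.continuousOn (by fun_prop)) (by fun_prop) (by intro x; norm_num)
  exact (continuous_id.div_const 4).add this

lemma ramp_gate (i : ℤ) {s : ℝ} (h0 : 0 ≤ s) (h1 : s ≤ 1) : ramp (4 * i + s) = i := by
  unfold ramp
  rw [fract_div_four i h0 (by linarith), max_eq_left (by linarith)]; ring

/-- The gate weight with prescribed exponents, truncated to `[0, 1]`. -/
noncomputable def gateWeight (g : ℝ → ℝ) (hg : Continuous g) : GateWeight where
  fn x := max 0 (min 1 (g (ramp x)))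
  val i := max 0 (min 1 (g i))
  cont := continuous_const.max (continuous_const.min (hg.comp continuous_ramp))
  nonneg _ := le_max_left _ _
  le_one _ := max_le zero_le_one (min_le_left _ _)
  gate i s h0 h1 := by rw [ramp_gate i h0 h1]

lemma sum_Icc_val {W : GateWeight} (hW : ∀ i ≤ 0, W.val i = 0) (m : ℕ) :
    ∑ i ∈ Finset.Icc (-(m : ℤ)) m, W.val i = ∑ k ∈ Finset.range m, W.val (k + 1) := by
  rw [← Finset.sum_image (f := W.val) (g := fun k : ℕ => (k : ℤ) + 1) (s := Finset.range m)
    (fun a _ b _ h => by simpa using h)]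
  symm
  refine Finset.sum_subset (fun i hi => ?_) fun i hi hn => hW i ?_
  · obtain ⟨k, hk, rfl⟩ := Finset.mem_image.1 hi
    have := Finset.mem_range.1 hk
    exact Finset.mem_Icc.2 ⟨by omega, by omega⟩
  · by_contra! h
    have := Finset.mem_Icc.1 hi
    exact hn (Finset.mem_image.2 ⟨(i - 1).toNat, Finset.mem_range.2 (by omega), by omega⟩)

lemma exists_polEntropy_eq_ofReal {a : ℝ} (ha : 0 ≤ a) :
    ∃ W : GateWeight, polEntropy (onePointExtend (chainHomeo W)) = ENNReal.ofReal (2 + a) := by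
  set W := gateWeight (fun t => min t (a + 1 - t)) (by fun_prop) with hW
  have hval : ∀ i : ℤ, W.val i = max 0 (min 1 (min (i : ℝ) (a + 1 - i))) := fun _ => rfl
  have hneg : ∀ i ≤ 0, W.val i = 0 := by
    intro i hi
    rw [hval, max_eq_left]
    exact (min_le_right _ _).trans ((min_le_left _ _).trans (by exact_mod_cast hi))
  have hsucc : ∀ k : ℕ, W.val (k + 1) = min ((k + 1 : ℕ) : ℝ) a - min (k : ℝ) a := by
    intro k
    have hk : (0 : ℝ) ≤ k := k.cast_nonneg
    rw [hval]
    push_cast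
    rcases le_total a k with h | h
    · rw [min_eq_right h, min_eq_right (by linarith : a ≤ (k : ℝ) + 1), sub_self, max_eq_left]
      exact (min_le_right _ _).trans ((min_le_right _ _).trans (by linarith))
    · rw [min_eq_left h]
      rcases le_total a (k + 1) with h' | h'
      · rw [min_eq_right h', min_eq_right (a := (k : ℝ) + 1) (by linarith),
          min_eq_right (by linarith), max_eq_right (by linarith)]; ring
      · rw [min_eq_left h', min_eq_left (le_min (by linarith) (by linarith)),
          max_eq_right zero_le_one]; ring
  have hsum : ∀ m : ℕ, ∑ k ∈ Finset.range m, W.val (k + 1) = min (m : ℝ) a := by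
    intro m
    simp only [hsucc]
    rw [Finset.sum_range_sub (fun k : ℕ => min (k : ℝ) a)]
    simp [ha]
  refine ⟨W, le_antisymm (polEntropy_chainHomeo_le W fun m => ?_) ?_⟩
  · rw [sum_Icc_val hneg, hsum]
    linarith [min_le_right (m : ℝ) a]
  · have h := le_polEntropy_chainHomeo (W := W) ⌈a⌉₊ (hneg 0 le_rfl) fun i hi => by
      have hia := Nat.lt_ceil.1 hi
      have hi0 : (0 : ℝ) ≤ i := i.cast_nonneg
      rw [hval]
      push_cast
      exact lt_max_of_lt_right (lt_min one_pos (lt_min (by linarith) (by linarith)))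
    rwa [Fin.sum_univ_eq_sum_range (fun k : ℕ => W.val ((k : ℤ) + 1)), hsum,
      min_eq_right (Nat.le_ceil a)] at h

lemma exists_polEntropy_eq_top :
    ∃ W : GateWeight, polEntropy (onePointExtend (chainHomeo W)) = ⊤ := by
  set W := gateWeight id continuous_id with hW
  have hval : ∀ i : ℤ, W.val i = max 0 (min 1 (i : ℝ)) := fun _ => rfl
  have hone : ∀ k : ℕ, W.val (k + 1) = 1 := by
    intro k
    rw [hval]
    push_cast
    rw [min_eq_left (by linarith [(k.cast_nonneg : (0 : ℝ) ≤ k)]), max_eq_right zero_le_one]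
  refine ⟨W, ENNReal.eq_top_of_forall_nnreal_le fun r => ?_⟩
  have h := le_polEntropy_chainHomeo (W := W) ⌈(r : ℝ)⌉₊ (by simp [hval])
    fun i _ => by rw [hone]; exact one_pos
  refine le_trans ?_ h
  rw [← ENNReal.ofReal_coe_nnreal]
  refine ENNReal.ofReal_le_ofReal ?_
  simp only [hone]
  simp only [Finset.sum_const, Finset.card_univ, Fintype.card_fin, nsmul_eq_mul, mul_one]
  linarith [Nat.le_ceil (r : ℝ)]

end BrouwerChain

/-- every extended real `α ∈ [2, +∞]` is the polynomial entropy of some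
Brouwer homeomorphism. -/
theorem brouwer_polEntropy_realizes_every_value_ge_two (α : ℝ≥0∞) (hα : 2 ≤ α) :
    ∃ f : (ℝ × ℝ) ≃ₜ (ℝ × ℝ), IsBrouwer f ∧ polEntropy (onePointExtend ⇑f) = α := by
  suffices ∃ W : BrouwerChain.GateWeight,
      polEntropy (onePointExtend (BrouwerChain.chainHomeo W)) = α by
    obtain ⟨W, hW⟩ := this
    exact ⟨BrouwerChain.chainHomeo W, BrouwerChain.isBrouwer_chainHomeo W, hW⟩
  rcases eq_or_ne α ⊤ with rfl | h
  · exact BrouwerChain.exists_polEntropy_eq_top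
  · have h2 : 2 ≤ α.toReal := by simpa using ENNReal.toReal_mono h hα
    obtain ⟨W, hW⟩ := BrouwerChain.exists_polEntropy_eq_ofReal (sub_nonneg.2 h2)
    exact ⟨W, by rw [hW, add_sub_cancel, ENNReal.ofReal_toReal h]⟩
end

section
/- The translation T(x,y) = (x+1, y) of the plane has polynomial entropy equal to 1; that is, the extension of T to the one-point compactification S² = ℝ² ∪ {∞}, fixing ∞, has polynomial entropy 1. -/
open Filter Topology Set
open scoped ENNReal

/-- A coding of `X` by a finite set whose classes are not `(n, ε)`-separated bounds the size of
`(n, ε)`-separated sets. -/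
lemma IsDynSeparated.card_le_of_code {X ι : Type*} [MetricSpace X] {f : X → X} {n : ℕ} {ε : ℝ}
    {E : Finset X} (hE : IsDynSeparated f n ε ↑E) (code : X → ι) (T : Finset ι)
    (hT : ∀ x, code x ∈ T)
    (hcode : ∀ x y, code x = code y → ∀ k < n, dist (f^[k] x) (f^[k] y) ≤ ε) :
    E.card ≤ T.card := by
  refine Finset.card_le_card_of_injOn code (fun x _ => hT x) fun x hx y hy hxy => ?_
  by_contra hne
  obtain ⟨k, hk, hlt⟩ := hE x hx y hy hne
  exact absurd hlt (not_lt.mpr (hcode x y hxy k hk))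

/-- Linear upper bounds for all `ε` and a linear lower bound for one `ε` force polynomial
entropy `1`. -/
lemma polEntropy_eq_one_of_linear {X : Type*} [MetricSpace X] {f : X → X}
    (hupper : ∀ ε > 0, ∃ C : ℕ, ∀ n ≥ 1, maxSep f n ε ≤ C * n)
    (hlower : ∃ ε > 0, ∀ n, n ≤ maxSep f n ε) : polEntropy f = 1 := by
  apply le_antisymm
  · refine iSup₂_le fun ε hε => ?_
    obtain ⟨C, hC⟩ := hupper ε hε
    have hlim : Tendsto (fun n : ℕ => ENNReal.ofReal (Real.log (C + 1) / Real.log n + 1))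
        atTop (𝓝 1) := by
      have h := (((Real.tendsto_log_atTop.comp tendsto_natCast_atTop_atTop).const_div_atTop
        (Real.log (C + 1))).add_const 1)
      simpa using ENNReal.tendsto_ofReal h
    rw [← hlim.limsup_eq]
    refine limsup_le_limsup ?_
    filter_upwards [eventually_ge_atTop 2] with n hn
    have hn0 : (0 : ℝ) < n := by positivity
    have hlog : 0 < Real.log n := Real.log_pos (by exact_mod_cast hn)
    apply ENNReal.ofReal_le_ofReal
    rw [div_add_one hlog.ne', ← Real.log_mul (by positivity) hn0.ne']
    refine div_le_div_of_nonneg_right ?_ hlog.le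
    rcases Nat.eq_zero_or_pos (maxSep f n ε) with h0 | hpos
    · rw [h0, Nat.cast_zero, Real.log_zero]
      exact Real.log_nonneg (by exact_mod_cast Nat.mul_pos C.succ_pos (by omega))
    · refine Real.log_le_log (by exact_mod_cast hpos) ?_
      exact_mod_cast (hC n (by omega)).trans (Nat.mul_le_mul_right n C.le_succ)
  · obtain ⟨ε, hε, h⟩ := hlower
    refine le_trans ?_ (le_iSup₂ (f := fun (ε : ℝ) (_ : 0 < ε) => atTop.limsup fun n : ℕ =>
      ENNReal.ofReal (Real.log (maxSep f n ε) / Real.log n)) ε hε)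
    refine le_limsup_of_frequently_le (Eventually.frequently ?_)
    filter_upwards [eventually_ge_atTop 2] with n hn
    have hlog : 0 < Real.log n := Real.log_pos (by exact_mod_cast hn)
    rw [ENNReal.one_le_ofReal, one_le_div hlog]
    exact Real.log_le_log (by positivity) (by exact_mod_cast h n)

lemma onePoint_dist_eq (a b : OnePoint (ℝ × ℝ)) :
    dist a b = dist (spherePoint a) (spherePoint b) := rfl

lemma norm_spherePoint_le {m : ℝ} (hm : 0 < m) {w : ℝ × ℝ} (hw : m ≤ ‖w‖) (hw1 : 1 ≤ ‖w‖) :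
    ‖spherePoint (w : OnePoint (ℝ × ℝ))‖ ≤ 1 / m := by
  have key : (1 + ‖w‖ ^ 2)⁻¹ * ‖w‖ ≤ 1 / m := by
    rw [inv_mul_eq_div, div_le_div_iff₀ (by positivity) hm]
    nlinarith
  have hpos : 0 < (1 + ‖w‖ ^ 2)⁻¹ := by positivity
  change ‖((1 + ‖w‖ ^ 2)⁻¹ • w, (1 + ‖w‖ ^ 2)⁻¹)‖ ≤ 1 / m
  rw [Prod.norm_mk, norm_smul, Real.norm_of_nonneg hpos.le]
  exact max_le key (by nlinarith)

lemma abs_inv_one_add_sq_sub_mul_le {a b c : ℝ} (ha : 0 ≤ a) (hb : 0 ≤ b)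
    (h : c * (a + b) ≤ (1 + a ^ 2) * (1 + b ^ 2)) :
    |(1 + a ^ 2)⁻¹ - (1 + b ^ 2)⁻¹| * c ≤ |a - b| := by
  have h1 : (1 + a ^ 2)⁻¹ - (1 + b ^ 2)⁻¹ =
      (b - a) * ((a + b) / ((1 + a ^ 2) * (1 + b ^ 2))) := by
    field_simp
    ring
  rw [h1, abs_mul, abs_sub_comm b a, mul_assoc,
    abs_of_nonneg (a := (a + b) / _) (by positivity)]
  refine mul_le_of_le_one_right (abs_nonneg _) ?_
  rw [div_mul_eq_mul_div, div_le_one (by positivity)]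
  linarith

lemma onePoint_dist_coe_le (v w : ℝ × ℝ) :
    dist (v : OnePoint (ℝ × ℝ)) (w : OnePoint (ℝ × ℝ)) ≤ 2 * ‖v - w‖ := by
  have hv := norm_nonneg v
  have hw := norm_nonneg w
  have hvw := norm_nonneg (v - w)
  have hnorm := abs_norm_sub_norm_le v w
  rw [onePoint_dist_eq, dist_eq_norm]
  change ‖((1 + ‖v‖ ^ 2)⁻¹ • v - (1 + ‖w‖ ^ 2)⁻¹ • w,
    (1 + ‖v‖ ^ 2)⁻¹ - (1 + ‖w‖ ^ 2)⁻¹)‖ ≤ 2 * ‖v - w‖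
  rw [Prod.norm_mk]
  refine max_le ?_ ?_
  · have h1 : (1 + ‖v‖ ^ 2)⁻¹ • v - (1 + ‖w‖ ^ 2)⁻¹ • w =
        (1 + ‖v‖ ^ 2)⁻¹ • (v - w) + ((1 + ‖v‖ ^ 2)⁻¹ - (1 + ‖w‖ ^ 2)⁻¹) • w := by
      module
    have h2 : |(1 + ‖v‖ ^ 2)⁻¹ - (1 + ‖w‖ ^ 2)⁻¹| * ‖w‖ ≤ |‖v‖ - ‖w‖| :=
      abs_inv_one_add_sq_sub_mul_le hv hw
        (by nlinarith [sq_nonneg (‖v‖ - ‖w‖), sq_nonneg (‖v‖ * ‖w‖)])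
    have h3 : (1 + ‖v‖ ^ 2)⁻¹ ≤ 1 := inv_le_one_of_one_le₀ (by nlinarith)
    calc _ ≤ (1 + ‖v‖ ^ 2)⁻¹ * ‖v - w‖ + |(1 + ‖v‖ ^ 2)⁻¹ - (1 + ‖w‖ ^ 2)⁻¹| * ‖w‖ := by
          rw [h1]
          refine (norm_add_le _ _).trans_eq ?_
          rw [norm_smul, norm_smul, Real.norm_of_nonneg (by positivity), Real.norm_eq_abs]
      _ ≤ 2 * ‖v - w‖ := by nlinarith
  · have h2 : |(1 + ‖v‖ ^ 2)⁻¹ - (1 + ‖w‖ ^ 2)⁻¹| * 1 ≤ |‖v‖ - ‖w‖| :=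
      abs_inv_one_add_sq_sub_mul_le hv hw
        (by nlinarith [sq_nonneg (‖v‖ - 1), sq_nonneg (‖w‖ - 1), sq_nonneg (‖v‖ * ‖w‖)])
    rw [Real.norm_eq_abs]
    linarith

lemma planeTranslation_extend_iterate_coe (k : ℕ) (w : ℝ × ℝ) :
    (onePointExtend planeTranslation)^[k] (w : OnePoint (ℝ × ℝ)) =
      ((w.1 + k, w.2) : ℝ × ℝ) := by
  induction k with
  | zero => simp
  | succ k ih =>
    rw [Function.iterate_succ_apply', ih]
    change ((w.1 + k + 1, w.2) : ℝ × ℝ) = ((_ : ℝ × ℝ) : OnePoint (ℝ × ℝ))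
    push_cast
    rw [add_assoc]

lemma planeTranslation_extend_iterate_infty (k : ℕ) :
    (onePointExtend planeTranslation)^[k] OnePoint.infty = OnePoint.infty :=
  Function.iterate_fixed rfl k

/-- The strip of points whose orbit segment of length `n` can meet the square `[-m, m]²`. -/
def meetingStrip (m n : ℕ) : Set (ℝ × ℝ) :=
  Icc (-(m + n : ℝ)) m ×ˢ Icc (-m : ℝ) m

open Classical in
/-- The cell of the grid of mesh `1 / m` containing a point of the strip; `none` for the other
points. -/
noncomputable def stripCode (m n : ℕ) (z : OnePoint (ℝ × ℝ)) : Option (ℤ × ℤ) :=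
  Option.elim z none fun w =>
    if w ∈ meetingStrip m n then some (⌊m * w.1⌋, ⌊m * w.2⌋) else none

lemma stripCode_coe_of_mem {m n : ℕ} {w : ℝ × ℝ} (h : w ∈ meetingStrip m n) :
    stripCode m n (w : OnePoint (ℝ × ℝ)) = some (⌊m * w.1⌋, ⌊m * w.2⌋) :=
  if_pos h

lemma stripCode_coe_of_notMem {m n : ℕ} {w : ℝ × ℝ} (h : w ∉ meetingStrip m n) :
    stripCode m n (w : OnePoint (ℝ × ℝ)) = none :=
  if_neg h

lemma stripCode_coe_eq_some {m n : ℕ} {w : ℝ × ℝ} {c : ℤ × ℤ}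
    (h : stripCode m n (w : OnePoint (ℝ × ℝ)) = some c) : (⌊m * w.1⌋, ⌊m * w.2⌋) = c := by
  by_cases hw : w ∈ meetingStrip m n
  · exact Option.some.inj ((stripCode_coe_of_mem hw).symm.trans h)
  · exact absurd (h.symm.trans (stripCode_coe_of_notMem hw)) (Option.some_ne_none c)

lemma stripCode_mem (m n : ℕ) (z : OnePoint (ℝ × ℝ)) :
    stripCode m n z ∈ Finset.insertNone
      (Finset.Icc (-(m * (m + n)) : ℤ) (m * m) ×ˢ Finset.Icc (-(m * m) : ℤ) (m * m)) := by
  cases z with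
  | infty => exact Finset.none_mem_insertNone
  | coe w =>
    by_cases h : w ∈ meetingStrip m n
    · rw [stripCode_coe_of_mem h]
      obtain ⟨⟨h1, h2⟩, h3, h4⟩ := h
      have hm : (0 : ℝ) ≤ m := m.cast_nonneg
      rw [Finset.some_mem_insertNone, Finset.mem_product, Finset.mem_Icc, Finset.mem_Icc]
      refine ⟨⟨Int.le_floor.mpr ?_, Int.cast_le (R := ℝ).mp ((Int.floor_le _).trans ?_)⟩,
        Int.le_floor.mpr ?_, Int.cast_le (R := ℝ).mp ((Int.floor_le _).trans ?_)⟩ <;>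
      push_cast <;> nlinarith
    · rw [stripCode_coe_of_notMem h]
      exact Finset.none_mem_insertNone

lemma norm_spherePoint_iterate_le {m n : ℕ} (hm : 1 ≤ m) {z : OnePoint (ℝ × ℝ)}
    (hz : stripCode m n z = none) {k : ℕ} (hk : k < n) :
    ‖spherePoint ((onePointExtend planeTranslation)^[k] z)‖ ≤ 1 / m := by
  have hm1 : (1 : ℝ) ≤ m := by exact_mod_cast hm
  have hkn : (k : ℝ) < n := by exact_mod_cast hk
  have hk0 : (0 : ℝ) ≤ k := k.cast_nonneg
  cases z with
  | infty =>
    rw [planeTranslation_extend_iterate_infty]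
    change ‖((0 : ℝ × ℝ), (0 : ℝ))‖ ≤ _
    simp
  | coe w =>
    have hw : w ∉ meetingStrip m n := fun h =>
      Option.some_ne_none _ ((stripCode_coe_of_mem h).symm.trans hz)
    rw [planeTranslation_extend_iterate_coe]
    have hle : (m : ℝ) ≤ ‖((w.1 + k, w.2) : ℝ × ℝ)‖ := by
      by_contra! hlt
      rw [Prod.norm_mk, max_lt_iff, Real.norm_eq_abs, Real.norm_eq_abs, abs_lt, abs_lt] at hlt
      obtain ⟨⟨h1, h2⟩, h3, h4⟩ := hlt
      exact hw ⟨⟨by linarith, by linarith⟩, h3.le, h4.le⟩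
    exact norm_spherePoint_le (by linarith) hle (hm1.trans hle)

lemma dist_le_of_floor_eq {m a b : ℝ} (hm : 0 < m) (h : ⌊m * a⌋ = ⌊m * b⌋) :
    |a - b| ≤ 1 / m := by
  have := Int.abs_sub_lt_one_of_floor_eq_floor h
  rw [← mul_sub, abs_mul, abs_of_pos hm] at this
  rw [le_div_iff₀ hm]
  linarith

lemma dist_iterate_le_of_stripCode_eq {m n : ℕ} (hm : 1 ≤ m) {x y : OnePoint (ℝ × ℝ)}
    (h : stripCode m n x = stripCode m n y) {k : ℕ} (hk : k < n) :
    dist ((onePointExtend planeTranslation)^[k] x) ((onePointExtend planeTranslation)^[k] y)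
      ≤ 2 / m := by
  have hm0 : (0 : ℝ) < m := by exact_mod_cast hm
  cases hx : stripCode m n x with
  | none =>
    have h1 := norm_spherePoint_iterate_le hm hx hk
    have h2 := norm_spherePoint_iterate_le hm (h ▸ hx) hk
    rw [onePoint_dist_eq]
    refine (dist_le_norm_add_norm _ _).trans ((add_le_add h1 h2).trans_eq ?_)
    ring
  | some c =>
    have hy : stripCode m n y = some c := h ▸ hx
    cases x with
    | infty => exact absurd hx (Option.some_ne_none c).symm
    | coe v =>
    cases y with
    | infty => exact absurd hy (Option.some_ne_none c).symm
    | coe w =>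
    obtain ⟨h1, h2⟩ := Prod.mk.inj
      ((stripCode_coe_eq_some hx).trans (stripCode_coe_eq_some hy).symm)
    rw [planeTranslation_extend_iterate_coe, planeTranslation_extend_iterate_coe]
    refine (onePoint_dist_coe_le _ _).trans ?_
    have hle : ‖((v.1 + k, v.2) : ℝ × ℝ) - (w.1 + k, w.2)‖ ≤ 1 / m := by
      rw [Prod.mk_sub_mk, add_sub_add_right_eq_sub, Prod.norm_mk]
      exact max_le (dist_le_of_floor_eq hm0 h1) (dist_le_of_floor_eq hm0 h2)
    calc _ ≤ 2 * (1 / (m : ℝ)) := by gcongr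
      _ = 2 / m := by ring

lemma exists_card_le_mul_of_isDynSeparated {ε : ℝ} (hε : 0 < ε) :
    ∃ C : ℕ, ∀ n ≥ 1, ∀ E : Finset (OnePoint (ℝ × ℝ)),
      IsDynSeparated (onePointExtend planeTranslation) n ε ↑E → E.card ≤ C * n := by
  obtain ⟨m, hm⟩ := exists_nat_gt (2 / ε)
  have hm0 : (0 : ℝ) < m := (by positivity : 0 < 2 / ε).trans hm
  have hmε : 2 / (m : ℝ) ≤ ε := by
    rw [div_lt_iff₀ hε] at hm
    rw [div_le_iff₀ hm0]
    linarith
  have hm1 : 1 ≤ m := by exact_mod_cast hm0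
  refine ⟨(m * m + m * (m + 1) + 1) * (m * m + m * m + 1) + 1, fun n hn E hE => ?_⟩
  refine (hE.card_le_of_code (stripCode m n) _ (stripCode_mem m n)
    fun x y hxy k hk => (dist_iterate_le_of_stripCode_eq hm1 hxy hk).trans hmε).trans ?_
  rw [Finset.card_insertNone, Finset.card_product, Int.card_Icc, Int.card_Icc]
  have h1 : (m * m + 1 - -(m * (m + n)) : ℤ).toNat = m * m + m * (m + n) + 1 := by
    have : (m * m + 1 - -(m * (m + n)) : ℤ) = ((m * m + m * (m + n) + 1 : ℕ) : ℤ) := by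
      push_cast
      ring
    rw [this, Int.toNat_natCast]
  have h2 : (m * m + 1 - -(m * m) : ℤ).toNat = m * m + m * m + 1 := by
    have : (m * m + 1 - -(m * m) : ℤ) = ((m * m + m * m + 1 : ℕ) : ℤ) := by
      push_cast
      ring
    rw [this, Int.toNat_natCast]
  rw [h1, h2, add_mul _ 1 n, one_mul, mul_right_comm]
  have h3 : m * m + m * (m + n) + 1 ≤ (m * m + m * (m + 1) + 1) * n := by
    nlinarith [Nat.mul_le_mul_left (m * m) hn, Nat.mul_le_mul_left m hn]
  exact add_le_add (Nat.mul_le_mul_right _ h3) hn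

lemma bddAbove_card_isDynSeparated {n : ℕ} {ε : ℝ} (hε : 0 < ε) :
    BddAbove {j | ∃ E : Finset (OnePoint (ℝ × ℝ)),
      IsDynSeparated (onePointExtend planeTranslation) n ε ↑E ∧ E.card = j} := by
  obtain ⟨C, hC⟩ := exists_card_le_mul_of_isDynSeparated hε
  refine ⟨C * (n + 1), ?_⟩
  rintro _ ⟨E, hE, rfl⟩
  refine hC (n + 1) n.succ_pos E fun x hx y hy hxy => ?_
  obtain ⟨k, hk, h⟩ := hE x hx y hy hxy
  exact ⟨k, hk.trans n.lt_succ_self, h⟩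

lemma one_half_le_dist_coe_zero {w : ℝ × ℝ} (hw : 1 ≤ ‖w‖) :
    1 / 2 ≤ dist ((0 : ℝ × ℝ) : OnePoint (ℝ × ℝ)) (w : OnePoint (ℝ × ℝ)) := by
  have h1 : (1 + ‖w‖ ^ 2)⁻¹ ≤ 1 / 2 := by
    rw [inv_le_comm₀ (by positivity) (by norm_num)]
    nlinarith
  have h2 : dist (1 + ‖(0 : ℝ × ℝ)‖ ^ 2)⁻¹ (1 + ‖w‖ ^ 2)⁻¹ ≤
      dist ((0 : ℝ × ℝ) : OnePoint (ℝ × ℝ)) (w : OnePoint (ℝ × ℝ)) :=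
    le_max_right _ _
  refine le_trans ?_ h2
  rw [Real.dist_eq, norm_zero]
  refine le_trans ?_ (le_abs_self _)
  norm_num at h1 ⊢
  linarith

lemma le_maxSep_planeTranslation (n : ℕ) :
    n ≤ maxSep (onePointExtend planeTranslation) n (1 / 4) := by
  have hinj : Function.Injective
      fun j : ℕ => (((-(j : ℝ), 0) : ℝ × ℝ) : OnePoint (ℝ × ℝ)) := by
    intro i j h
    simpa using h
  refine le_csSup (bddAbove_card_isDynSeparated (by norm_num))
    ⟨(Finset.range n).map ⟨_, hinj⟩, ?_, by simp⟩
  intro x hx y hy hxy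
  obtain ⟨i, hi, rfl⟩ := Finset.mem_map.mp (Finset.mem_coe.mp hx)
  obtain ⟨j, -, rfl⟩ := Finset.mem_map.mp (Finset.mem_coe.mp hy)
  have hij : i ≠ j := fun h => hxy (h ▸ rfl)
  refine ⟨i, Finset.mem_range.mp hi, ?_⟩
  simp only [Function.Embedding.coeFn_mk, planeTranslation_extend_iterate_coe, neg_add_cancel]
  refine lt_of_lt_of_le (by norm_num) (one_half_le_dist_coe_zero ?_)
  refine le_trans ?_ (le_max_left _ _)
  have h1 : (1 : ℤ) ≤ |-(j : ℤ) + i| := Int.one_le_abs (by omega)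
  change (1 : ℝ) ≤ |-(j : ℝ) + i|
  exact_mod_cast h1

/-- the translation `T(x,y) = (x+1, y)` has polynomial entropy `1`. -/
theorem polEntropy_planeTranslation_eq_one :
    polEntropy (onePointExtend planeTranslation) = 1 := by
  refine polEntropy_eq_one_of_linear (fun ε hε => ?_)
    ⟨1 / 4, by norm_num, le_maxSep_planeTranslation⟩
  obtain ⟨C, hC⟩ := exists_card_le_mul_of_isDynSeparated hε
  refine ⟨C, fun n hn => csSup_le' ?_⟩
  rintro _ ⟨E, hE, rfl⟩
  exact hC n hn E hE
end

section
/- (Monotonicity of coding entropy.) In the standing setting, let ℱ be a finite family of nonempty subsets of X∖{∞} with M(∪ℱ) < +∞, and let ℱ' be another finite family of nonempty subsets of X∖{∞} such that each element of ℱ' is included in some element of ℱ. Then h_pol(f;ℱ') ≤ h_pol(f;ℱ). -/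
open Filter Topology Set
open scoped ENNReal

/-- Topological entropy `h_top(f) = lim_{ε → 0} limsup_n (1/n) log S(n,ε)`. -/
noncomputable def topEntropy {X : Type*} [MetricSpace X] (f : X → X) : ℝ≥0∞ :=
  ⨆ (ε : ℝ) (_ : 0 < ε),
    Filter.atTop.limsup fun n : ℕ =>
      ENNReal.ofReal (Real.log (maxSep f n ε) / n)

/-- The set `A_n(ℱ)` of codings of orbit segments of length `n` relative to the finite
family `ℱ`: words `w` with letters in `ℱ ∪ {∞_ℱ}` (where `∞_ℱ` is the complement of `∪ℱ`)
for which some orbit segment `(x, f x, …, f^{n-1} x)` satisfies `f^k x ∈ w k` for all `k`. -/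
def codings {X : Type*} (f : X → X) (F : Finset (Set X)) (n : ℕ) : Set (Fin n → Set X) :=
  {w | (∀ k, w k ∈ F ∨ w k = (⋃₀ (F : Set (Set X)))ᶜ) ∧
      ∃ x : X, ∀ k : Fin n, f^[(k : ℕ)] x ∈ w k}

/-- Coding polynomial entropy of a finite family: `h_pol(f; ℱ) = limsup_n log #A_n(ℱ) / log n`.
For a single set `Y`, `h_pol(f; Y)` is `codingEntropy f {Y}`. -/
noncomputable def codingEntropy {X : Type*} (f : X → X) (F : Finset (Set X)) : ℝ≥0∞ :=
  Filter.atTop.limsup fun n : ℕ =>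
    ENNReal.ofReal (Real.log ((codings f F n).ncard) / Real.log n)

/-- The `n`-th iterate of a homeomorphism, for `n : ℤ`. -/
def zIter {X : Type*} [TopologicalSpace X] (f : X ≃ₜ X) (n : ℤ) (x : X) : X :=
  (f.toEquiv ^ n) x

/-- A set `Z` is wandering if `f^n(Z) ∩ Z = ∅` for every integer `n ≠ 0`. -/
def IsWanderingSet {X : Type*} [TopologicalSpace X] (f : X ≃ₜ X) (Z : Set X) : Prop :=
  ∀ n : ℤ, n ≠ 0 → zIter f n '' Z ∩ Z = ∅

/-- Standing setting: `p` (the point written `∞` in the paper) is a fixed point of `f`, and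
every other point is wandering, i.e. has a wandering neighborhood. -/
def StandingSetting {X : Type*} [TopologicalSpace X] (f : X ≃ₜ X) (p : X) : Prop :=
  f p = p ∧ ∀ x : X, x ≠ p → ∃ U ∈ 𝓝 x, IsWanderingSet f U

/-- `M(Y) = sup_{x ∈ X} #{n ∈ ℤ : f^n(x) ∈ Y}`. -/
noncomputable def orbitCount {X : Type*} [TopologicalSpace X] (f : X ≃ₜ X) (Y : Set X) : ℕ∞ :=
  ⨆ x : X, {n : ℤ | zIter f n x ∈ Y}.encard

/-- Local polynomial entropy `h^loc_pol(f; S)` of a finite set `S`: the limit, along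
decreasing neighborhood bases of the points of `S`, of the coding entropies of the
corresponding families of neighborhoods.  By monotonicity of the coding entropy this limit
equals the infimum of `h_pol(f; {U x : x ∈ S})` over all families `U` of respective
neighborhoods of the points of `S` such that `M(⋃_{x ∈ S} U x) < ∞` (such families exist,
and any decreasing neighborhood basis eventually consists of such sets). -/
noncomputable def localEntropy {X : Type*} [TopologicalSpace X] (f : X ≃ₜ X)
    (S : Finset X) : ℝ≥0∞ :=
  letI := Classical.decEq (Set X)
  ⨅ (U : X → Set X) (_ : ∀ x ∈ S, U x ∈ 𝓝 x)
    (_ : orbitCount f (⋃ x ∈ S, U x) < ⊤),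
    codingEntropy ⇑f (S.image U)

/-- The family `U` of sets (indexed by the points of `S`) is mutually singular: for every
`M` there are a point `x` and times `(N a)_{a ∈ S}` with `f^{N a}(x) ∈ U a` for all `a ∈ S`
and `|N a - N b| > M` for all `a ≠ b` in `S`. -/
def MutuallySingularFam {X : Type*} [TopologicalSpace X] (f : X ≃ₜ X) (S : Finset X)
    (U : X → Set X) : Prop :=
  ∀ M : ℕ, ∃ (x : X) (N : X → ℤ),
    (∀ a ∈ S, zIter f (N a) x ∈ U a) ∧
    ∀ a ∈ S, ∀ b ∈ S, a ≠ b → (M : ℤ) < |N a - N b|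

/-- A finite set `S` is singular if every family of respective neighborhoods of its points
is mutually singular. -/
def IsSingularSet {X : Type*} [TopologicalSpace X] (f : X ≃ₜ X) (S : Finset X) : Prop :=
  ∀ U : X → Set X, (∀ a ∈ S, U a ∈ 𝓝 a) → MutuallySingularFam f S U

theorem codings_finite {X : Type*} (f : X → X) (F : Finset (Set X)) (n : ℕ) :
    (codings f F n).Finite := by
  classical
  refine (Finset.finite_toSet
    (Fintype.piFinset fun _ : Fin n => insert (⋃₀ (F : Set (Set X)))ᶜ F)).subset ?_
  intro w hw
  simp only [Finset.mem_coe, Fintype.mem_piFinset, Finset.mem_insert]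
  exact fun k => (hw.1 k).symm

theorem zIter_natCast {X : Type*} [TopologicalSpace X] (f : X ≃ₜ X) (k : ℕ) (x : X) :
    zIter f (k : ℤ) x = f^[k] x := by
  rw [zIter, zpow_natCast, Equiv.Perm.coe_pow]
  rfl

/-- A coding has at most `M(∪ℱ)` letters in `ℱ`. -/
theorem card_filter_mem_le_orbitCount {X : Type*} [TopologicalSpace X] (f : X ≃ₜ X)
    (F : Finset (Set X)) {n : ℕ} {w : Fin n → Set X} (hw : w ∈ codings f F n)
    [DecidablePred fun k => w k ∈ F] :
    ((Finset.univ.filter fun k => w k ∈ F).card : ℕ∞) ≤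
      orbitCount f (⋃₀ (F : Set (Set X))) := by
  obtain ⟨-, x, hx⟩ := hw
  have hinj : Function.Injective fun k : Fin n => ((k : ℕ) : ℤ) :=
    fun a b h => Fin.ext (Int.ofNat_inj.1 h)
  rw [← Set.encard_coe_eq_coe_finsetCard, ← hinj.encard_image]
  refine le_trans (Set.encard_le_encard ?_)
    (le_iSup (fun x => {m : ℤ | zIter f m x ∈ ⋃₀ (F : Set (Set X))}.encard) x)
  rintro _ ⟨k, hk, rfl⟩
  simp only [Finset.coe_filter, Finset.mem_univ, true_and, Set.mem_ofPred_eq] at hk ⊢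
  rw [zIter_natCast]
  exact ⟨w k, hk, hx k⟩

/-- Every coding relative to a refinement `ℱ'` of `ℱ` is subordinate to a coding relative
to `ℱ`. -/
theorem exists_coding_of_refinement {X : Type*} (f : X → X) {F F' : Finset (Set X)}
    (hsub : ∀ Y' ∈ F', ∃ Y ∈ F, Y' ⊆ Y) {n : ℕ} {w' : Fin n → Set X}
    (hw' : w' ∈ codings f F' n) :
    ∃ w ∈ codings f F n, ∀ k, w k ∉ F → w' k = (⋃₀ (F' : Set (Set X)))ᶜ := by
  obtain ⟨hl, x, hx⟩ := hw'
  have key : ∀ k : Fin n, ∃ Y : Set X, (Y ∈ F ∨ Y = (⋃₀ (F : Set (Set X)))ᶜ) ∧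
      f^[(k : ℕ)] x ∈ Y ∧ (Y ∉ F → w' k = (⋃₀ (F' : Set (Set X)))ᶜ) := by
    intro k
    rcases hl k with h | h
    · obtain ⟨Y, hY, hs⟩ := hsub _ h
      exact ⟨Y, Or.inl hY, hs (hx k), fun hn => absurd hY hn⟩
    · by_cases hu : f^[(k : ℕ)] x ∈ ⋃₀ (F : Set (Set X))
      · obtain ⟨Y, hY, hxY⟩ := hu
        exact ⟨Y, Or.inl hY, hxY, fun _ => h⟩
      · exact ⟨_, Or.inr rfl, hu, fun _ => h⟩
  choose w hw using key
  exact ⟨w, ⟨fun k => (hw k).1, x, fun k => (hw k).2.1⟩, fun k => (hw k).2.2⟩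

theorem ncard_codings_le_of_refinement {X : Type*} [TopologicalSpace X] (f : X ≃ₜ X)
    {F F' : Finset (Set X)} (hsub : ∀ Y' ∈ F', ∃ Y ∈ F, Y' ⊆ Y) {M : ℕ}
    (hM : orbitCount f (⋃₀ (F : Set (Set X))) ≤ M) (n : ℕ) :
    (codings f F' n).ncard ≤ (F'.card + 1) ^ M * (codings f F n).ncard := by
  classical
  choose! φ hφ hφ' using fun w' (hw' : w' ∈ codings f F' n) =>
    exists_coding_of_refinement f hsub hw'
  rw [Set.ncard_eq_toFinset_card _ (codings_finite f F' n),
    Set.ncard_eq_toFinset_card _ (codings_finite f F n)]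
  refine Finset.card_le_mul_card_image_of_maps_to (f := φ) (fun w' hw' => ?_) _ ?_
  · rw [Set.Finite.mem_toFinset] at hw' ⊢
    exact hφ w' hw'
  · intro w hw
    rw [Set.Finite.mem_toFinset] at hw
    set c : Set X := (⋃₀ (F' : Set (Set X)))ᶜ with hc
    have hfiber : ((codings_finite f F' n).toFinset.filter fun w' => φ w' = w) ⊆
        Fintype.piFinset fun k => if w k ∈ F then insert c F' else {c} := by
      intro w' hw'
      rw [Finset.mem_filter, Set.Finite.mem_toFinset] at hw'
      obtain ⟨hw', rfl⟩ := hw'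
      rw [Fintype.mem_piFinset]
      intro k
      split_ifs with h
      · exact Finset.mem_insert.2 (hw'.1 k).symm
      · exact Finset.mem_singleton.2 (hφ' w' hw' k h)
    have hcard : (Finset.univ.filter fun k => w k ∈ F).card ≤ M := by
      exact_mod_cast (card_filter_mem_le_orbitCount f F hw).trans hM
    calc _ ≤ _ := Finset.card_le_card hfiber
      _ = (insert c F').card ^ (Finset.univ.filter fun k => w k ∈ F).card := by
        rw [Fintype.card_piFinset]
        simp only [apply_ite Finset.card, Finset.card_singleton]
        rw [Finset.prod_ite, Finset.prod_const, Finset.prod_const_one, mul_one]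
      _ ≤ (F'.card + 1) ^ (Finset.univ.filter fun k => w k ∈ F).card :=
        Nat.pow_le_pow_left (Finset.card_insert_le _ _) _
      _ ≤ (F'.card + 1) ^ M := Nat.pow_le_pow_right (Nat.succ_pos _) hcard

/-- A bounded multiplicative factor does not change the polynomial growth rate. -/
theorem limsup_log_div_log_le_of_le_mul {a b : ℕ → ℕ} {K : ℕ} (h : ∀ n, a n ≤ K * b n) :
    atTop.limsup (fun n : ℕ => ENNReal.ofReal (Real.log (a n) / Real.log n)) ≤
      atTop.limsup (fun n : ℕ => ENNReal.ofReal (Real.log (b n) / Real.log n)) := by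
  have hlim : Tendsto (fun n : ℕ => ENNReal.ofReal (Real.log K / Real.log n)) atTop (𝓝 0) := by
    rw [← ENNReal.ofReal_zero]
    exact ENNReal.tendsto_ofReal
      ((Real.tendsto_log_atTop.comp tendsto_natCast_atTop_atTop).const_div_atTop _)
  have hlog : ∀ n, Real.log (a n) ≤ Real.log K + Real.log (b n) := by
    intro n
    rcases Nat.eq_zero_or_pos (a n) with h0 | h0
    · rw [h0, Nat.cast_zero, Real.log_zero]
      exact add_nonneg (Real.log_natCast_nonneg _) (Real.log_natCast_nonneg _)
    · have hKb : 0 < K * b n := h0.trans_le (h n)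
      have hK : K ≠ 0 := by rintro rfl; simp at hKb
      have hb : b n ≠ 0 := by intro hb; simp [hb] at hKb
      rw [← Real.log_mul (by exact_mod_cast hK) (by exact_mod_cast hb)]
      exact Real.log_le_log (by exact_mod_cast h0) (by exact_mod_cast h n)
  calc _ ≤ atTop.limsup ((fun n : ℕ => ENNReal.ofReal (Real.log K / Real.log n)) +
        fun n : ℕ => ENNReal.ofReal (Real.log (b n) / Real.log n)) := by
        refine limsup_le_limsup (Eventually.of_forall fun n => ?_)
        refine le_trans (ENNReal.ofReal_le_ofReal ?_) ENNReal.ofReal_add_le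
        rw [← add_div]
        exact div_le_div_of_nonneg_right (hlog n) (Real.log_natCast_nonneg n)
    _ = _ := ENNReal.limsup_add_of_left_tendsto_zero hlim _

/-- monotonicity of coding entropy: if each element of `ℱ'` is included in
some element of `ℱ` and `M(∪ℱ) < ∞`, then `h_pol(f; ℱ') ≤ h_pol(f; ℱ)`. -/
theorem codingEntropy_monotone {X : Type*} [MetricSpace X] [CompactSpace X]
    (f : X ≃ₜ X) (p : X) (hst : StandingSetting f p)
    (F F' : Finset (Set X))
    (hF : ∀ Y ∈ F, Y.Nonempty ∧ p ∉ Y)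
    (hF' : ∀ Y ∈ F', Y.Nonempty ∧ p ∉ Y)
    (hM : orbitCount f (⋃₀ (F : Set (Set X))) < ⊤)
    (hsub : ∀ Y' ∈ F', ∃ Y ∈ F, Y' ⊆ Y) :
    codingEntropy ⇑f F' ≤ codingEntropy ⇑f F := by
  obtain ⟨M, hM⟩ := ENat.ne_top_iff_exists.1 hM.ne
  exact limsup_log_div_log_le_of_le_mul (ncard_codings_le_of_refinement f hsub hM.ge)
end
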